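/- For all sufficiently small ε > 0, the first singular homology group H_1(S_ε \ X; ℤ) of the complement of the link of X in the sphere S_ε is a free abelian group of rank r, i.e. H_1(S_ε \ X; ℤ) ≅ ℤ^r. -/

import Mathlib

/-!
STATEMENT 0: For a germ `X = ⋃ᵢ Dᵢ` of `r` irreducible hypersurface germs in `ℂ^{n+1}`
with an isolated non-normal crossing (INNC) at `0`, for all sufficiently small `ε > 0`
one has `H₁(S_ε \ X; ℤ) ≅ ℤ^r`.
-/

open CategoryTheory

/-- The singular chain complex functor (with coefficients in a commutative ring `R`),
obtained from the singular simplicial set by applying the free `R`-module functor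
and taking the alternating face map complex. -/
noncomputable def singularChainComplexFunctor (R : Type) [CommRing R] :
    TopCat.{0} ⥤ ChainComplex (ModuleCat R) ℕ :=
  TopCat.toSSet ⋙ ((SimplicialObject.whiskering _ _).obj (ModuleCat.free R)) ⋙
    AlgebraicTopology.alternatingFaceMapComplex _

/-- Singular homology of a topological space with coefficients in `R`. -/
noncomputable def singularHomologyFunctor (R : Type) [CommRing R] (k : ℕ) :
    TopCat.{0} ⥤ ModuleCat R :=
  singularChainComplexFunctor R ⋙ HomologicalComplex.homologyFunctor _ _ k

section
namespace INNC

section superposition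
variable {K : Type} [TopologicalSpace K] [CompactSpace K]
variable {E : Type} [NormedAddCommGroup E] [NormedSpace ℂ E]

/-- Superposition multilinear map. -/
noncomputable def supMul (n : ℕ) (q : ContinuousMultilinearMap ℂ (fun _ : Fin n => E) ℂ) :
    ContinuousMultilinearMap ℂ (fun _ : Fin n => C(K, E)) C(K, ℂ) :=
  MultilinearMap.mkContinuous
    { toFun := fun φ => ⟨fun t => q (fun i => φ i t), by
        exact q.cont.comp (continuous_pi fun i => (φ i).continuous)⟩
      map_update_add' := by
        intro _ m i x y
        ext t
        have h : ∀ z : C(K,E), (fun j => (Function.update m i z) j t) = Function.update (fun j => m j t) i (z t) := by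
          intro z; ext j
          by_cases hj : j = i
          · subst hj; simp
          · simp [hj]
        simp [h]
      map_update_smul' := by
        intro _ m i c x
        ext t
        have h : ∀ z : C(K,E), (fun j => (Function.update m i z) j t) = Function.update (fun j => m j t) i (z t) := by
          intro z; ext j
          by_cases hj : j = i
          · subst hj; simp
          · simp [hj]
        simp [h] }
    ‖q‖ (by
      intro φ
      rw [ContinuousMap.norm_le _ (by positivity)]
      intro t
      refine (q.le_opNorm _).trans ?_
      gcongr with i
      exact (φ i).norm_coe_le_norm t)

theorem supMul_apply (n : ℕ) (q : ContinuousMultilinearMap ℂ (fun _ : Fin n => E) ℂ) (φ : Fin n → C(K, E)) (t : K) :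
    supMul n q φ t = q (fun i => φ i t) := rfl

theorem norm_supMul_le (n : ℕ) (q : ContinuousMultilinearMap ℂ (fun _ : Fin n => E) ℂ) :
    ‖(supMul n q : ContinuousMultilinearMap ℂ (fun _ : Fin n => C(K, E)) C(K, ℂ))‖ ≤ ‖q‖ :=
  MultilinearMap.mkContinuous_norm_le _ (norm_nonneg _) _

/-- Composition with an analytic function is analytic near `0` on the space of continuous maps. -/
theorem exists_superposition {g : E → ℂ} (hg : AnalyticAt ℂ g 0) :
    ∃ R > (0:ℝ), ∃ G : C(K, E) → C(K, ℂ),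
      (∀ φ, ‖φ‖ < R → AnalyticAt ℂ G φ) ∧ ∀ φ, ‖φ‖ < R → ∀ t, G φ t = g (φ t) := by
  obtain ⟨p, ρ, hp⟩ := hg
  let P : FormalMultilinearSeries ℂ C(K,E) C(K,ℂ) := fun n => supMul n (p n)
  have hrad : p.radius ≤ P.radius := by
    apply FormalMultilinearSeries.radius_le_of_le
    intro n
    exact norm_supMul_le n (p n)
  have hρP : ρ ≤ P.radius := hp.r_le.trans hrad
  have hPpos : 0 < P.radius := lt_of_lt_of_le hp.r_pos hρP
  have hball := (P.hasFPowerSeriesOnBall hPpos).mono hp.r_pos hρP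
  obtain ⟨R, hR0, hRρ⟩ : ∃ R : NNReal, 0 < R ∧ (R : ENNReal) ≤ ρ := by
    obtain ⟨R, h1, h2⟩ := ENNReal.lt_iff_exists_nnreal_btwn.1 hp.r_pos
    exact ⟨R, by exact_mod_cast h1, h2.le⟩
  have key : ∀ {F : Type} [NormedAddCommGroup F], ∀ x : F, ‖x‖ < R → x ∈ Metric.eball (0:F) ρ := by
    intro F _ x hx
    rw [Metric.mem_eball, edist_zero_right]
    refine lt_of_lt_of_le ?_ hRρ
    rw [← ofReal_norm, ENNReal.ofReal_lt_coe_iff (norm_nonneg _)]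
    exact hx
  refine ⟨R, by exact_mod_cast hR0, P.sum, ?_, ?_⟩
  · intro φ hφ
    exact hball.analyticAt_of_mem (key φ hφ)
  · intro φ hφ t
    have h1 := hball.hasSum (key φ hφ)
    have h2 : HasSum (fun n => P n (fun _ => φ) t) (P.sum φ t) := by
      have := (ContinuousMap.evalCLM ℂ t : C(K,ℂ) →L[ℂ] ℂ).hasSum h1
      simpa using this
    have h3 := hp.hasSum (key (φ t) (lt_of_le_of_lt (φ.norm_coe_le_norm t) hφ))
    simp only [zero_add] at h3
    exact h2.unique h3

end superposition
end INNC
end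

section
namespace INNC
open Topology

/-- The parameter circle. -/
abbrev KK : Type := Set.Icc (0:ℝ) (2 * Real.pi)

theorem twopi_nonneg : (0:ℝ) ≤ 2 * Real.pi := by positivity

/-- Mean value functional. -/
noncomputable def JJ : C(KK, ℂ) →L[ℂ] ℂ :=
  LinearMap.mkContinuous
    { toFun := fun φ => (2 * Real.pi : ℂ)⁻¹ * ∫ θ in (0:ℝ)..(2*Real.pi), φ (Set.projIcc 0 (2*Real.pi) twopi_nonneg θ)
      map_add' := by
        intro φ ψ
        have h : ∀ φ : C(KK,ℂ), IntervalIntegrable (fun θ => φ (Set.projIcc 0 (2*Real.pi) twopi_nonneg θ)) MeasureTheory.volume 0 (2*Real.pi) := by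
          intro φ
          exact (φ.continuous.comp continuous_projIcc).intervalIntegrable _ _
        simp only [ContinuousMap.add_apply]
        rw [intervalIntegral.integral_add (h φ) (h ψ)]
        ring
      map_smul' := by
        intro c φ
        simp only [ContinuousMap.smul_apply, smul_eq_mul, RingHom.id_apply]
        rw [intervalIntegral.integral_const_mul]
        ring }
    1 (by
      intro φ
      have h := intervalIntegral.norm_integral_le_of_norm_le_const (a := 0) (b := 2*Real.pi) (C := ‖φ‖)
        (f := fun θ => φ (Set.projIcc 0 (2*Real.pi) twopi_nonneg θ)) (fun x _ => φ.norm_coe_le_norm _)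
      have hpi := Real.pi_pos
      rw [sub_zero, abs_of_pos (by positivity)] at h
      simp only [LinearMap.coe_mk, AddHom.coe_mk, norm_mul, norm_inv, one_mul]
      rw [Complex.norm_ofNat, Complex.norm_real, Real.norm_eq_abs, abs_of_pos hpi]
      rw [inv_mul_le_iff₀ (by positivity)]
      linarith)

/-- The circle as a continuous function. -/
noncomputable def zet (s : ℝ) : C(KK, ℂ) := ⟨fun θ => circleMap 0 s θ, by
  exact (continuous_circleMap 0 s).comp continuous_subtype_val⟩

theorem norm_zet (s : ℝ) (hs : 0 < s) (θ : KK) : ‖zet s θ‖ = s := by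
  simp [zet, abs_of_pos hs]

theorem JJ_eq {F : ℂ → ℂ} (s : ℝ) (φ : C(KK, ℂ)) (h : ∀ θ, φ θ = F (zet s θ)) :
    JJ φ = (2 * Real.pi : ℂ)⁻¹ * ∫ θ in (0:ℝ)..(2*Real.pi), F (circleMap 0 s θ) := by
  change (2 * Real.pi : ℂ)⁻¹ * ∫ θ in (0:ℝ)..(2*Real.pi), φ (Set.projIcc 0 (2*Real.pi) twopi_nonneg θ) = _
  congr 1
  apply intervalIntegral.integral_congr
  intro θ hθ
  rw [Set.uIcc_of_le twopi_nonneg] at hθ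
  simp only [h]
  rw [Set.projIcc_of_mem _ hθ]
  rfl

theorem JJ_cauchy {h : ℂ → ℂ} {s : ℝ} (hs : 0 < s) (hh : DifferentiableOn ℂ h (Metric.closedBall 0 s))
    {t : ℂ} (ht : ‖t‖ < s) (φ : C(KK, ℂ)) (hφ : ∀ θ, φ θ = h (zet s θ) * (zet s θ - t)⁻¹ * zet s θ) :
    JJ φ = h t := by
  rw [JJ_eq (F := fun z => h z * (z - t)⁻¹ * z) s φ hφ]
  have hc := hh.circleIntegral_sub_inv_smul (w := t) (by simpa using ht)
  rw [circleIntegral] at hc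
  have hI : ∫ θ in (0:ℝ)..(2*Real.pi), deriv (circleMap 0 s) θ • (circleMap 0 s θ - t)⁻¹ • h (circleMap 0 s θ)
     = Complex.I * ∫ θ in (0:ℝ)..(2*Real.pi), h (circleMap 0 s θ) * (circleMap 0 s θ - t)⁻¹ * circleMap 0 s θ := by
    rw [← intervalIntegral.integral_const_mul]
    congr 1
    ext θ
    simp [deriv_circleMap]
    ring
  rw [hI] at hc
  have hpi : (Real.pi : ℂ) ≠ 0 := by exact_mod_cast Real.pi_ne_zero
  have : ∫ θ in (0:ℝ)..(2*Real.pi), h (circleMap 0 s θ) * (circleMap 0 s θ - t)⁻¹ * circleMap 0 s θ = 2 * Real.pi * h t := by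
    apply mul_left_cancel₀ Complex.I_ne_zero
    rw [hc]; simp; ring
  rw [this]
  field_simp

theorem ringInverse_apply {u : C(KK, ℂ)} (hu : IsUnit u) (θ : KK) : Ring.inverse u θ = (u θ)⁻¹ := by
  have h := Ring.mul_inverse_cancel u hu
  have := congrArg (fun φ : C(KK,ℂ) => φ θ) h
  simp only [ContinuousMap.mul_apply, ContinuousMap.one_apply] at this
  exact eq_inv_of_mul_eq_one_right this

theorem isUnit_of_ne {u : C(KK, ℂ)} (hu : ∀ θ, u θ ≠ 0) : IsUnit u := by
  refine IsUnit.of_mul_eq_one ⟨fun θ => (u θ)⁻¹, u.continuous.inv₀ hu⟩ ?_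
  ext θ
  simp [hu θ]

theorem weier_div {P : Type} [NormedAddCommGroup P] [NormedSpace ℂ P] (d : ℕ) (w : Fin d → P → ℂ)
    (hw : ∀ k, AnalyticAt ℂ (w k) 0) (hw0 : ∀ k, w k 0 = 0) (g : P × ℂ → ℂ) (hg : AnalyticAt ℂ g 0) :
    ∃ (q : P × ℂ → ℂ) (c : Fin d → P → ℂ), AnalyticAt ℂ q 0 ∧ (∀ j, AnalyticAt ℂ (c j) 0) ∧
      ∀ᶠ y in 𝓝 (0 : P × ℂ), g y = q y * (y.2 ^ d + ∑ k, w k y.1 * y.2 ^ (k:ℕ)) + ∑ j, c j y.1 * y.2 ^ (j:ℕ) := by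
  obtain ⟨R₁, hR₁, G, hG, hGv⟩ := exists_superposition (K := KK) hg
  obtain ⟨R₂, hR₂, hgan⟩ := Metric.eventually_nhds_iff_ball.1 hg.eventually_analyticAt
  set s : ℝ := min R₁ R₂ / 2 with hs_def
  have hmin : 0 < min R₁ R₂ := lt_min hR₁ hR₂
  have hs : 0 < s := by positivity
  have hs1 : s < R₁ := by have := min_le_left R₁ R₂; linarith
  have hs2 : s < R₂ := by have := min_le_right R₁ R₂; linarith
  set ζ := zet s with hζ
  have hζ0 : ∀ θ, ζ θ ≠ 0 := fun θ => by rw [← norm_pos_iff, norm_zet s hs]; exact hs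
  -- the map x ↦ (θ ↦ (x, ζ θ))
  let A : P → C(KK, P × ℂ) := fun x => (ContinuousMap.const KK x).prodMk ζ
  have hA : AnalyticAt ℂ A 0 := by
    let L : P →L[ℂ] C(KK, P × ℂ) := LinearMap.mkContinuous
      { toFun := fun x => (ContinuousMap.const KK x).prodMk 0
        map_add' := by intro x y; ext θ <;> simp
        map_smul' := by intro x y; ext θ <;> simp } 1 (by
        intro x
        rw [ContinuousMap.norm_le _ (by positivity)]
        intro θ
        simp [Prod.norm_def])
    have : A = fun x => L x + (ContinuousMap.const KK (0:P)).prodMk ζ := by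
      ext x θ
      · simp [A, L]
      · simp [A, L]
    rw [this]
    exact (L.analyticAt 0).add analyticAt_const
  have hAn : ∀ x, ‖x‖ < s → ‖A x‖ < R₁ := by
    intro x hx
    refine lt_of_le_of_lt ?_ hs1
    rw [ContinuousMap.norm_le _ hs.le]
    intro θ
    rw [Prod.norm_def]
    exact max_le hx.le (norm_zet s hs θ).le
  -- the polynomial
  let wh : ℕ → P → ℂ := fun k x => if h : k < d then w ⟨k, h⟩ x else 1
  have hwh : ∀ k, AnalyticAt ℂ (wh k) 0 := by
    intro k
    by_cases h : k < d
    · simp only [wh, h, dif_pos]; exact hw _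
    · simp only [wh, h, dif_neg, not_false_eq_true]; exact analyticAt_const
  have hW : ∀ (x : P) (t : ℂ), t ^ d + ∑ k, w k x * t ^ (k:ℕ) = ∑ k ∈ Finset.range (d+1), wh k x * t ^ k := by
    intro x t
    rw [Finset.sum_range_succ, Finset.sum_range]
    have : wh d x = 1 := by simp [wh]
    rw [this, one_mul, add_comm]
    congr 1
    apply Finset.sum_congr rfl
    intro k _
    simp [wh]
  let Wf : P → C(KK, ℂ) := fun x => ∑ k ∈ Finset.range (d+1), wh k x • ζ ^ k
  have hWf : AnalyticAt ℂ Wf 0 := by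
    apply Finset.analyticAt_fun_sum
    intro k _
    exact (hwh k).fun_smul analyticAt_const
  have hWfv : ∀ x θ, Wf x θ = ∑ k ∈ Finset.range (d+1), wh k x * (ζ θ) ^ k := by
    intro x θ
    simp [Wf, ContinuousMap.sum_apply]
  have hWf0 : IsUnit (Wf 0) := by
    apply isUnit_of_ne
    intro θ
    rw [hWfv, ← hW]
    simp [hw0, hζ0]
  let T : ℂ → C(KK, ℂ) := fun t => ζ - t • 1
  have hT : AnalyticAt ℂ T 0 := by
    exact analyticAt_const.fun_sub (analyticAt_id.fun_smul analyticAt_const)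
  have hT0 : IsUnit (T 0) := isUnit_of_ne (fun θ => by simp [T, hζ0])
  have hiW : AnalyticAt ℂ (fun x => Ring.inverse (Wf x)) 0 := by
    obtain ⟨u, hu⟩ := hWf0
    have := analyticAt_inverse (𝕜 := ℂ) u
    rw [hu] at this
    exact this.comp hWf
  have hiT : AnalyticAt ℂ (fun t => Ring.inverse (T t)) 0 := by
    obtain ⟨u, hu⟩ := hT0
    have := analyticAt_inverse (𝕜 := ℂ) u
    rw [hu] at this
    exact this.comp hT
  have hGA : AnalyticAt ℂ (fun x => G (A x)) 0 := by
    refine AnalyticAt.comp (g := G) (hG _ (hAn 0 ?_)) hA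
    simpa using hs
  let Q : P → C(KK, ℂ) := fun x => G (A x) * Ring.inverse (Wf x) * ζ
  have hQ : AnalyticAt ℂ Q 0 := (hGA.fun_mul hiW).fun_mul analyticAt_const
  let q : P × ℂ → ℂ := fun y => JJ (Q y.1 * Ring.inverse (T y.2))
  let c : Fin d → P → ℂ := fun j x => ∑ k ∈ Finset.range (d+1), if (j:ℕ) < k then wh k x * JJ (Q x * ζ ^ (k - 1 - j)) else 0
  refine ⟨q, c, ?_, ?_, ?_⟩
  · refine (JJ.analyticAt _).comp ?_
    refine AnalyticAt.fun_mul ?_ ?_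
    · exact AnalyticAt.comp (f := fun y : P × ℂ => y.1) (x := 0) hQ (analyticAt_fst)
    · exact AnalyticAt.comp (g := fun t => Ring.inverse (T t)) (f := fun y : P × ℂ => y.2) (x := 0) hiT (analyticAt_snd)
  · intro j
    apply Finset.analyticAt_fun_sum
    intro k _
    split_ifs
    · refine (hwh k).fun_mul ?_
      exact AnalyticAt.comp (g := JJ) (JJ.analyticAt _) (hQ.fun_mul analyticAt_const)
    · exact analyticAt_const
  · have e1 : ∀ᶠ y in 𝓝 (0 : P × ℂ), IsUnit (Wf y.1) := by
      have : ContinuousAt (fun y : P × ℂ => Wf y.1) 0 :=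
        ContinuousAt.comp (f := fun y : P × ℂ => y.1) (x := 0) hWf.continuousAt continuousAt_fst
      exact this.eventually (Units.isOpen.mem_nhds hWf0)
    have e2 : ∀ᶠ y in 𝓝 (0 : P × ℂ), ‖y‖ < s := by
      have := Metric.ball_mem_nhds (0 : P × ℂ) hs
      filter_upwards [this] with y hy
      simpa using hy
    filter_upwards [e1, e2] with y hy1 hy2
    obtain ⟨x, t⟩ := y
    simp only at hy1 ⊢
    have hx : ‖x‖ < s := lt_of_le_of_lt (norm_fst_le (x,t)) hy2
    have ht : ‖t‖ < s := lt_of_le_of_lt (norm_snd_le (x,t)) hy2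
    have hzt : ∀ θ, ζ θ - t ≠ 0 := by
      intro θ h
      have : ‖ζ θ‖ = ‖t‖ := by rw [sub_eq_zero.1 h]
      rw [norm_zet s hs] at this
      linarith
    have hTt : IsUnit (T t) := isUnit_of_ne (fun θ => by simpa [T] using hzt θ)
    have hgd : DifferentiableOn ℂ (fun z => g (x, z)) (Metric.closedBall 0 s) := by
      intro z hz
      have : AnalyticAt ℂ g (x, z) := hgan _ (by
        rw [mem_ball_zero_iff, Prod.norm_def]
        exact max_lt (hx.trans hs2) (lt_of_le_of_lt (by simpa using hz) hs2))
      have h2 : DifferentiableAt ℂ (fun z : ℂ => (x, z)) z := by fun_prop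
      exact (DifferentiableAt.comp z this.differentiableAt h2).differentiableWithinAt
    have hWne : ∀ θ, Wf x θ ≠ 0 := by
      intro θ h0
      have := congrArg (fun φ : C(KK,ℂ) => φ θ) (Ring.mul_inverse_cancel _ hy1)
      simp [h0] at this
    have hmain : JJ (G (A x) * Ring.inverse (T t) * ζ) = g (x, t) := by
      refine JJ_cauchy (h := fun z => g (x, z)) hs hgd ht _ ?_
      intro θ
      simp only [ContinuousMap.mul_apply]
      rw [ringInverse_apply hTt, hGv _ (hAn x hx)]
      simp [A, T, hζ]
    rw [← hmain, hW]
    have hsplit : G (A x) * Ring.inverse (T t) * ζ =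
        (∑ k ∈ Finset.range (d+1), wh k x * t ^ k) • (Q x * Ring.inverse (T t)) +
        ∑ k ∈ Finset.range (d+1), wh k x • ∑ j ∈ Finset.range k, (t ^ j) • (Q x * ζ ^ (k - 1 - j)) := by
      ext θ
      simp only [ContinuousMap.mul_apply, ContinuousMap.add_apply, ContinuousMap.smul_apply, ContinuousMap.sum_apply,
        smul_eq_mul, ContinuousMap.pow_apply, Q]
      rw [ringInverse_apply hTt, ringInverse_apply hy1]
      have hTv : T t θ = ζ θ - t := by simp [T]
      rw [hTv]
      have hWn := hWne θ
      have hz := hzt θ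
      have hgs : ∀ k, ∑ j ∈ Finset.range k, t ^ j * (G (A x) θ * (Wf x θ)⁻¹ * ζ θ * (ζ θ) ^ (k - 1 - j)) =
         (G (A x) θ * (Wf x θ)⁻¹ * ζ θ) * ((ζ θ) ^ k - t ^ k) * (ζ θ - t)⁻¹ := by
        intro k
        have := geom_sum₂_mul t (ζ θ) k
        rw [eq_mul_inv_iff_mul_eq₀ hz]
        have h3 : (ζ θ)^k - t^k = (∑ i ∈ Finset.range k, t ^ i * ζ θ ^ (k - 1 - i)) * (ζ θ - t) := by
          linear_combination this
        rw [h3, ← mul_assoc, Finset.mul_sum]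
        congr 1
        apply Finset.sum_congr rfl
        intro j _
        ring
      simp only [hgs]
      have h4 : ∑ k ∈ Finset.range (d+1), wh k x * (G (A x) θ * (Wf x θ)⁻¹ * ζ θ * (ζ θ ^ k - t ^ k) * (ζ θ - t)⁻¹)
        = (G (A x) θ * (Wf x θ)⁻¹ * ζ θ * (ζ θ - t)⁻¹) * (Wf x θ - ∑ k ∈ Finset.range (d+1), wh k x * t ^ k) := by
        rw [hWfv, ← Finset.sum_sub_distrib, Finset.mul_sum]
        apply Finset.sum_congr rfl
        intro j _
        ring
      rw [h4]
      field_simp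
      ring
    rw [hsplit, map_add, map_smul, smul_eq_mul, mul_comm]
    congr 1
    simp only [c, map_sum, map_smul, smul_eq_mul]
    simp only [Finset.sum_mul]
    rw [Finset.sum_comm]
    apply Finset.sum_congr rfl
    intro k hk
    have hkd : k ≤ d := by have := Finset.mem_range.1 hk; omega
    have h5 : ∑ j : Fin d, (if (j:ℕ) < k then wh k x * JJ (Q x * ζ ^ (k - 1 - j)) else 0) * t ^ (j:ℕ) =
      ∑ j ∈ Finset.range d, (if (j:ℕ) < k then wh k x * JJ (Q x * ζ ^ (k - 1 - j)) else 0) * t ^ (j:ℕ) := by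
      rw [Finset.sum_range]
    rw [h5]
    obtain ⟨e, rfl⟩ := Nat.exists_eq_add_of_le hkd
    rw [Finset.sum_range_add]
    rw [Finset.mul_sum]
    have h6 : ∑ j ∈ Finset.range e, (if k + j < k then wh k x * JJ (Q x * ζ ^ (k - 1 - (k + j))) else 0) * t ^ (k+j) = 0 := by
      apply Finset.sum_eq_zero
      intro j _
      simp
    rw [h6, add_zero]
    apply Finset.sum_congr rfl
    intro j hj
    rw [if_pos (Finset.mem_range.1 hj)]
    ring

end INNC
end

section
namespace INNC
open Topology

theorem poly_vanish : ∀ (d : ℕ) (a : Fin d → ℂ) (h : ℂ → ℂ), ContinuousAt h 0 →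
    (∀ᶠ t in 𝓝[≠] (0:ℂ), ∑ j, a j * t ^ (j:ℕ) = t ^ d * h t) → a = 0 := by
  intro d
  induction d with
  | zero => intro a h _ _; exact Subsingleton.elim _ _
  | succ d ih =>
    intro a h hc he
    have h0 : a 0 = 0 := by
      have l1 : Filter.Tendsto (fun t : ℂ => ∑ j, a j * t ^ (j:ℕ)) (𝓝[≠] 0) (𝓝 (a 0)) := by
        have : ContinuousAt (fun t : ℂ => ∑ j, a j * t ^ (j:ℕ)) 0 := by fun_prop
        have h2 := this.tendsto.mono_left (nhdsWithin_le_nhds (s := {0}ᶜ))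
        simpa [Fin.sum_univ_succ] using h2
      have l2 : Filter.Tendsto (fun t : ℂ => t ^ (d+1) * h t) (𝓝[≠] 0) (𝓝 0) := by
        have : ContinuousAt (fun t : ℂ => t ^ (d+1) * h t) 0 := by fun_prop
        have h2 := this.tendsto.mono_left (nhdsWithin_le_nhds (s := {0}ᶜ))
        simpa using h2
      exact tendsto_nhds_unique (l1.congr' he) l2
    have h1 : (fun j : Fin d => a j.succ) = 0 := by
      apply ih _ h hc
      filter_upwards [he, self_mem_nhdsWithin] with t ht htne
      have htne : t ≠ 0 := htne
      rw [Fin.sum_univ_succ, h0] at ht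
      apply mul_left_cancel₀ htne
      rw [Finset.mul_sum]
      simp only [Fin.val_succ, zero_mul, zero_add] at ht
      rw [pow_succ'] at ht
      rw [← mul_assoc, ← ht]
      apply Finset.sum_congr rfl
      intro j _
      rw [pow_succ]; ring
    ext j
    refine Fin.cases h0 (fun j => congrFun h1 j) j

theorem isInvertible_of_inj {V : Type} [NormedAddCommGroup V] [NormedSpace ℂ V] [FiniteDimensional ℂ V]
    (L : V →L[ℂ] V) (h : ∀ v, L v = 0 → v = 0) : L.IsInvertible := by
  have hi : Function.Injective (L : V →ₗ[ℂ] V) := by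
    rw [injective_iff_map_eq_zero]; exact h
  refine ⟨(LinearEquiv.ofBijective (L : V →ₗ[ℂ] V) ⟨hi, LinearMap.injective_iff_surjective.1 hi⟩).toContinuousLinearEquiv, ?_⟩
  ext v
  rfl

theorem weier_prep {P : Type} [NormedAddCommGroup P] [NormedSpace ℂ P] [CompleteSpace P] (d : ℕ)
    (g : P × ℂ → ℂ) (hg : AnalyticAt ℂ g 0) (u : ℂ → ℂ) (hu : ContinuousAt u 0) (hu0 : u 0 ≠ 0)
    (hgu : ∀ᶠ t in 𝓝 (0:ℂ), g (0, t) = t ^ d * u t) :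
    ∃ (w : Fin d → P → ℂ) (q : P × ℂ → ℂ), (∀ k, AnalyticAt ℂ (w k) 0) ∧ (∀ k, w k 0 = 0) ∧
      AnalyticAt ℂ q 0 ∧ q 0 ≠ 0 ∧
      ∀ᶠ y in 𝓝 (0 : P × ℂ), g y = q y * (y.2 ^ d + ∑ k, w k y.1 * y.2 ^ (k:ℕ)) := by
  let C := Fin d → ℂ
  let pr : (P × C) × ℂ →L[ℂ] P × ℂ := ((ContinuousLinearMap.fst ℂ P C).comp (ContinuousLinearMap.fst ℂ (P × C) ℂ)).prod (ContinuousLinearMap.snd ℂ (P × C) ℂ)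
  have hg' : AnalyticAt ℂ (fun y : (P × C) × ℂ => g (y.1.1, y.2)) 0 := by
    refine AnalyticAt.comp (g := g) (f := pr) ?_ (pr.analyticAt 0)
    simpa using hg
  let pk : Fin d → (P × C →L[ℂ] ℂ) := fun k => (ContinuousLinearMap.proj k).comp (ContinuousLinearMap.snd ℂ P C)
  obtain ⟨q, ρ, hq, hρ, hdiv⟩ := weier_div d (fun k (y : P × C) => y.2 k) (fun k => (pk k).analyticAt 0) (fun k => rfl)
    (fun y : (P × C) × ℂ => g (y.1.1, y.2)) hg'
  -- restrict to x = 0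
  have hcont1 : ContinuousAt (fun t : ℂ => q ((0, 0), t)) 0 := by
    refine ContinuousAt.comp (g := q) (f := fun t : ℂ => (((0:P), (0:C)), t)) hq.continuousAt (by fun_prop)
  have hat0 : ∀ᶠ t in 𝓝 (0:ℂ), t ^ d * u t = q ((0,0),t) * t ^ d + ∑ j, ρ j (0,0) * t ^ (j:ℕ) := by
    have hc : ContinuousAt (fun t : ℂ => (((0:P), (0:C)), t)) 0 := by fun_prop
    have := hc.eventually hdiv
    filter_upwards [this, hgu] with t ht ht2
    rw [ht2] at ht
    have hz : ∀ k : Fin d, (0 : C) k = 0 := fun _ => rfl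
    simpa [hz] using ht
  have hρ0 : (fun j => ρ j (0,0)) = 0 := by
    apply poly_vanish d _ (fun t => u t - q ((0,0),t)) (hu.sub hcont1)
    apply Filter.Eventually.filter_mono nhdsWithin_le_nhds
    filter_upwards [hat0] with t ht
    linear_combination -ht
  have hq0 : q 0 = u 0 := by
    have h1 : ∀ᶠ t in 𝓝[≠] (0:ℂ), u t = q ((0,0),t) := by
      filter_upwards [hat0.filter_mono nhdsWithin_le_nhds, self_mem_nhdsWithin] with t ht htne
      have htne : t ≠ 0 := htne
      have h2 : ∀ j, ρ j (0,0) = 0 := fun j => congrFun hρ0 j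
      simp only [h2, zero_mul, Finset.sum_const_zero, add_zero] at ht
      apply mul_left_cancel₀ (pow_ne_zero d htne)
      rw [ht]; ring
    have l1 := hu.tendsto.mono_left (nhdsWithin_le_nhds (s := {0}ᶜ))
    have l2 := hcont1.tendsto.mono_left (nhdsWithin_le_nhds (s := {0}ᶜ))
    exact (tendsto_nhds_unique (l1.congr' h1) l2).symm
  -- the remainder map
  let Φ : P × C → C := fun y j => ρ j y
  have hΦ : AnalyticAt ℂ Φ 0 := by
    exact AnalyticAt.pi hρ
  have hΦc : ContDiffAt ℂ ⊤ Φ 0 := hΦ.contDiffAt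
  have hinv : (fderiv ℂ Φ 0 ∘L .inr ℂ P C).IsInvertible := by
    apply isInvertible_of_inj
    intro γ hγ
    have hqev : ∀ᶠ t in 𝓝 (0:ℂ), AnalyticAt ℂ q ((0,0),t) := by
      have hc : ContinuousAt (fun t : ℂ => (((0:P), (0:C)), t)) 0 := by fun_prop
      exact hc.eventually hq.eventually_analyticAt
    have hdivev : ∀ᶠ t in 𝓝 (0:ℂ), ∀ᶠ z in 𝓝 (0:ℂ), t ^ d * u t = q ((0, z • γ), t) * (t ^ d + ∑ k, z * γ k * t ^ (k:ℕ)) + ∑ j, ρ j (0, z • γ) * t ^ (j:ℕ) := by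
      have hc : ContinuousAt (fun t : ℂ => (((0:P), (0:C)), t)) 0 := by fun_prop
      have := hc.eventually hdiv.eventually_nhds
      filter_upwards [this, hgu] with t ht ht2
      have hc2 : ContinuousAt (fun z : ℂ => (((0:P), z • γ), t)) 0 := by fun_prop
      have h3 := hc2.tendsto
      simp only [zero_smul] at h3
      filter_upwards [h3.eventually ht] with z hz
      rw [← ht2]
      exact hz
    let h : ℂ → ℂ := fun t => fderiv ℂ q ((0,0),t) ((0,γ),0)
    have hhc : ContinuousAt h 0 := by
      have h1 : ContinuousAt (fderiv ℂ q) (((0:P), (0:C)), (0:ℂ)) := hq.fderiv.continuousAt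
      have h2 : ContinuousAt (fun t => fderiv ℂ q ((0,0),t)) (0:ℂ) :=
        ContinuousAt.comp (g := fderiv ℂ q) (f := fun t : ℂ => (((0:P), (0:C)), t)) h1 (by fun_prop)
      exact h2.clm_apply continuousAt_const
    have hqne : ∀ᶠ t in 𝓝 (0:ℂ), q ((0,0),t) ≠ 0 := by
      apply hcont1.eventually_ne
      have : q ((0,0),0) = u 0 := hq0
      rw [this]; exact hu0
    have hρd : ∀ j, HasDerivAt (fun z : ℂ => ρ j (0, z • γ)) 0 0 := by
      intro j
      have hl : HasDerivAt (fun z : ℂ => ((0:P), z • γ)) ((0:P), γ) 0 := by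
        have := (hasDerivAt_id (0:ℂ)).smul_const γ
        simp only [id, one_smul] at this
        exact (hasDerivAt_const (0:ℂ) (0:P)).prodMk this
      have hf : HasFDerivAt (ρ j) (fderiv ℂ (ρ j) 0) ((0:P), (0:ℂ) • γ) := by
        rw [zero_smul]
        exact (hρ j).differentiableAt.hasFDerivAt
      have hcomp := hf.comp_hasDerivAt (0:ℂ) hl
      have hΦj : fderiv ℂ (ρ j) 0 ((0:P), γ) = 0 := by
        have h1 : fderiv ℂ Φ 0 ((0:P), γ) = 0 := hγ
        have h2 : HasFDerivAt Φ (fderiv ℂ Φ 0) 0 := hΦ.differentiableAt.hasFDerivAt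
        have h3 := (hasFDerivAt_pi'.1 h2) j
        have h4 := h3.fderiv
        have h5 : fderiv ℂ (ρ j) 0 = (ContinuousLinearMap.proj j).comp (fderiv ℂ Φ 0) := h4
        rw [h5]
        change (fderiv ℂ Φ 0 ((0:P), γ)) j = 0
        rw [h1]; rfl
      rw [hΦj] at hcomp
      exact hcomp
    apply poly_vanish d γ (fun t => - h t / q ((0,0),t))
    · refine (hhc.neg).div hcont1 ?_
      have : q ((0,0),0) = u 0 := hq0
      rw [this]; exact hu0
    apply Filter.Eventually.filter_mono nhdsWithin_le_nhds
    filter_upwards [hqev, hdivev, hqne] with t ht1 ht2 ht3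
    have hl : HasDerivAt (fun z : ℂ => (((0:P), z • γ), t)) (((0:P), γ), 0) 0 := by
      have := (hasDerivAt_id (0:ℂ)).smul_const γ
      simp only [id, one_smul] at this
      exact ((hasDerivAt_const (0:ℂ) (0:P)).prodMk this).prodMk (hasDerivAt_const (0:ℂ) t)
    have hf : HasFDerivAt q (fderiv ℂ q ((0,0),t)) (((0:P), (0:ℂ) • γ), t) := by
      rw [zero_smul]
      exact ht1.differentiableAt.hasFDerivAt
    have hqd : HasDerivAt (fun z : ℂ => q ((0, z • γ), t)) (h t) 0 := hf.comp_hasDerivAt (0:ℂ) hl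
    have hpd : HasDerivAt (fun z : ℂ => t ^ d + ∑ k, z * γ k * t ^ (k:ℕ)) (∑ k, γ k * t ^ (k:ℕ)) 0 := by
      apply HasDerivAt.const_add
      apply HasDerivAt.fun_sum
      intro k _
      have := ((hasDerivAt_id (0:ℂ)).mul_const (γ k)).mul_const (t ^ (k:ℕ))
      simpa using this
    have hrd : HasDerivAt (fun z : ℂ => ∑ j, ρ j (0, z • γ) * t ^ (j:ℕ)) (∑ j : Fin d, 0 * t ^ (j:ℕ)) 0 := by
      apply HasDerivAt.fun_sum
      intro k _
      exact (hρd k).mul_const _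
    have htot := (hqd.mul hpd).add hrd
    have hconst : HasDerivAt (fun _ : ℂ => t ^ d * u t) 0 0 := hasDerivAt_const _ _
    have hcongr := hconst.congr_of_eventuallyEq (f₁ := fun z : ℂ => q ((0, z • γ), t) * (t ^ d + ∑ k, z * γ k * t ^ (k:ℕ)) + ∑ j, ρ j (0, z • γ) * t ^ (j:ℕ))
      (by filter_upwards [ht2] with z hz; exact hz.symm)
    have huniq := htot.unique hcongr
    simp only [zero_smul, zero_mul, Finset.sum_const_zero, add_zero] at huniq
    field_simp
    linear_combination huniq
  let ψ := hΦc.implicitFunction (by simp) hinv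
  have hψ : ContDiffAt ℂ ⊤ ψ 0 := hΦc.contDiffAt_implicitFunction (by simp) hinv
  have hψa : AnalyticAt ℂ ψ 0 := hψ.analyticAt
  have hψ0 : ψ 0 = 0 := hΦc.implicitFunction_apply_self (by simp) hinv
  have hψe : ∀ᶠ x in 𝓝 (0:P), Φ (x, ψ x) = Φ 0 := hΦc.eventually_apply_implicitFunction (by simp) hinv
  have hΦ0 : Φ 0 = 0 := hρ0
  let ι : P × ℂ → (P × C) × ℂ := fun y => ((y.1, ψ y.1), y.2)
  have hι0 : ι 0 = 0 := by simp [ι, hψ0]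
  have hψ1 : AnalyticAt ℂ (fun y : P × ℂ => ψ y.1) 0 :=
    AnalyticAt.comp (g := ψ) (f := fun y : P × ℂ => y.1) (x := 0) hψa analyticAt_fst
  have hιa : AnalyticAt ℂ ι 0 := (analyticAt_fst.prod hψ1).prod analyticAt_snd
  refine ⟨fun k x => ψ x k, q ∘ ι, ?_, ?_, ?_, ?_, ?_⟩
  · intro k
    exact AnalyticAt.comp (g := fun c : C => c k) (f := ψ)
      ((ContinuousLinearMap.proj (R := ℂ) (φ := fun _ : Fin d => ℂ) k).analyticAt _) hψa
  · intro k; simp only [hψ0]; rfl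
  · refine AnalyticAt.comp ?_ hιa
    rw [hι0]; exact hq
  · simp only [Function.comp, hι0, hq0]; exact hu0
  · have e1 : ∀ᶠ y in 𝓝 (0 : P × ℂ), Φ (y.1, ψ y.1) = Φ 0 := (continuousAt_fst (p := (0 : P × ℂ))).eventually hψe
    have hιc := hιa.continuousAt
    have e2 : ∀ᶠ y in 𝓝 (0 : P × ℂ), _ := hιc.eventually (by rw [hι0]; exact hdiv)
    filter_upwards [e1, e2] with y hy1 hy2
    rw [hΦ0] at hy1
    have h3 : ∀ j, ρ j (y.1, ψ y.1) = 0 := fun j => congrFun hy1 j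
    have h4 : g y = q (ι y) * (y.2 ^ d + ∑ k, ψ y.1 k * y.2 ^ (k:ℕ)) + ∑ j, ρ j (y.1, ψ y.1) * y.2 ^ (j:ℕ) := hy2
    simpa [h3] using h4

end INNC
end

section
namespace INNC
open Topology

theorem ext_der {B K : Type} [CommRing B] [IsDomain B] [Field K] [CharZero K] [Algebra B K]
    [FaithfulSMul B K] [Algebra.IsAlgebraic B K] (δ : Derivation ℤ B K) :
    ∃ D : Derivation ℤ K K, ∀ b, D (algebraMap B K b) = δ b := by
  let _inst := FractionRing.liftAlgebra B K
  have : CharZero (FractionRing B) := (algebraMap (FractionRing B) K).charZero_iff (algebraMap (FractionRing B) K).injective |>.2 inferInstance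
  have : Algebra.IsAlgebraic (FractionRing B) K := ⟨fun x => (Algebra.IsAlgebraic.isAlgebraic (R := B) x).extendScalars (IsFractionRing.injective B (FractionRing B))⟩
  have : Algebra.FormallyEtale B (FractionRing B) := Algebra.FormallyEtale.of_isLocalization (nonZeroDivisors B)
  have : Algebra.FormallyEtale (FractionRing B) K := Algebra.FormallyEtale.of_isSeparable _ _
  have : Algebra.FormallyEtale B K := Algebra.FormallyEtale.comp B (FractionRing B) K
  let e := KaehlerDifferential.tensorKaehlerEquivOfFormallyEtale ℤ B K
  let L : TensorProduct B K (KaehlerDifferential ℤ B) →ₗ[K] K := (δ.liftKaehlerDifferential).liftBaseChange K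
  let D : Derivation ℤ K K := (L.comp e.symm.toLinearMap).compDer (KaehlerDifferential.D ℤ K)
  refine ⟨D, fun b => ?_⟩
  change L (e.symm (KaehlerDifferential.D ℤ K (algebraMap B K b))) = _
  rw [KaehlerDifferential.tensorKaehlerEquivOfFormallyEtale_symm_D_algebraMap]
  simp [L]

theorem const_of_killed {B K ι : Type} [CommRing B] [IsDomain B] [Field K] [Algebra ℂ K] [Algebra B K]
    [FaithfulSMul B K] (Dv : ι → Derivation ℤ K K)
    (hst : ∀ v b, ∃ b', Dv v (algebraMap B K b) = algebraMap B K b')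
    (hconst : ∀ a b : B, b ≠ 0 → (∀ v, Dv v (algebraMap B K a / algebraMap B K b) = 0) →
      ∃ c : ℂ, algebraMap B K a / algebraMap B K b = algebraMap ℂ K c)
    (ξ : K) (halg : IsAlgebraic B ξ) (hξ : ∀ v, Dv v ξ = 0) : ∃ c : ℂ, ξ = algebraMap ℂ K c := by
  let _inst := FractionRing.liftAlgebra B K
  let F := FractionRing B
  have hinte : IsIntegral F ξ := (halg.extendScalars (S := F) (IsFractionRing.injective B F)).isIntegral
  let p := minpoly F ξ
  have hbK : ∀ b : B, b ≠ 0 → algebraMap B K b ≠ 0 := by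
    intro b hb h
    apply hb
    exact (FaithfulSMul.algebraMap_injective B K) (by rw [h, map_zero])
  have hdiv : ∀ a b : B, algebraMap F K (algebraMap B F a / algebraMap B F b) = algebraMap B K a / algebraMap B K b := by
    intro a b
    rw [map_div₀, ← IsScalarTower.algebraMap_apply, ← IsScalarTower.algebraMap_apply]
  -- stability of F
  have hstF : ∀ v (x : F), ∃ y : F, Dv v (algebraMap F K x) = algebraMap F K y := by
    intro v x
    obtain ⟨a, b, hb, rfl⟩ := IsFractionRing.div_surjective (A := B) x
    have hb0 : b ≠ 0 := nonZeroDivisors.ne_zero hb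
    obtain ⟨a', ha'⟩ := hst v a
    obtain ⟨b', hb'⟩ := hst v b
    refine ⟨algebraMap B F (b * a' - a * b') / algebraMap B F (b * b), ?_⟩
    rw [hdiv, hdiv]
    have h1 : Dv v (algebraMap B K a / algebraMap B K b * algebraMap B K b) = algebraMap B K a' := by
      rw [div_mul_cancel₀ _ (hbK b hb0), ha']
    rw [Derivation.leibniz, hb', smul_eq_mul, smul_eq_mul] at h1
    have := hbK b hb0
    simp only [map_sub, map_mul]
    field_simp
    field_simp at h1
    linear_combination h1
  choose DF hDF using hstF
  have hkill : ∀ v i, Dv v (algebraMap F K (p.coeff i)) = 0 := by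
    intro v
    let q : Polynomial F := ∑ i ∈ Finset.range p.natDegree, Polynomial.C (DF v (p.coeff i)) * Polynomial.X ^ i
    have hmon : p.Monic := minpoly.monic hinte
    have hone : DF v 1 = 0 := by
      have := hDF v 1
      rw [map_one, Derivation.map_one_eq_zero] at this
      exact (algebraMap F K).injective (by rw [← this, map_zero])
    have hpow : ∀ i, Dv v (ξ ^ i) = 0 := by
      intro i; rw [Derivation.leibniz_pow, hξ v]; simp
    have hq0 : Polynomial.aeval ξ q = 0 := by
      have h0 : Polynomial.aeval ξ p = 0 := minpoly.aeval F ξ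
      rw [Polynomial.aeval_eq_sum_range, Finset.sum_range_succ] at h0
      have h1 := congrArg (Dv v) h0
      rw [map_zero, map_add, map_sum] at h1
      have hterm : ∀ i, Dv v (p.coeff i • ξ ^ i) = algebraMap F K (DF v (p.coeff i)) * ξ ^ i := by
        intro i
        rw [Algebra.smul_def, Derivation.leibniz, hpow, hDF]
        simp [mul_comm]
      simp only [hterm] at h1
      have hlc : p.coeff p.natDegree = 1 := hmon
      rw [hlc, hone, map_zero, zero_mul, add_zero] at h1
      simp only [q, map_sum, map_mul, Polynomial.aeval_C, map_pow, Polynomial.aeval_X]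
      exact h1
    have hdeg : q.degree < p.degree := by
      rw [Polynomial.degree_eq_natDegree hmon.ne_zero]
      refine lt_of_le_of_lt (Polynomial.degree_sum_le _ _) ?_
      rw [Finset.sup_lt_iff (WithBot.bot_lt_coe _)]
      intro i hi
      refine lt_of_le_of_lt (Polynomial.degree_C_mul_X_pow_le _ _) ?_
      exact_mod_cast Finset.mem_range.1 hi
    have hqz : q = 0 := by
      by_contra hne
      exact absurd (minpoly.degree_le_of_ne_zero F ξ hne hq0) (not_le.2 hdeg)
    intro i
    rw [hDF]
    have : DF v (p.coeff i) = 0 := by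
      rcases lt_trichotomy i p.natDegree with h | h | h
      · have hc : q.coeff i = DF v (p.coeff i) := by
          simp [q, Polynomial.coeff_X_pow, h]
        rw [← hc, hqz, Polynomial.coeff_zero]
      · rw [h]
        have hlc : p.coeff p.natDegree = 1 := hmon
        rw [hlc, hone]
      · rw [Polynomial.coeff_eq_zero_of_natDegree_lt h]
        have := hDF v 0
        rw [map_zero, map_zero] at this
        exact (algebraMap F K).injective (by rw [← this, map_zero])
    rw [this, map_zero]
  have hcoef : ∀ i, ∃ c : ℂ, algebraMap F K (p.coeff i) = algebraMap ℂ K c := by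
    intro i
    obtain ⟨a, b, hb, hab⟩ := IsFractionRing.div_surjective (A := B) (p.coeff i)
    have hb0 : b ≠ 0 := nonZeroDivisors.ne_zero hb
    rw [← hab, hdiv]
    apply hconst a b hb0
    intro v
    rw [← hdiv, hab]
    exact hkill v i
  have halgC : IsAlgebraic ℂ ξ := by
    have hl : p.map (algebraMap F K) ∈ Polynomial.lifts (algebraMap ℂ K) := by
      rw [Polynomial.lifts_iff_coeff_lifts]
      intro i
      obtain ⟨c, hc⟩ := hcoef i
      exact ⟨c, by rw [Polynomial.coeff_map, hc]⟩
    obtain ⟨P, hP⟩ := (Polynomial.mem_lifts _).1 hl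
    refine ⟨P, ?_, ?_⟩
    · rintro rfl
      rw [Polynomial.map_zero] at hP
      have := (minpoly.monic hinte).map (algebraMap F K)
      exact this.ne_zero hP.symm
    · rw [Polynomial.aeval_def, ← Polynomial.eval_map, hP, Polynomial.eval_map, ← Polynomial.aeval_def]
      exact minpoly.aeval F ξ
  have := IsAlgClosed.splits (minpoly ℂ ξ)
  have hirr := minpoly.irreducible halgC.isIntegral
  have hdeg1 := IsAlgClosed.degree_eq_one_of_irreducible ℂ hirr
  obtain ⟨c, hc⟩ := minpoly.mem_range_of_degree_eq_one ℂ ξ hdeg1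
  exact ⟨c, hc.symm⟩

end INNC
end

section
namespace INNC
open Topology

section anal
variable {E : Type} [NormedAddCommGroup E] [NormedSpace ℂ E]

theorem an_dir {g : E → ℂ} {x : E} (hg : AnalyticAt ℂ g x) (v : E) : AnalyticAt ℂ (fun x => fderiv ℂ g x v) x :=
  AnalyticAt.comp (g := fun L : E →L[ℂ] ℂ => L v) ((ContinuousLinearMap.apply ℂ ℂ v).analyticAt _) hg.fderiv

theorem ball_analytic {g : E → ℂ} (hg : AnalyticAt ℂ g 0) : ∃ R > (0:ℝ), AnalyticOnNhd ℂ g (Metric.ball 0 R) := by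
  obtain ⟨R, hR, h⟩ := Metric.eventually_nhds_iff_ball.1 hg.eventually_analyticAt
  exact ⟨R, hR, h⟩

theorem ball_preconn (x : E) (R : ℝ) : IsPreconnected (Metric.ball x R) := (convex_ball x R).isPreconnected

theorem const_ratio {g h : E → ℂ} (hg : AnalyticAt ℂ g 0) (hh : AnalyticAt ℂ h 0) (hne : ¬ ∀ᶠ x in 𝓝 (0:E), h x = 0)
    (hd : ∀ v, ∀ᶠ x in 𝓝 (0:E), h x * fderiv ℂ g x v = g x * fderiv ℂ h x v) :
    ∃ c : ℂ, ∀ᶠ x in 𝓝 (0:E), g x = c * h x := by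
  obtain ⟨R₁, hR₁, h1⟩ := ball_analytic hg
  obtain ⟨R₂, hR₂, h2⟩ := ball_analytic hh
  set R := min R₁ R₂
  have hR : 0 < R := lt_min hR₁ hR₂
  have ag : AnalyticOnNhd ℂ g (Metric.ball 0 R) := h1.mono (Metric.ball_subset_ball (min_le_left _ _))
  have ah : AnalyticOnNhd ℂ h (Metric.ball 0 R) := h2.mono (Metric.ball_subset_ball (min_le_right _ _))
  have hall : ∀ v, ∀ x ∈ Metric.ball (0:E) R, h x * fderiv ℂ g x v = g x * fderiv ℂ h x v := by
    intro v x hx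
    have a1 : AnalyticOnNhd ℂ (fun x => h x * fderiv ℂ g x v) (Metric.ball 0 R) := fun y hy => (ah y hy).fun_mul (an_dir (ag y hy) v)
    have a2 : AnalyticOnNhd ℂ (fun x => g x * fderiv ℂ h x v) (Metric.ball 0 R) := fun y hy => (ag y hy).fun_mul (an_dir (ah y hy) v)
    exact a1.eqOn_of_preconnected_of_eventuallyEq a2 (ball_preconn _ _) (Metric.mem_ball_self hR) (hd v) hx
  obtain ⟨x₀, hx₀, hx₀h⟩ : ∃ x₀ ∈ Metric.ball (0:E) R, h x₀ ≠ 0 := by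
    by_contra hcon
    push Not at hcon
    exact hne (Filter.eventually_of_mem (Metric.ball_mem_nhds 0 hR) hcon)
  have hev : ∀ᶠ x in 𝓝 x₀, x ∈ Metric.ball (0:E) R ∧ h x ≠ 0 :=
    (Metric.isOpen_ball.eventually_mem hx₀).and ((ah x₀ hx₀).continuousAt.eventually_ne hx₀h)
  obtain ⟨r, hr, hball⟩ := Metric.eventually_nhds_iff_ball.1 hev
  have hconst : ∀ x ∈ Metric.ball x₀ r, g x / h x = g x₀ / h x₀ := by
    intro x hx
    have hdiff : ∀ y ∈ Metric.ball x₀ r, HasFDerivAt (fun x => g x / h x) (0 : E →L[ℂ] ℂ) y := by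
      intro y hy
      have hb := hball y hy
      have d1 := (ag y hb.1).differentiableAt.hasFDerivAt
      have d2 := (ah y hb.1).differentiableAt.hasFDerivAt
      have d3 := d1.mul ((hasDerivAt_inv hb.2).comp_hasFDerivAt y d2)
      have he : (g y • (-(h y ^ 2)⁻¹) • fderiv ℂ h y + (Inv.inv ∘ h) y • fderiv ℂ g y : E →L[ℂ] ℂ) = 0 := by
        ext v
        have := hall v y hb.1
        have h0 := hb.2
        simp
        field_simp
        linear_combination this
      rw [he] at d3
      exact d3
    refine IsOpen.is_const_of_fderiv_eq_zero (𝕜 := ℂ) Metric.isOpen_ball (ball_preconn x₀ r)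
      (f := fun x => g x / h x) (fun y hy => (hdiff y hy).differentiableAt.differentiableWithinAt)
      (fun y hy => (hdiff y hy).fderiv) hx (Metric.mem_ball_self hr)
  refine ⟨g x₀ / h x₀, ?_⟩
  have a2 : AnalyticOnNhd ℂ (fun x => g x₀ / h x₀ * h x) (Metric.ball 0 R) := fun y hy => analyticAt_const.fun_mul (ah y hy)
  have heq := ag.eqOn_of_preconnected_of_eventuallyEq a2 (ball_preconn _ _) hx₀ (by
    refine Filter.eventually_of_mem (Metric.ball_mem_nhds x₀ hr) ?_
    intro x hx
    have := hconst x hx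
    have hb := (hball x hx).2
    change g x = g x₀ / h x₀ * h x
    rw [← this]
    field_simp)
  exact Filter.eventually_of_mem (Metric.ball_mem_nhds 0 hR) heq

theorem exists_dir {g : E → ℂ} (hg : AnalyticAt ℂ g 0) (hne : ¬ ∀ᶠ x in 𝓝 (0:E), g x = 0) :
    ∃ v : E, ¬ ∀ᶠ t in 𝓝 (0:ℂ), g (t • v) = 0 := by
  obtain ⟨R, hR, ag⟩ := ball_analytic hg
  obtain ⟨x, hx, hxg⟩ : ∃ x ∈ Metric.ball (0:E) R, g x ≠ 0 := by
    by_contra hcon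
    push Not at hcon
    exact hne (Filter.eventually_of_mem (Metric.ball_mem_nhds 0 hR) hcon)
  refine ⟨x, fun hev => hxg ?_⟩
  by_cases hx0 : x = 0
  · have := hev.self_of_nhds
    simpa [hx0] using this
  have hxn : 0 < ‖x‖ := norm_pos_iff.2 hx0
  have a1 : AnalyticOnNhd ℂ (fun t : ℂ => g (t • x)) (Metric.ball 0 (R / ‖x‖)) := by
    intro t ht
    refine AnalyticAt.comp (g := g) (f := fun t : ℂ => t • x) (ag _ ?_) (analyticAt_id.fun_smul analyticAt_const)
    rw [mem_ball_zero_iff] at ht ⊢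
    rw [norm_smul]
    rwa [lt_div_iff₀ hxn] at ht
  have := a1.eqOn_of_preconnected_of_eventuallyEq (g := fun _ => 0) (fun y hy => analyticAt_const) (convex_ball _ _).isPreconnected
    (Metric.mem_ball_self (by positivity)) hev (x := 1) (by
      rw [mem_ball_zero_iff, norm_one, lt_div_iff₀ hxn, one_mul]
      simpa using hx)
  simpa using this
end anal

/-- Evaluation homomorphisms on germs of analytic functions. -/
structure Ev (E K : Type) [NormedAddCommGroup E] [NormedSpace ℂ E] [Field K] [Algebra ℂ K] where
  f : (E → ℂ) → K
  add : ∀ g h, AnalyticAt ℂ g 0 → AnalyticAt ℂ h 0 → f (fun x => g x + h x) = f g + f h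
  mul : ∀ g h, AnalyticAt ℂ g 0 → AnalyticAt ℂ h 0 → f (fun x => g x * h x) = f g * f h
  const : ∀ c, f (fun _ => c) = algebraMap ℂ K c
  congr : ∀ g h, AnalyticAt ℂ g 0 → AnalyticAt ℂ h 0 → g =ᶠ[𝓝 0] h → f g = f h

namespace Ev
variable {E E' K : Type} [NormedAddCommGroup E] [NormedSpace ℂ E] [NormedAddCommGroup E'] [NormedSpace ℂ E']
  [Field K] [Algebra ℂ K]

theorem neg (φ : Ev E K) (g : E → ℂ) (hg : AnalyticAt ℂ g 0) : φ.f (fun x => - g x) = - φ.f g := by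
  have h1 : (fun x => - g x) = fun x => (-1 : ℂ) * g x := by ext; ring
  rw [h1, φ.mul _ _ analyticAt_const hg, φ.const]
  simp

theorem sub (φ : Ev E K) (g h : E → ℂ) (hg : AnalyticAt ℂ g 0) (hh : AnalyticAt ℂ h 0) :
    φ.f (fun x => g x - h x) = φ.f g - φ.f h := by
  have h1 : (fun x => g x - h x) = fun x => g x + (- h x) := by ext; ring
  rw [h1, φ.add _ _ hg hh.fun_neg, φ.neg _ hh]
  ring

theorem zero (φ : Ev E K) : φ.f (fun _ => 0) = 0 := by rw [φ.const, map_zero]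

theorem pow (φ : Ev E K) (g : E → ℂ) (hg : AnalyticAt ℂ g 0) (n : ℕ) : φ.f (fun x => g x ^ n) = φ.f g ^ n := by
  induction n with
  | zero => simp only [pow_zero]; rw [φ.const, map_one]
  | succ n ih =>
    simp only [pow_succ]
    rw [φ.mul _ _ (hg.fun_pow n) hg, ih]

theorem sum (φ : Ev E K) {ι : Type} (s : Finset ι) (g : ι → E → ℂ) (hg : ∀ i, AnalyticAt ℂ (g i) 0) :
    φ.f (fun x => ∑ i ∈ s, g i x) = ∑ i ∈ s, φ.f (g i) := by
  classical
  induction s using Finset.induction_on with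
  | empty => simpa using φ.zero
  | insert a s ha ih =>
    simp only [Finset.sum_insert ha]
    rw [φ.add _ _ (hg a) (Finset.analyticAt_fun_sum _ fun i _ => hg i), ih]

/-- Pull back along a continuous linear map. -/
def pull (φ : Ev E K) (A : E →L[ℂ] E') : Ev E' K where
  f g := φ.f (fun x => g (A x))
  add g h hg hh := by
    have a : ∀ {g : E' → ℂ}, AnalyticAt ℂ g 0 → AnalyticAt ℂ (fun x => g (A x)) 0 := fun hg =>
      AnalyticAt.comp (f := A) (x := 0) (by simpa using hg) (A.analyticAt 0)
    exact φ.add _ _ (a hg) (a hh)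
  mul g h hg hh := by
    have a : ∀ {g : E' → ℂ}, AnalyticAt ℂ g 0 → AnalyticAt ℂ (fun x => g (A x)) 0 := fun hg =>
      AnalyticAt.comp (f := A) (x := 0) (by simpa using hg) (A.analyticAt 0)
    exact φ.mul _ _ (a hg) (a hh)
  const c := φ.const c
  congr g h hg hh e := by
    have a : ∀ {g : E' → ℂ}, AnalyticAt ℂ g 0 → AnalyticAt ℂ (fun x => g (A x)) 0 := fun hg =>
      AnalyticAt.comp (f := A) (x := 0) (by simpa using hg) (A.analyticAt 0)
    apply φ.congr _ _ (a hg) (a hh)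
    have : Filter.Tendsto A (𝓝 0) (𝓝 0) := by simpa using A.continuous.tendsto 0
    exact this.eventually e

/-- The image ring. -/
def B (φ : Ev E K) : Subring K where
  carrier := {b | ∃ g, AnalyticAt ℂ g 0 ∧ φ.f g = b}
  zero_mem' := ⟨fun _ => 0, analyticAt_const, φ.zero⟩
  one_mem' := ⟨fun _ => 1, analyticAt_const, by rw [φ.const, map_one]⟩
  add_mem' := by
    rintro _ _ ⟨g, hg, rfl⟩ ⟨h, hh, rfl⟩
    exact ⟨_, hg.fun_add hh, φ.add _ _ hg hh⟩
  mul_mem' := by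
    rintro _ _ ⟨g, hg, rfl⟩ ⟨h, hh, rfl⟩
    exact ⟨_, hg.fun_mul hh, φ.mul _ _ hg hh⟩
  neg_mem' := by
    rintro _ ⟨g, hg, rfl⟩
    exact ⟨_, hg.fun_neg, φ.neg _ hg⟩

/-- The chain rule for a derivation. -/
def Chain (φ : Ev E K) (D : Derivation ℤ K K) : Prop :=
  ∃ (k : ℕ) (e : Fin k → E) (c : Fin k → K), ∀ g, AnalyticAt ℂ g 0 →
    D (φ.f g) = ∑ i, c i * φ.f (fun x => fderiv ℂ g x (e i))

theorem dir_add (φ : Ev E K) (g h : E → ℂ) (hg : AnalyticAt ℂ g 0) (hh : AnalyticAt ℂ h 0) (v : E) :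
    φ.f (fun x => fderiv ℂ (fun x => g x + h x) x v) = φ.f (fun x => fderiv ℂ g x v) + φ.f (fun x => fderiv ℂ h x v) := by
  rw [← φ.add _ _ (an_dir hg v) (an_dir hh v)]
  apply φ.congr _ _ (an_dir (hg.fun_add hh) v) ((an_dir hg v).fun_add (an_dir hh v))
  filter_upwards [hg.eventually_analyticAt, hh.eventually_analyticAt] with x h1 h2
  rw [fderiv_fun_add h1.differentiableAt h2.differentiableAt]
  rfl

theorem dir_mul (φ : Ev E K) (g h : E → ℂ) (hg : AnalyticAt ℂ g 0) (hh : AnalyticAt ℂ h 0) (v : E) :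
    φ.f (fun x => fderiv ℂ (fun x => g x * h x) x v) =
      φ.f g * φ.f (fun x => fderiv ℂ h x v) + φ.f h * φ.f (fun x => fderiv ℂ g x v) := by
  rw [← φ.mul _ _ hg (an_dir hh v), ← φ.mul _ _ hh (an_dir hg v), ← φ.add _ _ (hg.fun_mul (an_dir hh v)) (hh.fun_mul (an_dir hg v))]
  apply φ.congr _ _ (an_dir (hg.fun_mul hh) v) ((hg.fun_mul (an_dir hh v)).fun_add (hh.fun_mul (an_dir hg v)))
  filter_upwards [hg.eventually_analyticAt, hh.eventually_analyticAt] with x h1 h2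
  rw [fderiv_fun_mul h1.differentiableAt h2.differentiableAt]
  rfl

theorem dir_congr (φ : Ev E K) (g h : E → ℂ) (hg : AnalyticAt ℂ g 0) (hh : AnalyticAt ℂ h 0) (v : E)
    (e : g =ᶠ[𝓝 0] h) : φ.f (fun x => fderiv ℂ g x v) = φ.f (fun x => fderiv ℂ h x v) := by
  apply φ.congr _ _ (an_dir hg v) (an_dir hh v)
  filter_upwards [e.fderiv (𝕜 := ℂ)] with x hx
  rw [hx]

/-- Case without relations. -/
theorem case1 (φ : Ev E K) (hinj : ∀ g, AnalyticAt ℂ g 0 → φ.f g = 0 → ∀ᶠ x in 𝓝 (0:E), g x = 0)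
    (halg : ∀ ξ : K, IsAlgebraic φ.B ξ) (ξ : K) (hξ : ¬ ∃ c : ℂ, ξ = algebraMap ℂ K c) :
    ∃ D : Derivation ℤ K K, D ξ ≠ 0 ∧ φ.Chain D := by
  have : CharZero K := charZero_of_injective_algebraMap (algebraMap ℂ K).injective
  have hAlg : Algebra.IsAlgebraic φ.B K := ⟨halg⟩
  -- choose representatives
  have hrep : ∀ b : φ.B, ∃ g, AnalyticAt ℂ g 0 ∧ φ.f g = b := fun b => b.2
  choose rep hrep1 hrep2 using hrep
  have heq : ∀ g h, AnalyticAt ℂ g 0 → AnalyticAt ℂ h 0 → φ.f g = φ.f h → g =ᶠ[𝓝 0] h := by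
    intro g h hg hh e
    have := hinj _ (hg.fun_sub hh) (by rw [φ.sub _ _ hg hh, e, sub_self])
    filter_upwards [this] with x hx
    exact sub_eq_zero.1 hx
  have hwd : ∀ (v : E) (b : φ.B) g, AnalyticAt ℂ g 0 → φ.f g = b → φ.f (fun x => fderiv ℂ (rep b) x v) = φ.f (fun x => fderiv ℂ g x v) := by
    intro v b g hg e
    exact φ.dir_congr _ _ (hrep1 b) hg v (heq _ _ (hrep1 b) hg (by rw [hrep2, e]))
  have hδ : ∀ v : E, ∃ D : Derivation ℤ K K, ∀ g, AnalyticAt ℂ g 0 → D (φ.f g) = φ.f (fun x => fderiv ℂ g x v) := by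
    intro v
    let δ₀ : φ.B →+ K := AddMonoidHom.mk' (fun b => φ.f (fun x => fderiv ℂ (rep b) x v)) (by
      intro a b
      rw [hwd v (a+b) (fun x => rep a x + rep b x) ((hrep1 a).fun_add (hrep1 b)) (by
        rw [φ.add _ _ (hrep1 a) (hrep1 b), hrep2, hrep2]; rfl), φ.dir_add _ _ (hrep1 a) (hrep1 b)])
    let δ : Derivation ℤ φ.B K := Derivation.mk' δ₀.toIntLinearMap (by
      intro a b
      change φ.f (fun x => fderiv ℂ (rep (a*b)) x v) = a • φ.f (fun x => fderiv ℂ (rep b) x v) + b • φ.f (fun x => fderiv ℂ (rep a) x v)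
      rw [hwd v (a*b) (fun x => rep a x * rep b x) ((hrep1 a).fun_mul (hrep1 b)) (by
        rw [φ.mul _ _ (hrep1 a) (hrep1 b), hrep2, hrep2]; rfl), φ.dir_mul _ _ (hrep1 a) (hrep1 b), hrep2, hrep2]
      rfl)
    obtain ⟨D, hD⟩ := ext_der δ
    refine ⟨D, fun g hg => ?_⟩
    have := hD ⟨φ.f g, g, hg, rfl⟩
    have h2 : δ ⟨φ.f g, g, hg, rfl⟩ = φ.f (fun x => fderiv ℂ g x v) := hwd v _ g hg rfl
    rw [← h2, ← this]
    rfl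
  choose Dv hDv using hδ
  by_contra hcon
  apply hξ
  refine const_of_killed (B := φ.B) Dv ?_ ?_ ξ (halg ξ) ?_
  · rintro v ⟨_, g, hg, rfl⟩
    exact ⟨⟨φ.f (fun x => fderiv ℂ g x v), _, an_dir hg v, rfl⟩, hDv v g hg⟩
  · rintro ⟨_, g, hg, rfl⟩ ⟨_, h, hh, rfl⟩ hne hk
    have hne' : φ.f h ≠ 0 := fun e => hne (Subtype.ext e)
    change ∀ v, Dv v (φ.f g / φ.f h) = 0 at hk
    change ∃ c, φ.f g / φ.f h = _
    have hd : ∀ v, φ.f h * φ.f (fun x => fderiv ℂ g x v) = φ.f g * φ.f (fun x => fderiv ℂ h x v) := by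
      intro v
      have h1 : Dv v (φ.f g / φ.f h * φ.f h) = φ.f (fun x => fderiv ℂ g x v) := by
        rw [div_mul_cancel₀ _ hne', hDv v g hg]
      rw [Derivation.leibniz, hk v, hDv v h hh, smul_eq_mul, smul_zero, add_zero] at h1
      rw [← h1]
      field_simp
    obtain ⟨c, hc⟩ := const_ratio hg hh (fun hz => hne' (by
      rw [φ.congr h (fun _ => 0) hh analyticAt_const hz, φ.zero])) (fun v => by
      apply heq _ _ (hh.fun_mul (an_dir hg v)) (hg.fun_mul (an_dir hh v))
      rw [φ.mul _ _ hh (an_dir hg v), φ.mul _ _ hg (an_dir hh v), hd])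
    refine ⟨c, ?_⟩
    rw [φ.congr g _ hg (analyticAt_const.fun_mul hh) hc, φ.mul _ _ analyticAt_const hh, φ.const]
    field_simp
  · intro v
    by_contra hv
    exact hcon ⟨Dv v, hv, 1, fun _ => v, fun _ => 1, fun g hg => by simp [hDv v g hg]⟩

end Ev
end INNC
end

section
namespace INNC
open Topology

namespace Ev
variable {E E' K : Type} [NormedAddCommGroup E] [NormedSpace ℂ E] [NormedAddCommGroup E'] [NormedSpace ℂ E']
  [Field K] [Algebra ℂ K]

theorem an_pull {g : E' → ℂ} (hg : AnalyticAt ℂ g 0) (A : E →L[ℂ] E') : AnalyticAt ℂ (fun x => g (A x)) 0 :=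
  AnalyticAt.comp (f := A) (x := 0) (by simpa using hg) (A.analyticAt 0)

theorem fderiv_pull {g : E' → ℂ} (hg : AnalyticAt ℂ g 0) (A : E →L[ℂ] E') (v : E) :
    (fun x => fderiv ℂ (fun x => g (A x)) x v) =ᶠ[𝓝 0] fun x => fderiv ℂ g (A x) (A v) := by
  have : Filter.Tendsto A (𝓝 0) (𝓝 0) := by simpa using A.continuous.tendsto 0
  filter_upwards [this.eventually hg.eventually_analyticAt] with x hx
  have h1 : HasFDerivAt (fun x => g (A x)) ((fderiv ℂ g (A x)).comp A) x :=
    hx.differentiableAt.hasFDerivAt.comp x A.hasFDerivAt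
  rw [h1.fderiv]; rfl

theorem ne_zero_of_unit (φ : Ev E K) (q : E → ℂ) (hq : AnalyticAt ℂ q 0) (hq0 : q 0 ≠ 0) : φ.f q ≠ 0 := by
  intro h
  have hi : AnalyticAt ℂ (fun x => (q x)⁻¹) 0 := hq.fun_inv hq0
  have h1 : φ.f (fun x => q x * (q x)⁻¹) = φ.f (fun _ => 1) := by
    apply φ.congr _ _ (hq.fun_mul hi) analyticAt_const
    filter_upwards [hq.continuousAt.eventually_ne hq0] with x hx
    field_simp
  rw [φ.mul _ _ hq hi, h, φ.const] at h1
  simp at h1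

/-- The Weierstrass polynomial relation. -/
theorem weier_rel {P : Type} [NormedAddCommGroup P] [NormedSpace ℂ P] [CompleteSpace P] (φ : Ev (P × ℂ) K) (g : P × ℂ → ℂ)
    (hg : AnalyticAt ℂ g 0) (hg0 : φ.f g = 0) (hne : ¬ ∀ᶠ t in 𝓝 (0:ℂ), g (0, t) = 0) :
    ∃ (d : ℕ) (w : Fin d → P → ℂ), (∀ k, AnalyticAt ℂ (w k) 0) ∧ (∀ k, w k 0 = 0) ∧
      φ.f (fun y => y.2 ^ d + ∑ k, w k y.1 * y.2 ^ (k:ℕ)) = 0 := by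
  have hga : AnalyticAt ℂ (fun t : ℂ => g (0, t)) 0 := an_pull hg (ContinuousLinearMap.inr ℂ P ℂ)
  obtain ⟨d, u, hu, hu0, he⟩ := (hga.exists_eventuallyEq_pow_smul_nonzero_iff).2 hne
  simp only [sub_zero, smul_eq_mul] at he
  obtain ⟨w, q, hw, hw0, hq, hq0, hfac⟩ := weier_prep d g hg u hu.continuousAt hu0 he
  refine ⟨d, w, hw, hw0, ?_⟩
  have hW : AnalyticAt ℂ (fun y : P × ℂ => y.2 ^ d + ∑ k, w k y.1 * y.2 ^ (k:ℕ)) 0 := by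
    refine (analyticAt_snd.fun_pow d).fun_add ?_
    apply Finset.analyticAt_fun_sum
    intro k _
    exact (an_pull (hw k) (ContinuousLinearMap.fst ℂ P ℂ)).fun_mul (analyticAt_snd.fun_pow _)
  have h1 := φ.congr g _ hg (hq.fun_mul hW) hfac
  rw [hg0, φ.mul _ _ hq hW] at h1
  exact (mul_eq_zero.1 h1.symm).resolve_left (φ.ne_zero_of_unit q hq hq0)

/-- The reduction of dimension. -/
theorem reduce {P : Type} [NormedAddCommGroup P] [NormedSpace ℂ P] (φ : Ev (P × ℂ) K)
    (d : ℕ) (w : Fin d → P → ℂ) (hw : ∀ k, AnalyticAt ℂ (w k) 0) (hw0 : ∀ k, w k 0 = 0)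
    (hW0 : φ.f (fun y => y.2 ^ d + ∑ k, w k y.1 * y.2 ^ (k:ℕ)) = 0) :
    (∀ b ∈ φ.B, IsIntegral (φ.pull (ContinuousLinearMap.fst ℂ P ℂ)).B b) ∧
    ∀ D : Derivation ℤ K K, (φ.pull (ContinuousLinearMap.fst ℂ P ℂ)).Chain D → φ.Chain D := by
  set φ' := φ.pull (ContinuousLinearMap.fst ℂ P ℂ) with hφ'
  have hφ'f : ∀ g : P → ℂ, φ'.f g = φ.f (fun y => g y.1) := fun g => rfl
  have an1 : ∀ {h : P → ℂ}, AnalyticAt ℂ h 0 → AnalyticAt ℂ (fun y : P × ℂ => h y.1) 0 := fun hh =>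
    an_pull hh (ContinuousLinearMap.fst ℂ P ℂ)
  have ansnd : AnalyticAt ℂ (fun y : P × ℂ => y.2) 0 := analyticAt_snd
  have anpoly : ∀ {w : Fin d → P → ℂ}, (∀ k, AnalyticAt ℂ (w k) 0) → ∀ k : Fin d, AnalyticAt ℂ (fun y : P × ℂ => w k y.1 * y.2 ^ (k:ℕ)) 0 :=
    fun hw k => (an1 (hw k)).fun_mul (ansnd.fun_pow _)
  have anpolys : ∀ {w : Fin d → P → ℂ}, (∀ k, AnalyticAt ℂ (w k) 0) → AnalyticAt ℂ (fun y : P × ℂ => ∑ k, w k y.1 * y.2 ^ (k:ℕ)) 0 :=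
    fun hw => Finset.analyticAt_fun_sum _ fun k _ => anpoly hw k
  have hW : AnalyticAt ℂ (fun y : P × ℂ => y.2 ^ d + ∑ k, w k y.1 * y.2 ^ (k:ℕ)) 0 :=
    (ansnd.fun_pow d).fun_add (anpolys hw)
  set τ := φ.f (fun y => y.2) with hτ
  have hpolyv : ∀ {w : Fin d → P → ℂ}, (∀ k, AnalyticAt ℂ (w k) 0) → φ.f (fun y : P × ℂ => ∑ k, w k y.1 * y.2 ^ (k:ℕ)) = ∑ k, φ'.f (w k) * τ ^ (k:ℕ) := by
    intro w hw
    rw [φ.sum Finset.univ (fun k (y : P × ℂ) => w k y.1 * y.2 ^ (k:ℕ)) (anpoly hw)]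
    apply Finset.sum_congr rfl
    intro k _
    rw [φ.mul _ _ (an1 (hw k)) (ansnd.fun_pow _), φ.pow _ ansnd]
    rfl
  constructor
  · have hmem : ∀ {h : P → ℂ}, AnalyticAt ℂ h 0 → φ'.f h ∈ φ'.B := fun {h} hh => ⟨h, hh, rfl⟩
    have hτint : IsIntegral φ'.B τ := by
      let p : Polynomial φ'.B := Polynomial.X ^ d + ∑ k : Fin d, Polynomial.C ⟨φ'.f (w k), hmem (hw k)⟩ * Polynomial.X ^ (k:ℕ)
      refine ⟨p, ?_, ?_⟩
      · apply Polynomial.monic_X_pow_add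
        refine lt_of_le_of_lt (Polynomial.degree_sum_le _ _) ?_
        rw [Finset.sup_lt_iff (WithBot.bot_lt_coe _)]
        intro i hi
        refine lt_of_le_of_lt (Polynomial.degree_C_mul_X_pow_le _ _) ?_
        exact_mod_cast i.2
      · rw [← Polynomial.aeval_def]
        simp only [p, map_add, map_pow, Polynomial.aeval_X, map_sum, map_mul, Polynomial.aeval_C]
        rw [φ.add _ _ (ansnd.fun_pow d) (anpolys hw), φ.pow _ ansnd, hpolyv hw] at hW0
        exact hW0
    rintro _ ⟨g, hg, rfl⟩
    obtain ⟨q, c, hq, hc, he⟩ := weier_div d w hw hw0 g hg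
    rw [φ.congr g _ hg ((hq.fun_mul hW).fun_add (anpolys hc)) he, φ.add _ _ (hq.fun_mul hW) (anpolys hc),
      φ.mul _ _ hq hW, hW0, mul_zero, zero_add, hpolyv hc]
    apply IsIntegral.sum
    intro k _
    refine IsIntegral.mul ?_ (hτint.pow _)
    exact isIntegral_algebraMap (R := φ'.B) (x := ⟨φ'.f (c k), hmem (hc k)⟩)
  · rintro D ⟨k, e, c, hD⟩
    let Δ : (P × ℂ → ℂ) → K := fun g => D (φ.f g) - ∑ i, c i * φ.f (fun y => fderiv ℂ g y (e i, 0)) - D τ * φ.f (fun y => fderiv ℂ g y (0, 1))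
    have Δadd : ∀ g h, AnalyticAt ℂ g 0 → AnalyticAt ℂ h 0 → Δ (fun y => g y + h y) = Δ g + Δ h := by
      intro g h hg hh
      simp only [Δ]
      rw [φ.add _ _ hg hh, map_add, φ.dir_add _ _ hg hh]
      simp only [φ.dir_add _ _ hg hh, mul_add, Finset.sum_add_distrib]
      ring
    have Δmul : ∀ g h, AnalyticAt ℂ g 0 → AnalyticAt ℂ h 0 → Δ (fun y => g y * h y) = φ.f g * Δ h + φ.f h * Δ g := by
      intro g h hg hh
      simp only [Δ]
      rw [φ.mul _ _ hg hh, Derivation.leibniz, φ.dir_mul _ _ hg hh]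
      simp only [φ.dir_mul _ _ hg hh, mul_add, Finset.sum_add_distrib, mul_sub, Finset.mul_sum, smul_eq_mul]
      have s1 : ∀ (a : K) (F : Fin k → K), ∑ i, c i * (a * F i) = ∑ i, a * (c i * F i) := fun a F =>
        Finset.sum_congr rfl fun i _ => by ring
      rw [s1, s1]
      ring
    have Δcongr : ∀ g h, AnalyticAt ℂ g 0 → AnalyticAt ℂ h 0 → g =ᶠ[𝓝 0] h → Δ g = Δ h := by
      intro g h hg hh e
      simp only [Δ]
      rw [φ.congr _ _ hg hh e]
      simp only [φ.dir_congr _ _ hg hh _ e]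
    have Δ1 : ∀ h : P → ℂ, AnalyticAt ℂ h 0 → Δ (fun y => h y.1) = 0 := by
      intro h hh
      simp only [Δ]
      have h1 := hD h hh
      rw [hφ'f] at h1
      rw [h1]
      have h2 : ∀ v : P × ℂ, φ.f (fun y => fderiv ℂ (fun y : P × ℂ => h y.1) y v) = φ.f (fun y => fderiv ℂ h y.1 v.1) := by
        intro v
        exact φ.congr _ _ (an_dir (an1 hh) v) (an1 (an_dir hh v.1)) (fderiv_pull hh (ContinuousLinearMap.fst ℂ P ℂ) v)
      rw [h2]
      simp only [h2, map_zero]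
      rw [φ.zero]
      simp [hφ'f]
    have Δ2 : Δ (fun y => y.2) = 0 := by
      simp only [Δ]
      have h2 : ∀ y v : P × ℂ, fderiv ℂ (fun y : P × ℂ => y.2) y v = v.2 := by
        intro y v
        rw [show (fun y : P × ℂ => y.2) = Prod.snd from rfl, fderiv_snd]
        rfl
      simp only [h2]
      rw [φ.zero, φ.const]
      simp [hτ]
    have Δpow : ∀ n, Δ (fun y => y.2 ^ n) = 0 := by
      intro n
      induction n with
      | zero =>
        simp only [pow_zero]
        exact Δ1 (fun _ => 1) analyticAt_const
      | succ n ih =>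
        simp only [pow_succ]
        rw [Δmul _ _ (ansnd.fun_pow n) ansnd, Δ2, ih]; simp
    have Δpoly : ∀ {w : Fin d → P → ℂ}, (∀ k, AnalyticAt ℂ (w k) 0) → Δ (fun y : P × ℂ => ∑ k, w k y.1 * y.2 ^ (k:ℕ)) = 0 := by
      intro w hw
      have : ∀ s : Finset (Fin d), Δ (fun y : P × ℂ => ∑ k ∈ s, w k y.1 * y.2 ^ (k:ℕ)) = 0 := by
        intro s
        classical
        induction s using Finset.induction_on with
        | empty => simpa using Δ1 (fun _ => 0) analyticAt_const
        | insert a s ha ih =>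
          simp only [Finset.sum_insert ha]
          rw [Δadd _ _ (anpoly hw a) (Finset.analyticAt_fun_sum _ fun i _ => anpoly hw i), ih,
            Δmul _ _ (an1 (hw a)) (ansnd.fun_pow _), Δpow, Δ1 _ (hw a)]
          simp
      exact this _
    have ΔW : Δ (fun y => y.2 ^ d + ∑ k, w k y.1 * y.2 ^ (k:ℕ)) = 0 := by
      rw [Δadd _ _ (ansnd.fun_pow d) (anpolys hw), Δpow, Δpoly hw, add_zero]
    have Δall : ∀ g, AnalyticAt ℂ g 0 → Δ g = 0 := by
      intro g hg
      obtain ⟨q, c, hq, hc, he⟩ := weier_div d w hw hw0 g hg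
      rw [Δcongr g _ hg ((hq.fun_mul hW).fun_add (anpolys hc)) he, Δadd _ _ (hq.fun_mul hW) (anpolys hc),
        Δmul _ _ hq hW, hW0, ΔW, Δpoly hc]
      simp
    refine ⟨k + 1, Fin.snoc (fun i => (e i, 0)) (0, 1), Fin.snoc c (D τ), ?_⟩
    intro g hg
    have := Δall g hg
    simp only [Δ] at this
    rw [Fin.sum_univ_castSucc]
    simp only [Fin.snoc_castSucc, Fin.snoc_last]
    linear_combination this

theorem isAlgebraic_trans_subring {B' B : Subring K} (hle : ∀ b ∈ B, IsIntegral B' b) (hB' : B' ≤ B)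
    (halg : ∀ ξ : K, IsAlgebraic B ξ) : ∀ ξ : K, IsAlgebraic B' ξ := by
  let _alg : Algebra B' B := (Subring.inclusion hB').toAlgebra
  have : IsScalarTower B' B K := IsScalarTower.of_algebraMap_eq (fun _ => rfl)
  have h1 : Algebra.IsIntegral B' B := ⟨fun b => by
    have := hle b b.2
    exact (isIntegral_algebraMap_iff (R := B') (A := B) (B := K) Subtype.val_injective).1 this⟩
  have h2 : Algebra.IsAlgebraic B K := ⟨halg⟩
  have h3 : Algebra.IsAlgebraic B' K := Algebra.IsAlgebraic.trans B' B K
  exact h3.isAlgebraic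

theorem chain_pull (φ : Ev E K) (L : E ≃L[ℂ] E') (D : Derivation ℤ K K)
    (h : (φ.pull (L : E →L[ℂ] E')).Chain D) : φ.Chain D := by
  obtain ⟨k, e, c, hD⟩ := h
  refine ⟨k, fun i => L.symm (e i), c, fun g hg => ?_⟩
  have h1 := hD (fun y => g (L.symm y)) (an_pull hg (L.symm : E' →L[ℂ] E))
  have h2 : (φ.pull (L : E →L[ℂ] E')).f (fun y => g (L.symm y)) = φ.f g := by
    change φ.f (fun x => g (L.symm (L x))) = _
    simp
  rw [h2] at h1
  rw [h1]
  apply Finset.sum_congr rfl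
  intro i _
  congr 1
  change φ.f (fun x => fderiv ℂ (fun y => g (L.symm y)) (L x) (e i)) = _
  have ha := an_dir (an_pull hg (L.symm : E' →L[ℂ] E)) (e i)
  apply φ.congr _ _ (an_pull ha (L : E →L[ℂ] E')) (an_dir hg _)
  have h3 := fderiv_pull hg (L.symm : E' →L[ℂ] E) (e i)
  have : Filter.Tendsto L (𝓝 0) (𝓝 0) := by simpa using L.continuous.tendsto 0
  filter_upwards [this.eventually h3] with x hx
  simpa using hx

theorem KL (m : ℕ) : ∀ (E : Type) [NormedAddCommGroup E] [NormedSpace ℂ E] [FiniteDimensional ℂ E],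
    Module.finrank ℂ E = m → ∀ φ : Ev E K, (∀ ξ : K, IsAlgebraic φ.B ξ) →
    ∀ ξ : K, (¬ ∃ c : ℂ, ξ = algebraMap ℂ K c) → ∃ D : Derivation ℤ K K, D ξ ≠ 0 ∧ φ.Chain D := by
  induction m using Nat.strong_induction_on with
  | _ m ih =>
  intro E _ _ _ hm φ halg ξ hξ
  by_cases hinj : ∀ g, AnalyticAt ℂ g 0 → φ.f g = 0 → ∀ᶠ x in 𝓝 (0:E), g x = 0
  · exact φ.case1 hinj halg ξ hξ
  push Not at hinj
  obtain ⟨g, hg, hg0, hgne⟩ := hinj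
  obtain ⟨v, hv⟩ := exists_dir hg (by rw [Filter.not_eventually]; exact hgne)
  have hv0 : v ≠ 0 := by
    rintro rfl
    simp only [smul_zero, Filter.eventually_const] at hv
    exact φ.ne_zero_of_unit g hg hv hg0
  obtain ⟨H, hH⟩ := Submodule.exists_isCompl (Submodule.span ℂ {v})
  let L₀ : (H × ℂ) ≃ₗ[ℂ] E := (LinearEquiv.prodCongr (LinearEquiv.refl ℂ H) (LinearEquiv.toSpanNonzeroSingleton ℂ E v hv0)).trans
    (Submodule.prodEquivOfIsCompl H (Submodule.span ℂ {v}) hH.symm)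
  let L : E ≃L[ℂ] (H × ℂ) := L₀.toContinuousLinearEquiv.symm
  have hL : ∀ t : ℂ, L.symm (0, t) = t • v := by
    intro t
    change L₀ (0, t) = t • v
    simp [L₀]
  have hfin : Module.finrank ℂ H < m := by
    have := L₀.finrank_eq
    rw [Module.finrank_prod, Module.finrank_self, hm] at this
    omega
  let φ₁ := φ.pull (L : E →L[ℂ] H × ℂ)
  have hφ₁g : φ₁.f (fun y => g (L.symm y)) = 0 := by
    change φ.f (fun x => g (L.symm (L x))) = 0
    simpa using hg0
  obtain ⟨d, w, hw, hw0, hW⟩ := φ₁.weier_rel (fun y => g (L.symm y)) (an_pull hg (L.symm : H × ℂ →L[ℂ] E)) hφ₁g (by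
    simpa only [hL] using hv)
  obtain ⟨hinte, hchain⟩ := φ₁.reduce d w hw hw0 hW
  have hBle : φ.B ≤ φ₁.B := by
    rintro _ ⟨h, hh, rfl⟩
    refine ⟨fun y => h (L.symm y), an_pull hh (L.symm : H × ℂ →L[ℂ] E), ?_⟩
    change φ.f (fun x => h (L.symm (L x))) = _
    simp
  have hBle' : (φ₁.pull (ContinuousLinearMap.fst ℂ H ℂ)).B ≤ φ.B := by
    rintro _ ⟨h, hh, rfl⟩
    exact ⟨fun x => h (L x).1, an_pull hh ((ContinuousLinearMap.fst ℂ H ℂ).comp (L : E →L[ℂ] H × ℂ)), rfl⟩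
  have halg' := isAlgebraic_trans_subring (fun b hb => hinte b (hBle hb)) hBle' halg
  obtain ⟨D, hD1, hD2⟩ := ih _ hfin H rfl (φ₁.pull (ContinuousLinearMap.fst ℂ H ℂ)) halg' ξ hξ
  exact ⟨D, hD1, φ.chain_pull L D (hchain D hD2)⟩

end Ev
end INNC
end

section
namespace INNC
open Topology

theorem Ev.KL' {E K : Type} [NormedAddCommGroup E] [NormedSpace ℂ E] [FiniteDimensional ℂ E]
    [Field K] [Algebra ℂ K] (φ : Ev E K) (F : E → ℂ) (hF : AnalyticAt ℂ F 0)
    (hne : ¬ ∃ c : ℂ, φ.f F = algebraMap ℂ K c) :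
    ∃ (k : ℕ) (e : Fin k → E) (c : Fin k → K),
      (∀ g, AnalyticAt ℂ g 0 → φ.f g = 0 → ∑ i, c i * φ.f (fun x => fderiv ℂ g x (e i)) = 0) ∧
      ∑ i, c i * φ.f (fun x => fderiv ℂ F x (e i)) ≠ 0 := by
  classical
  let K0 : Subfield K :=
    { (Subalgebra.algebraicClosure φ.B K).toSubring with
      inv_mem' := fun x hx => by
        have hx' : IsAlgebraic φ.B x := hx
        exact hx'.inv }
  have hB : ∀ g, AnalyticAt ℂ g 0 → φ.f g ∈ K0 := fun g hg => by
    change IsAlgebraic φ.B (φ.f g)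
    exact isAlgebraic_algebraMap (⟨φ.f g, g, hg, rfl⟩ : φ.B)
  let ι : ℂ →+* K0 := (algebraMap ℂ K).codRestrict K0 fun c => by
    rw [← φ.const]; exact hB _ analyticAt_const
  let _inst : Algebra ℂ K0 := ι.toAlgebra
  let ψ : Ev E K0 :=
    { f := fun g => if hg : AnalyticAt ℂ g 0 then ⟨φ.f g, hB g hg⟩ else 0
      add := fun g h hg hh => by
        rw [dif_pos hg, dif_pos hh, dif_pos (hg.fun_add hh)]
        exact Subtype.ext (φ.add g h hg hh)
      mul := fun g h hg hh => by
        rw [dif_pos hg, dif_pos hh, dif_pos (hg.fun_mul hh)]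
        exact Subtype.ext (φ.mul g h hg hh)
      const := fun c => by
        rw [dif_pos analyticAt_const]
        exact Subtype.ext (φ.const c)
      congr := fun g h hg hh e => by
        rw [dif_pos hg, dif_pos hh]
        exact Subtype.ext (φ.congr g h hg hh e) }
  have hψ : ∀ g, AnalyticAt ℂ g 0 → ((ψ.f g : K0) : K) = φ.f g := fun g hg => by
    change ((if hg : AnalyticAt ℂ g 0 then (⟨φ.f g, hB g hg⟩ : K0) else 0 : K0) : K) = _
    rw [dif_pos hg]
  have halg : ∀ ξ : K0, IsAlgebraic ψ.B ξ := by
    intro ξ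
    have h1 : IsAlgebraic φ.B (ξ : K) := ξ.2
    let g : ψ.B →+* φ.B := (K0.subtype.comp ψ.B.subtype).codRestrict φ.B (by
      rintro ⟨_, g, hg, rfl⟩
      exact ⟨g, hg, (hψ g hg).symm⟩)
    refine IsAlgebraic.of_ringHom_of_comp_eq g K0.subtype (a := ξ) h1 ?_ (Subtype.val_injective) ?_
    · rintro ⟨_, u, hu, rfl⟩
      exact ⟨⟨ψ.f u, u, hu, rfl⟩, Subtype.ext (hψ u hu)⟩
    · ext; rfl
  obtain ⟨D, hD, k, e, c, hc⟩ := Ev.KL _ E rfl ψ halg (ψ.f F) (by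
    rintro ⟨c, h⟩
    refine hne ⟨c, ?_⟩
    rw [← hψ F hF, h]; rfl)
  have key : ∀ g, AnalyticAt ℂ g 0 → ((D (ψ.f g) : K0) : K) = ∑ i, (c i : K) * φ.f (fun x => fderiv ℂ g x (e i)) := by
    intro g hg
    rw [hc g hg]
    push_cast
    refine Finset.sum_congr rfl fun i _ => ?_
    rw [hψ _ (an_dir hg _)]
  refine ⟨k, e, fun i => c i, ?_, ?_⟩
  · intro g hg h0
    rw [← key g hg]
    have : ψ.f g = 0 := Subtype.ext (by rw [hψ g hg, h0]; rfl)
    rw [this]; simp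
  · rw [← key F hF]
    simpa using hD

/-- A weak curve selection lemma. -/
theorem seq_tangent {E : Type} [NormedAddCommGroup E] [NormedSpace ℂ E] [FiniteDimensional ℂ E]
    (x : ℕ → E) (hx : Filter.Tendsto x Filter.atTop (𝓝 0)) (F : E → ℂ) (hF : AnalyticAt ℂ F 0) (hF0 : F 0 = 0)
    (hFx : ∀ k, F (x k) ≠ 0) :
    ∃ v : ℕ → E, (∀ g : E → ℂ, AnalyticAt ℂ g 0 → (∀ k, g (x k) = 0) →
        ∀ᶠ k in (Filter.hyperfilter ℕ : Filter ℕ), fderiv ℂ g (x k) (v k) = 0) ∧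
      ∀ᶠ k in (Filter.hyperfilter ℕ : Filter ℕ), fderiv ℂ F (x k) (v k) ≠ 0 := by
  let U := Filter.hyperfilter ℕ
  let K := Filter.Germ (U : Filter ℕ) ℂ
  let cst : ℂ →+* K := (Filter.Germ.coeRingHom (U : Filter ℕ)).comp (Pi.constRingHom ℕ ℂ)
  let _i : Algebra ℂ K := cst.toAlgebra
  have hxU : Filter.Tendsto x U (𝓝 0) := hx.mono_left Nat.hyperfilter_le_atTop
  let φ : Ev E K :=
    { f := fun g => ((fun k => g (x k) : ℕ → ℂ) : K)
      add := fun g h _ _ => rfl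
      mul := fun g h _ _ => rfl
      const := fun c => rfl
      congr := fun g h _ _ e => Filter.Germ.coe_eq.2 (hxU.eventually e) }
  obtain ⟨k, e, c, h1, h2⟩ := φ.KL' F hF (by
    rintro ⟨c, hc⟩
    have h3 : ∀ᶠ k in (U : Filter ℕ), F (x k) = c := Filter.Germ.coe_eq.1 hc
    have h4 : Filter.Tendsto (fun k => F (x k)) U (𝓝 0) := by
      have := hF.continuousAt.tendsto.comp hxU
      rwa [hF0] at this
    have h5 : Filter.Tendsto (fun k => F (x k)) U (𝓝 c) :=
      tendsto_const_nhds.congr' (h3.mono fun k hk => hk.symm)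
    have h6 := tendsto_nhds_unique h4 h5
    obtain ⟨k, hk⟩ := h3.exists
    exact hFx k (by rw [hk, ← h6]))
  choose γ hγ using fun i => Quotient.exists_rep (c i)
  have key : ∀ g : E → ℂ, ∑ i, c i * φ.f (fun x => fderiv ℂ g x (e i)) =
      ((fun n => fderiv ℂ g (x n) (∑ i, γ i n • e i) : ℕ → ℂ) : K) := by
    intro g
    have : (fun n => fderiv ℂ g (x n) (∑ i, γ i n • e i) : ℕ → ℂ) =
        ∑ i, (γ i) * fun n => fderiv ℂ g (x n) (e i) := by
      ext n
      simp [Finset.sum_apply]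
    rw [this]
    have h7 : ((∑ i, (γ i) * (fun n => fderiv ℂ g (x n) (e i)) : ℕ → ℂ) : K) =
      Filter.Germ.coeRingHom (U : Filter ℕ) (∑ i, (γ i) * (fun n => fderiv ℂ g (x n) (e i))) := rfl
    rw [h7, map_sum]
    refine Finset.sum_congr rfl fun i _ => ?_
    rw [map_mul, ← hγ i]
    rfl
  refine ⟨fun n => ∑ i, γ i n • e i, ?_, ?_⟩
  · intro g hg hg0
    have h3 := h1 g hg (by
      change ((fun k => g (x k) : ℕ → ℂ) : K) = ((fun _ => 0 : ℕ → ℂ) : K)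
      simp only [hg0])
    rw [key g] at h3
    exact Filter.Germ.coe_eq.1 h3
  · rw [key F] at h2
    rw [Ultrafilter.eventually_not]
    intro h
    exact h2 (Filter.Germ.coe_eq.2 h)
end INNC
end

section
namespace INNC
open Topology

/-- coordinatewise conjugation -/
noncomputable def cj (N : ℕ) : EuclideanSpace ℂ (Fin N) →ₗᵢ⋆[ℂ] EuclideanSpace ℂ (Fin N) where
  toFun z := WithLp.toLp 2 fun i => star (z i)
  map_add' x y := by ext i; simp
  map_smul' c x := by ext i; simp
  norm_map' x := by simp [EuclideanSpace.norm_eq]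

@[simp] theorem cj_apply {N : ℕ} (z : EuclideanSpace ℂ (Fin N)) (i : Fin N) : cj N z i = star (z i) := rfl
@[simp] theorem cj_cj {N : ℕ} (z : EuclideanSpace ℂ (Fin N)) : cj N (cj N z) = z := by ext i; simp

/-- conjugated multilinear map -/
noncomputable def cjMul {N n : ℕ} (p : ContinuousMultilinearMap ℂ (fun _ : Fin n => EuclideanSpace ℂ (Fin N)) ℂ) :
    ContinuousMultilinearMap ℂ (fun _ : Fin n => EuclideanSpace ℂ (Fin N)) ℂ where
  toFun v := star (p fun i => cj N (v i))
  map_update_add' := by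
    intro _ v i x y
    have h : ∀ z, (fun j => cj N (Function.update v i z j)) = Function.update (fun j => cj N (v j)) i (cj N z) := by
      intro z; ext1 j
      by_cases hj : j = i
      · subst hj; simp
      · simp [Function.update_of_ne hj]
    simp only [h]
    rw [map_add, ContinuousMultilinearMap.map_update_add, star_add]
  map_update_smul' := by
    intro _ v i c x
    have h : ∀ z, (fun j => cj N (Function.update v i z j)) = Function.update (fun j => cj N (v j)) i (cj N z) := by
      intro z; ext1 j
      by_cases hj : j = i
      · subst hj; simp
      · simp [Function.update_of_ne hj]
    simp only [h]
    rw [LinearIsometry.map_smulₛₗ, ContinuousMultilinearMap.map_update_smul]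
    simp
  cont := by
    refine continuous_star.comp (p.cont.comp ?_)
    exact continuous_pi fun i => (cj N).continuous.comp (continuous_apply i)

theorem cj_analytic {N : ℕ} {f : EuclideanSpace ℂ (Fin N) → ℂ} (hf : AnalyticAt ℂ f 0) :
    AnalyticAt ℂ (fun w => star (f (cj N w))) 0 := by
  obtain ⟨p, r, hp⟩ := hf
  refine ⟨fun n => cjMul (p n), r, ?_, hp.r_pos, ?_⟩
  · refine hp.r_le.trans ?_
    refine ENNReal.le_of_forall_nnreal_lt fun s hs => ?_
    obtain ⟨C, hC, h⟩ := p.norm_mul_pow_le_of_lt_radius hs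
    refine FormalMultilinearSeries.le_radius_of_bound _ C fun n => le_trans ?_ (h n)
    refine mul_le_mul_of_nonneg_right ?_ (by positivity)
    refine ContinuousMultilinearMap.opNorm_le_bound (norm_nonneg _) fun v => ?_
    have := (p n).le_opNorm fun i => cj N (v i)
    simp only [LinearIsometry.norm_map] at this
    change ‖star (p n fun i => cj N (v i))‖ ≤ _
    rwa [norm_star]
  · intro y hy
    have hy' : cj N y ∈ Metric.eball (0 : EuclideanSpace ℂ (Fin N)) r := by
      rw [Metric.mem_eball, edist_dist, dist_zero_right] at hy ⊢
      rwa [LinearIsometry.norm_map]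
    have h := (hp.hasSum hy').star
    rw [zero_add] at h ⊢
    exact h

theorem cj_fderiv {N : ℕ} {f : EuclideanSpace ℂ (Fin N) → ℂ} {p : EuclideanSpace ℂ (Fin N)}
    (hf : DifferentiableAt ℂ f p)
    (hf' : DifferentiableAt ℂ (fun w => star (f (cj N w))) (cj N p)) (b) :
    fderiv ℂ (fun w => star (f (cj N w))) (cj N p) b = star (fderiv ℂ f p (cj N b)) := by
  have h1 : HasDerivAt (fun t : ℝ => star (f (cj N (cj N p + t • b)))) (fderiv ℂ (fun w => star (f (cj N w))) (cj N p) b) 0 :=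
    (hf'.hasFDerivAt.restrictScalars ℝ).hasLineDerivAt b
  have h2 : HasDerivAt (fun t : ℝ => f (p + t • cj N b)) (fderiv ℂ f p (cj N b)) 0 :=
    (hf.hasFDerivAt.restrictScalars ℝ).hasLineDerivAt _
  have h3 := h2.star
  refine h1.unique (h3.congr_deriv rfl |>.congr_of_eventuallyEq ?_)
  refine Filter.Eventually.of_forall fun t => ?_
  have : cj N (cj N p + t • b) = p + t • cj N b := by
    ext i; simp
  simp only [this]

theorem transverse {N r : ℕ} (f : Fin r → EuclideanSpace ℂ (Fin N) → ℂ) (hf : ∀ i, AnalyticAt ℂ (f i) 0) (I : Finset (Fin r)) :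
    ∃ δ > (0:ℝ), ∀ p : EuclideanSpace ℂ (Fin N), p ≠ 0 → ‖p‖ < δ → (∀ i ∈ I, f i p = 0) →
      ∃ v, (∀ i ∈ I, fderiv ℂ (f i) p v = 0) ∧ inner ℂ p v ≠ 0 := by
  by_contra! hcon
  choose p hp0 hpn hpf hpv using fun k : ℕ => hcon (1 / ((k:ℝ) + 1)) (by positivity)
  have hplim : Filter.Tendsto p Filter.atTop (𝓝 0) := by
    rw [tendsto_zero_iff_norm_tendsto_zero]
    exact squeeze_zero (fun _ => norm_nonneg _) (fun k => (hpn k).le) tendsto_one_div_add_atTop_nhds_zero_nat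
  let V := EuclideanSpace ℂ (Fin N)
  let x : ℕ → V × V := fun k => (p k, cj N (p k))
  have hx : Filter.Tendsto x Filter.atTop (𝓝 0) := by
    refine hplim.prodMk_nhds ?_
    have := (cj N).continuous.tendsto 0
    rw [map_zero] at this
    exact this.comp hplim
  let pr : Fin N → (V →L[ℂ] ℂ) := fun j => EuclideanSpace.proj j
  let F : V × V → ℂ := fun z => ∑ j, pr j z.1 * pr j z.2
  have hFd : ∀ z, HasFDerivAt F (∑ j, (pr j z.1 • (pr j).comp (ContinuousLinearMap.snd ℂ V V) + pr j z.2 • (pr j).comp (ContinuousLinearMap.fst ℂ V V))) z := by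
    intro z
    refine HasFDerivAt.fun_sum fun j _ => ?_
    exact HasFDerivAt.mul ((pr j).comp (ContinuousLinearMap.fst ℂ V V)).hasFDerivAt ((pr j).comp (ContinuousLinearMap.snd ℂ V V)).hasFDerivAt
  have hF : AnalyticAt ℂ F 0 := by
    refine Finset.analyticAt_fun_sum _ fun j _ => AnalyticAt.fun_mul ?_ ?_
    · exact ((pr j).comp (ContinuousLinearMap.fst ℂ V V)).analyticAt 0
    · exact ((pr j).comp (ContinuousLinearMap.snd ℂ V V)).analyticAt 0
  have hinner : ∀ q v : V, inner ℂ q v = ∑ j, pr j (cj N q) * pr j v := by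
    intro q v
    have h : inner ℂ q v = ∑ j, inner ℂ (q j) (v j) := PiLp.inner_apply q v
    rw [h]
    refine Finset.sum_congr rfl fun j _ => ?_
    exact mul_comm _ _
  have hFx : ∀ k, F (x k) ≠ 0 := by
    intro k
    have : F (x k) = inner ℂ (p k) (p k) := by
      rw [hinner]
      exact Finset.sum_congr rfl fun j _ => mul_comm _ _
    rw [this]
    exact inner_self_ne_zero.2 (hp0 k)
  obtain ⟨v, hv1, hv2⟩ := seq_tangent x hx F hF (by simp [F]) hFx
  let A1 := ContinuousLinearMap.fst ℂ V V
  let A2 := ContinuousLinearMap.snd ℂ V V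
  have e1 : ∀ᶠ k in (Filter.hyperfilter ℕ : Filter ℕ), ∀ i ∈ I, fderiv ℂ (fun z => f i (A1 z)) (x k) (v k) = 0 := by
    rw [Filter.eventually_all_finset]
    intro i hi
    exact hv1 (fun z => f i (A1 z)) (Ev.an_pull (hf i) A1) fun k => hpf k i hi
  have e2 : ∀ᶠ k in (Filter.hyperfilter ℕ : Filter ℕ), ∀ i ∈ I, fderiv ℂ (fun z => star (f i (cj N (A2 z)))) (x k) (v k) = 0 := by
    rw [Filter.eventually_all_finset]
    intro i hi
    refine hv1 (fun z => star (f i (cj N (A2 z)))) (Ev.an_pull (cj_analytic (hf i)) A2) fun k => ?_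
    change star (f i (cj N (cj N (p k)))) = 0
    rw [cj_cj, hpf k i hi, star_zero]
  have e3 : ∀ᶠ k in (Filter.hyperfilter ℕ : Filter ℕ), ∀ i ∈ I, AnalyticAt ℂ (f i) (p k) := by
    rw [Filter.eventually_all_finset]
    intro i hi
    exact (hplim.mono_left Nat.hyperfilter_le_atTop).eventually (hf i).eventually_analyticAt
  have e4 : ∀ᶠ k in (Filter.hyperfilter ℕ : Filter ℕ), ∀ i ∈ I, AnalyticAt ℂ (fun w => star (f i (cj N w))) (cj N (p k)) := by
    rw [Filter.eventually_all_finset]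
    intro i hi
    have := (cj N).continuous.tendsto 0
    rw [map_zero] at this
    exact (this.comp (hplim.mono_left Nat.hyperfilter_le_atTop)).eventually (cj_analytic (hf i)).eventually_analyticAt
  obtain ⟨k, h1, h2, h3, h4, h5⟩ := (e1.and (e2.and (e3.and (e4.and hv2)))).exists
  rcases hvk : v k with ⟨a, b⟩
  have ha : inner ℂ (p k) a = 0 := by
    refine hpv k a fun i hi => ?_
    have h6 := h1 i hi
    have h7 : HasFDerivAt (fun z => f i (A1 z)) ((fderiv ℂ (f i) (p k)).comp A1) (x k) :=
      HasFDerivAt.comp (x k) (h3 i hi).differentiableAt.hasFDerivAt A1.hasFDerivAt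
    rw [h7.fderiv, hvk] at h6
    exact h6
  have hb : inner ℂ (p k) (cj N b) = 0 := by
    refine hpv k _ fun i hi => ?_
    have h6 := h2 i hi
    have h7 : HasFDerivAt (fun z => star (f i (cj N (A2 z)))) ((fderiv ℂ (fun w => star (f i (cj N w))) (cj N (p k))).comp A2) (x k) :=
      HasFDerivAt.comp (x k) (h4 i hi).differentiableAt.hasFDerivAt A2.hasFDerivAt
    rw [h7.fderiv, hvk] at h6
    have h8 : fderiv ℂ (fun w => star (f i (cj N w))) (cj N (p k)) b = 0 := h6
    rw [cj_fderiv (h3 i hi).differentiableAt (h4 i hi).differentiableAt] at h8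
    exact star_eq_zero.1 h8
  apply h5
  rw [(hFd (x k)).fderiv, hvk]
  have ha' := ha
  rw [hinner] at ha'
  have hb' := congrArg star hb
  rw [hinner, star_sum, star_zero] at hb'
  simp only [sum_apply, add_apply, Finset.sum_add_distrib]
  have e : ∀ s t : ℂ, s = 0 → t = 0 → s + t = 0 := fun s t h h' => by rw [h, h', add_zero]
  refine e _ _ ?_ ?_
  · rw [← hb']
    refine Finset.sum_congr rfl fun j _ => ?_
    have h9 : ∀ s t : ℂ, s * t = star (star s * star t) := fun s t => by simp
    exact h9 _ _
  · rw [← ha']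
    refine Finset.sum_congr rfl fun j _ => ?_
    simp [x, pr]
end INNC
end

section
namespace INNC
open Topology

/-- The image of the segment from `x` to `y` under `H`. -/
def seg {E V : Type} [NormedAddCommGroup E] [NormedSpace ℝ E] (H : E → V) (x y : E) : unitInterval → V :=
  fun t => H (x + (t : ℝ) • (y - x))

/-- Path cocycles on `Y`. -/
def IsCoc {V A : Type} [TopologicalSpace V] [AddCommGroup A] (Y : Set V) (c : (unitInterval → V) → A) : Prop :=
  ∀ G : ℝ × ℝ → V, Continuous G → (∀ u, G u ∈ Y) →
    c (seg G (0, 0) (1, 0)) + c (seg G (1, 0) (0, 1)) = c (seg G (0, 0) (0, 1))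

theorem seg_zero {E V : Type} [NormedAddCommGroup E] [NormedSpace ℝ E] (H : E → V) (x y : E) : seg H x y 0 = H x := by simp [seg]
theorem seg_one {E V : Type} [NormedAddCommGroup E] [NormedSpace ℝ E] (H : E → V) (x y : E) : seg H x y 1 = H y := by simp [seg]

theorem seg_mem {E : Type} [NormedAddCommGroup E] [NormedSpace ℝ E] {K : Set E} (hK : Convex ℝ K) {x y : E}
    (hx : x ∈ K) (hy : y ∈ K) (t : unitInterval) : x + (t : ℝ) • (y - x) ∈ K :=
  hK.add_smul_sub_mem hx hy t.2

theorem seg_continuous {E V : Type} [NormedAddCommGroup E] [NormedSpace ℝ E] [TopologicalSpace V] {H : E → V} {K : Set E} (hK : Convex ℝ K)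
    (hH : ContinuousOn H K) {x y : E} (hx : x ∈ K) (hy : y ∈ K) : Continuous (seg H x y) :=
  hH.comp_continuous (by fun_prop) (seg_mem hK hx hy)

namespace IsCoc
variable {V A : Type} [TopologicalSpace V] [AddCommGroup A] {Y : Set V} {c : (unitInterval → V) → A}

theorem tri (hc : IsCoc Y c) {E : Type} [NormedAddCommGroup E] [NormedSpace ℝ E] {K : Set E} (hK : Convex ℝ K)
    {H : E → V} (hH : ContinuousOn H K) (hY : ∀ x ∈ K, H x ∈ Y) {x y z : E} (hx : x ∈ K) (hy : y ∈ K) (hz : z ∈ K) :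
    c (seg H x y) + c (seg H y z) = c (seg H x z) := by
  let a : ℝ × ℝ → ℝ := fun u => max 0 (min u.1 1)
  let b : ℝ × ℝ → ℝ := fun u => max 0 (min u.2 (1 - a u))
  let B : ℝ × ℝ → E := fun u => x + a u • (y - x) + b u • (z - x)
  have ha0 : ∀ u, 0 ≤ a u := fun u => le_max_left _ _
  have hb0 : ∀ u, 0 ≤ b u := fun u => le_max_left _ _
  have ha1 : ∀ u, a u ≤ 1 := fun u => max_le zero_le_one (min_le_right _ _)
  have hb1 : ∀ u, b u ≤ 1 - a u := fun u => max_le (by linarith [ha1 u]) (min_le_right _ _)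
  have hac : Continuous a := by fun_prop
  have hbc : Continuous b := by fun_prop
  have hB : ∀ u, B u ∈ K := by
    intro u
    have h := hK.sum_mem (t := Finset.univ) (w := ![1 - a u - b u, a u, b u]) (z := ![x, y, z])
      (by intro i _; fin_cases i <;> simp <;> linarith [ha0 u, hb0 u, hb1 u])
      (by simp only [Fin.sum_univ_three, Matrix.cons_val_zero, Matrix.cons_val_one, Matrix.cons_val]; ring) (by intro i _; fin_cases i <;> simpa)
    simp only [Fin.sum_univ_three] at h
    convert h using 1
    simp only [B, Matrix.cons_val_zero, Matrix.cons_val_one, Matrix.cons_val]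
    module
  have hBc : Continuous B := by fun_prop
  have h := hc (fun u => H (B u)) (hH.comp_continuous hBc hB) (fun u => hY _ (hB u))
  have e1 : seg (fun u => H (B u)) (0, 0) (1, 0) = seg H x y := by
    funext t
    have h1 := t.2.1
    have h2 := t.2.2
    simp only [seg, B, a, b]
    congr 1
    simp [h1, h2]
  have e2 : seg (fun u => H (B u)) (1, 0) (0, 1) = seg H y z := by
    funext t
    have h1 := t.2.1
    have h2 := t.2.2
    have h3 : a ((1, 0) + (t:ℝ) • ((0, 1) - (1, 0))) = 1 - t := by
      have : ((1, 0) + (t:ℝ) • ((0, 1) - (1, 0)) : ℝ × ℝ).1 = 1 - t := by simp; ring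
      simp only [a]
      rw [this, min_eq_left (by linarith), max_eq_right (by linarith)]
    have h4 : b ((1, 0) + (t:ℝ) • ((0, 1) - (1, 0))) = t := by
      have : ((1, 0) + (t:ℝ) • ((0, 1) - (1, 0)) : ℝ × ℝ).2 = t := by simp
      simp only [b]
      rw [h3, this, min_eq_left (by linarith), max_eq_right (by linarith)]
    simp only [seg, B]
    rw [h3, h4]
    congr 1
    module
  have e3 : seg (fun u => H (B u)) (0, 0) (0, 1) = seg H x z := by
    funext t
    have h1 := t.2.1
    have h2 := t.2.2
    simp only [seg, B, a, b]
    congr 1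
    simp [h1, h2]
  rwa [e1, e2, e3] at h

theorem const (hc : IsCoc Y c) {y : V} (hy : y ∈ Y) : c (fun _ => y) = 0 := by
  have h := hc.tri (E := ℝ) (K := Set.univ) convex_univ (H := fun _ => y) continuousOn_const (fun _ _ => hy)
    (x := 0) (y := 0) (z := 0) trivial trivial trivial
  have e : seg (fun _ : ℝ => y) 0 0 = fun _ => y := rfl
  rw [e] at h
  simpa using h

theorem straight (hc : IsCoc Y c) {E : Type} [NormedAddCommGroup E] [NormedSpace ℝ E] {K : Set E} (hK : Convex ℝ K)
    {H : E → V} (hH : ContinuousOn H K) (hY : ∀ x ∈ K, H x ∈ Y) {γ : unitInterval → E} (hγ : Continuous γ)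
    (hγK : ∀ t, γ t ∈ K) : c (fun t => H (γ t)) = c (seg H (γ 0) (γ 1)) := by
  let π : ℝ → unitInterval := Set.projIcc 0 1 zero_le_one
  have hπ : Continuous π := continuous_projIcc
  have hπt : ∀ t : unitInterval, π t = t := fun t => Set.projIcc_val zero_le_one t
  have hπ0 : π 0 = 0 := hπt 0
  have hπ1 : π 1 = 1 := hπt 1
  let B : ℝ × ℝ → E := fun u => γ (π u.2) + (π u.1 : ℝ) • ((γ 0 + (π u.2 : ℝ) • (γ 1 - γ 0)) - γ (π u.2))
  have hB : ∀ u, B u ∈ K := fun u => seg_mem hK (hγK _) (seg_mem hK (hγK 0) (hγK 1) _) _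
  have hBc : Continuous B := by fun_prop
  have tri := fun x y z => hc.tri (E := ℝ × ℝ) (K := Set.univ) convex_univ (H := fun u => H (B u))
    (hH.comp_continuous hBc hB).continuousOn (fun u _ => hY _ (hB u)) (x := x) (y := y) (z := z) trivial trivial trivial
  have e1 : seg (fun u => H (B u)) (0, 0) (0, 1) = fun t => H (γ t) := by
    funext t; simp [seg, B, hπt, hπ0]
  have e2 : seg (fun u => H (B u)) (1, 0) (1, 1) = seg H (γ 0) (γ 1) := by
    funext t; simp [seg, B, hπt, hπ1]
  have e3 : seg (fun u => H (B u)) (0, 0) (1, 0) = fun _ => H (γ 0) := by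
    funext t; simp [seg, B, hπ0]
  have e4 : seg (fun u => H (B u)) (0, 1) (1, 1) = fun _ => H (γ 1) := by
    funext t; simp [seg, B, hπ1]
  have t1 := tri (0, 0) (0, 1) (1, 1)
  have t2 := tri (0, 0) (1, 0) (1, 1)
  rw [e1, e4, hc.const (hY _ (hγK 1)), ← t2, e3, e2, hc.const (hY _ (hγK 0))] at t1
  simpa using t1

/-- Local coboundary implies global coboundary, along paths. -/
theorem of_local (hc : IsCoc Y c) (b : V → A)
    (hloc : ∀ p ∈ Y, ∃ N, IsOpen N ∧ p ∈ N ∧ ∀ γ : unitInterval → V, Continuous γ → (∀ t, γ t ∈ N ∩ Y) →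
      c γ = b (γ 1) - b (γ 0)) (γ : unitInterval → V) (hγ : Continuous γ) (hγY : ∀ t, γ t ∈ Y) :
    c γ = b (γ 1) - b (γ 0) := by
  let π : ℝ → unitInterval := Set.projIcc 0 1 zero_le_one
  have hπ : Continuous π := continuous_projIcc
  have hπt : ∀ t : unitInterval, π t = t := fun t => Set.projIcc_val zero_le_one t
  have hπ0 : π 0 = 0 := hπt 0
  have hπ1 : π 1 = 1 := hπt 1
  let g : ℝ → V := fun t => γ (π t)
  have hg : Continuous g := hγ.comp hπ
  have tri := fun x y z => hc.tri (E := ℝ) (K := Set.univ) convex_univ (H := g)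
    hg.continuousOn (fun u _ => hγY _) (x := x) (y := y) (z := z) trivial trivial trivial
  let F : ℝ → A := fun t => c (seg g 0 t) - b (g t)
  have hF : IsLocallyConstant F := by
    rw [IsLocallyConstant.iff_eventually_eq]
    intro t
    obtain ⟨N, hN, hpN, h⟩ := hloc (g t) (hγY _)
    obtain ⟨δ, hδ, hball⟩ := Metric.isOpen_iff.1 (hN.preimage hg) t hpN
    filter_upwards [Metric.ball_mem_nhds t hδ] with s hs
    have h1 := h (seg g t s) (seg_continuous convex_univ hg.continuousOn trivial trivial) fun u =>
      ⟨hball (seg_mem (convex_ball t δ) (Metric.mem_ball_self hδ) hs u), hγY _⟩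
    rw [seg_zero, seg_one] at h1
    have h2 := tri 0 t s
    simp only [F]
    rw [← h2, h1]
    abel
  have h := hF.apply_eq_of_preconnectedSpace 0 1
  simp only [F] at h
  have e0 : seg g 0 0 = fun _ => γ 0 := by funext t; simp [seg, g, hπ0]
  have e1 : seg g 0 1 = γ := by funext t; simp [seg, g, hπt]
  rw [e0, e1, hc.const (hγY 0)] at h
  simp only [g, hπ0, hπ1] at h
  rw [zero_sub, neg_eq_iff_eq_neg, neg_sub] at h
  rw [h]; abel

theorem sub {c' : (unitInterval → V) → A} (hc : IsCoc Y c) (hc' : IsCoc Y c') : IsCoc Y (fun γ => c γ - c' γ) := by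
  intro G hG hY
  simp only
  rw [← hc G hG hY, ← hc' G hG hY]; abel

theorem smul (n : (unitInterval → V) → ℤ) (hn : IsCoc Y n) (a : A) : IsCoc Y (fun γ => n γ • a) := by
  intro G hG hY
  simp only
  rw [← hn G hG hY, add_smul]

theorem sum {ι : Type} (s : Finset ι) {c : ι → (unitInterval → V) → A} (hc : ∀ i, IsCoc Y (c i)) :
    IsCoc Y (fun γ => ∑ i ∈ s, c i γ) := by
  intro G hG hY
  simp only
  rw [← Finset.sum_add_distrib]
  exact Finset.sum_congr rfl fun i _ => hc i G hG hY

end IsCoc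

/-! ### Winding numbers -/

theorem exists_log {E : Type} [NormedAddCommGroup E] [NormedSpace ℝ E] {g : E → ℂ} (hg : Continuous g)
    (h0 : ∀ x, g x ≠ 0) : ∃ l : E → ℂ, Continuous l ∧ ∀ x, Complex.exp (l x) = g x := by
  have hU : IsSimplyConnected (Set.univ : Set E) := by
    have : ContractibleSpace (Set.univ : Set E) :=
      (Homeomorph.Set.univ E).symm.contractibleSpace_iff.1 inferInstance
    exact SimplyConnectedSpace.ofContractible _
  obtain ⟨l, h1, h2⟩ := Complex.exists_continuousOn_eqOn_exp_comp hU isOpen_univ hg.continuousOn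
    (by rintro ⟨x, _, hx⟩; exact h0 x hx)
  exact ⟨l, continuousOn_univ.1 h1, fun x => h2 trivial⟩

theorem exists_log_path {g : unitInterval → ℂ} (hg : Continuous g)
    (h0 : ∀ x, g x ≠ 0) : ∃ l : unitInterval → ℂ, Continuous l ∧ ∀ x, Complex.exp (l x) = g x := by
  let π : ℝ → unitInterval := Set.projIcc 0 1 zero_le_one
  obtain ⟨l, hl, h⟩ := exists_log (g := fun t => g (π t)) (hg.comp continuous_projIcc) (fun t => h0 _)
  exact ⟨fun t => l t, by fun_prop, fun t => by rw [h]; exact congrArg g (Set.projIcc_val zero_le_one t)⟩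

theorem wind_aux {g : unitInterval → ℂ} (hg : Continuous g) (h0 : ∀ x, g x ≠ 0) :
    ∃ n : ℤ, ∀ l : unitInterval → ℂ, Continuous l → (∀ x, Complex.exp (l x) = g x) →
      l 1 - l 0 = Complex.log (g 1) - Complex.log (g 0) + n * (2 * Real.pi * Complex.I) := by
  obtain ⟨l, hl, h⟩ := exists_log_path hg h0
  obtain ⟨m, hm⟩ := Complex.exp_eq_exp_iff_exists_int.1 ((h 1).trans (Complex.exp_log (h0 1)).symm)
  obtain ⟨k, hk⟩ := Complex.exp_eq_exp_iff_exists_int.1 ((h 0).trans (Complex.exp_log (h0 0)).symm)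
  refine ⟨m - k, fun l' hl' h' => ?_⟩
  have hd : ∀ t, ∃ n : ℤ, l' t = l t + n * (2 * Real.pi * Complex.I) := fun t =>
    Complex.exp_eq_exp_iff_exists_int.1 ((h' t).trans (h t).symm)
  choose n hn using hd
  have hnc : Continuous fun t => (n t : ℂ) := by
    have : (fun t => (n t : ℂ)) = fun t => (l' t - l t) / (2 * Real.pi * Complex.I) := by
      funext t
      rw [hn t, add_sub_cancel_left, mul_div_assoc, div_self Complex.two_pi_I_ne_zero, mul_one]
    rw [this]; fun_prop
  have hnc' : Continuous n := by
    have hemb : IsClosedEmbedding (fun k : ℤ => (k : ℂ)) := Complex.isClosedEmbedding_intCast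
    exact hemb.isInducing.continuous_iff.2 hnc
  have hnn : n 0 = n 1 := (IsLocallyConstant.iff_continuous n).2 hnc' |>.apply_eq_of_preconnectedSpace 0 1
  rw [hn 1, hn 0, hm, hk, hnn]
  push_cast; ring

open Classical in
/-- The winding cocycle of a nonvanishing function. -/
noncomputable def wind (g : unitInterval → ℂ) : ℤ :=
  if h : Continuous g ∧ ∀ x, g x ≠ 0 then (wind_aux h.1 h.2).choose else 0

theorem wind_spec {g : unitInterval → ℂ} {l : unitInterval → ℂ} (hl : Continuous l) (h : ∀ x, Complex.exp (l x) = g x) :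
    l 1 - l 0 = Complex.log (g 1) - Complex.log (g 0) + wind g * (2 * Real.pi * Complex.I) := by
  have hh : Continuous g ∧ ∀ x, g x ≠ 0 := by
    have : g = fun x => Complex.exp (l x) := by funext x; rw [h]
    rw [this]
    exact ⟨by fun_prop, fun x => Complex.exp_ne_zero _⟩
  rw [wind, dif_pos hh]
  exact (wind_aux hh.1 hh.2).choose_spec l hl h

theorem wind_isCoc {V : Type} [TopologicalSpace V] {Y : Set V} {f : V → ℂ} (hf : ContinuousOn f Y) (h0 : ∀ y ∈ Y, f y ≠ 0) :
    IsCoc Y (fun γ => wind (fun t => f (γ t))) := by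
  intro G hG hY
  obtain ⟨L, hL, h⟩ := exists_log (g := fun u => f (G u)) (hf.comp_continuous hG hY) fun u => h0 _ (hY u)
  have key : ∀ x y, L y - L x = Complex.log (f (G y)) - Complex.log (f (G x)) + wind (fun t => f (seg G x y t)) * (2 * Real.pi * Complex.I) := by
    intro x y
    have := wind_spec (g := fun t => f (seg G x y t)) (l := seg L x y)
      (seg_continuous convex_univ hL.continuousOn trivial trivial) (fun t => h _)
    simpa only [seg_zero, seg_one] using this
  have h1 := key (0, 0) (1, 0)
  have h2 := key (1, 0) (0, 1)
  have h3 := key (0, 0) (0, 1)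
  have h4 : ((wind (fun t => f (seg G (0, 0) (1, 0) t)) + wind (fun t => f (seg G (1, 0) (0, 1) t)) : ℤ) : ℂ) * (2 * Real.pi * Complex.I) =
      (wind (fun t => f (seg G (0, 0) (0, 1) t)) : ℂ) * (2 * Real.pi * Complex.I) := by
    push_cast
    linear_combination h3 - h1 - h2
  have h5 := mul_right_cancel₀ Complex.two_pi_I_ne_zero h4
  exact_mod_cast h5

end INNC
end

section
namespace INNC
open Topology

/-- Good neighbourhoods. -/
structure Good {V : Type} [TopologicalSpace V] {r : ℕ} (f : Fin r → V → ℂ) (Y N : Set V) (J : Set (Fin r)) : Prop where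
  nonempty : (N ∩ Y).Nonempty
  conn : ∀ x ∈ N ∩ Y, ∀ y ∈ N ∩ Y, ∃ γ : unitInterval → V, Continuous γ ∧ (∀ t, γ t ∈ N ∩ Y) ∧ γ 0 = x ∧ γ 1 = y
  merid : ∀ i ∈ J, ∃ γ : unitInterval → V, Continuous γ ∧ (∀ t, γ t ∈ N ∩ Y) ∧ γ 0 = γ 1 ∧
    ∀ j, wind (fun t => f j (γ t)) = if j = i then 1 else 0
  triv : ∀ i ∉ J, ∃ b : V → ℤ, ∀ γ : unitInterval → V, Continuous γ → (∀ t, γ t ∈ N ∩ Y) →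
    wind (fun t => f i (γ t)) = b (γ 1) - b (γ 0)
  coc : ∀ (A : Type) [AddCommGroup A] (c : (unitInterval → V) → A), IsCoc Y c → ∃ (a : Fin r → A) (b : V → A),
    ∀ γ : unitInterval → V, Continuous γ → (∀ t, γ t ∈ N ∩ Y) →
      c γ = b (γ 1) - b (γ 0) + ∑ i, wind (fun t => f i (γ t)) • a i

theorem good_of_chart {V W κ : Type} [TopologicalSpace V] [NormedAddCommGroup W] [NormedSpace ℝ W] [Fintype κ] [DecidableEq κ] {r : ℕ}
    (f : Fin r → V → ℂ) (Y N : Set V) (hfY : ∀ i, ∀ y ∈ Y, f i y ≠ 0) (ι : κ → Fin r) (hι : Function.Injective ι)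
    (δ : ℝ) (hδ : 0 < δ) (Φ : (κ → ℂ) × W → V) (ω : V → W)
    (hΦ : ContinuousOn Φ {u | (∀ k, ‖u.1 k‖ < δ) ∧ ‖u.2‖ < δ})
    (hΦf : ∀ u, (∀ k, ‖u.1 k‖ < δ) → ‖u.2‖ < δ → ∀ k, f (ι k) (Φ u) = u.1 k)
    (hΦY : ∀ u, (∀ k, ‖u.1 k‖ < δ) → ‖u.2‖ < δ → (∀ k, u.1 k ≠ 0) → Φ u ∈ N ∩ Y)
    (hNf : ∀ x ∈ N ∩ Y, ∀ k, ‖f (ι k) x‖ < δ) (hNω : ∀ x ∈ N ∩ Y, ‖ω x‖ < δ)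
    (hfc : ∀ k, ContinuousOn (f (ι k)) (N ∩ Y)) (hωc : ContinuousOn ω (N ∩ Y))
    (hinv : ∀ x ∈ N ∩ Y, Φ (fun k => f (ι k) x, ω x) = x)
    (hL : ∀ j ∉ Set.range ι, ∃ L : V → ℂ, ContinuousOn L (N ∩ Y) ∧ ∀ x ∈ N ∩ Y, Complex.exp (L x) = f j x) :
    Good f Y N (Set.range ι) := by
  let K : Set ((κ → ℂ) × W) := {u | (∀ k, (u.1 k).re < Real.log δ) ∧ ‖u.2‖ < δ}
  have hK : Convex ℝ K := by
    have h1 : Convex ℝ {u : (κ → ℂ) × W | ∀ k, (u.1 k).re < Real.log δ} := by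
      rw [Set.ofPred_forall]
      refine convex_iInter fun k => ?_
      exact convex_halfSpace_lt (f := fun u : (κ → ℂ) × W => (u.1 k).re) ⟨fun x y => by simp, fun c x => by simp⟩ _
    have h2 : Convex ℝ {u : (κ → ℂ) × W | ‖u.2‖ < δ} := by
      have := (convex_ball (0 : W) δ).linear_preimage (LinearMap.snd ℝ (κ → ℂ) W)
      simpa [Set.preimage, Metric.mem_ball] using this
    exact h1.inter h2
  let ex : (κ → ℂ) × W → (κ → ℂ) × W := fun u => (fun k => Complex.exp (u.1 k), u.2)
  have hexc : Continuous ex := by fun_prop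
  have hexK : ∀ u ∈ K, (∀ k, ‖(ex u).1 k‖ < δ) ∧ ‖(ex u).2‖ < δ := by
    intro u hu
    refine ⟨fun k => ?_, hu.2⟩
    change ‖Complex.exp (u.1 k)‖ < δ
    rw [Complex.norm_exp]
    exact (Real.lt_log_iff_exp_lt hδ).1 (hu.1 k)
  let H : (κ → ℂ) × W → V := fun u => Φ (ex u)
  have hH : ContinuousOn H K := hΦ.comp hexc.continuousOn hexK
  have hHN : ∀ u ∈ K, H u ∈ N ∩ Y := fun u hu =>
    hΦY _ (hexK u hu).1 (hexK u hu).2 fun k => Complex.exp_ne_zero _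
  have hHf : ∀ u ∈ K, ∀ k, f (ι k) (H u) = Complex.exp (u.1 k) := fun u hu k =>
    hΦf _ (hexK u hu).1 (hexK u hu).2 k
  let s : V → (κ → ℂ) × W := fun y => (fun k => Complex.log (f (ι k) y), ω y)
  have hsK : ∀ y ∈ N ∩ Y, s y ∈ K := by
    intro y hy
    refine ⟨fun k => ?_, hNω y hy⟩
    change (Complex.log (f (ι k) y)).re < _
    rw [Complex.log_re]
    exact Real.log_lt_log (norm_pos_iff.2 (hfY _ y hy.2)) (hNf y hy k)
  have hHs : ∀ y ∈ N ∩ Y, H (s y) = y := by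
    intro y hy
    have : ex (s y) = (fun k => f (ι k) y, ω y) := by
      ext k
      · exact Complex.exp_log (hfY _ y hy.2)
      · rfl
    change Φ (ex (s y)) = y
    rw [this, hinv y hy]
  let T : (κ → ℤ) → (κ → ℂ) × W := fun m => (fun k => m k * (2 * Real.pi * Complex.I), 0)
  have hTadd : ∀ m m', T (m + m') = T m + T m' := by
    intro m m'
    ext k
    · simp [T]; ring
    · simp [T]
  have hTK : ∀ m, ∀ u ∈ K, u + T m ∈ K := by
    intro m u hu
    refine ⟨fun k => ?_, ?_⟩
    · have := hu.1 k
      simpa [T] using this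
    · simpa [T] using hu.2
  have hHT : ∀ m u, H (u + T m) = H u := by
    intro m u
    have : ex (u + T m) = ex u := by
      ext k
      · change Complex.exp (u.1 k + m k * (2 * Real.pi * Complex.I)) = Complex.exp (u.1 k)
        exact Complex.exp_eq_exp_iff_exists_int.2 ⟨m k, rfl⟩
      · simp [ex, T]
    change Φ _ = Φ _
    rw [this]
  obtain ⟨u0, hu0⟩ : K.Nonempty := ⟨(fun _ => ((Real.log δ - 1 : ℝ) : ℂ), 0), fun k => by
    change ((Real.log δ - 1 : ℝ) : ℂ).re < _
    rw [Complex.ofReal_re]; linarith, by simpa using hδ⟩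
  have htriv : ∀ j ∉ Set.range ι, ∃ b : V → ℤ, ∀ γ : unitInterval → V, Continuous γ → (∀ t, γ t ∈ N ∩ Y) →
      wind (fun t => f j (γ t)) = b (γ 1) - b (γ 0) := by
    intro j hj
    obtain ⟨L, hLc, hLe⟩ := hL j hj
    have hd : ∀ x, ∃ n : ℤ, x ∈ N ∩ Y → L x = Complex.log (f j x) + n * (2 * Real.pi * Complex.I) := by
      intro x
      by_cases hx : x ∈ N ∩ Y
      · obtain ⟨n, hn⟩ := Complex.exp_eq_exp_iff_exists_int.1 ((hLe x hx).trans (Complex.exp_log (hfY j x hx.2)).symm)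
        exact ⟨n, fun _ => hn⟩
      · exact ⟨0, fun h => absurd h hx⟩
    choose b hb using hd
    refine ⟨b, fun γ hγ hγN => ?_⟩
    have h := wind_spec (g := fun t => f j (γ t)) (l := fun t => L (γ t)) (hLc.comp_continuous hγ hγN) fun t => hLe _ (hγN t)
    simp only [hb _ (hγN 1), hb _ (hγN 0)] at h
    have h4 : (wind (fun t => f j (γ t)) : ℂ) * (2 * Real.pi * Complex.I) = ((b (γ 1) - b (γ 0) : ℤ) : ℂ) * (2 * Real.pi * Complex.I) := by
      push_cast
      linear_combination -h
    exact_mod_cast mul_right_cancel₀ Complex.two_pi_I_ne_zero h4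
  refine ⟨⟨H u0, hHN u0 hu0⟩, ?_, ?_, htriv, ?_⟩
  · intro x hx y hy
    exact ⟨seg H (s x) (s y), seg_continuous hK hH (hsK x hx) (hsK y hy),
      fun t => hHN _ (seg_mem hK (hsK x hx) (hsK y hy) t), by rw [seg_zero, hHs x hx], by rw [seg_one, hHs y hy]⟩
  · rintro _ ⟨k, rfl⟩
    let m : κ → ℤ := Pi.single k 1
    have hc := seg_continuous hK hH hu0 (hTK m u0 hu0)
    have hN : ∀ t, seg H u0 (u0 + T m) t ∈ N ∩ Y := fun t => hHN _ (seg_mem hK hu0 (hTK m u0 hu0) t)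
    have h01 : seg H u0 (u0 + T m) 0 = seg H u0 (u0 + T m) 1 := by rw [seg_zero, seg_one, hHT]
    refine ⟨seg H u0 (u0 + T m), hc, hN, h01, fun j => ?_⟩
    by_cases hj : j ∈ Set.range ι
    · obtain ⟨k', rfl⟩ := hj
      have h := wind_spec (g := fun t => f (ι k') (seg H u0 (u0 + T m) t)) (l := fun t => (u0 + (t:ℝ) • (u0 + T m - u0)).1 k')
        (by fun_prop) (fun t => (hHf _ (seg_mem hK hu0 (hTK m u0 hu0) t) k').symm)
      simp only [← h01, sub_self, zero_add] at h
      have h4 : (wind (fun t => f (ι k') (seg H u0 (u0 + T m) t)) : ℂ) * (2 * Real.pi * Complex.I) = ((m k' : ℤ) : ℂ) * (2 * Real.pi * Complex.I) := by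
        rw [← h]
        simp [T]
      have h5 : wind (fun t => f (ι k') (seg H u0 (u0 + T m) t)) = m k' := by
        exact_mod_cast mul_right_cancel₀ Complex.two_pi_I_ne_zero h4
      rw [h5]
      simp only [m, Pi.single_apply, hι.eq_iff]
    · obtain ⟨b, hb⟩ := htriv j hj
      rw [hb _ hc hN, h01, sub_self, if_neg]
      rintro rfl
      exact hj ⟨k, rfl⟩
  · intro A _ c hc
    have hHY : ∀ u ∈ K, H u ∈ Y := fun u hu => (hHN u hu).2
    have tri : ∀ {x y z}, x ∈ K → y ∈ K → z ∈ K → c (seg H x y) + c (seg H y z) = c (seg H x z) :=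
      fun hx hy hz => hc.tri hK hH hHY hx hy hz
    have hsegT : ∀ m x y, seg H (x + T m) (y + T m) = seg H x y := by
      intro m x y
      funext t
      change H _ = H _
      rw [← hHT m (x + (t:ℝ) • (y - x))]
      congr 1
      module
    have hind : ∀ m, ∀ x ∈ K, ∀ y ∈ K, c (seg H x (x + T m)) = c (seg H y (y + T m)) := by
      intro m x hx y hy
      have h1 := tri hx (hTK m x hx) (hTK m y hy)
      have h2 := tri hx hy (hTK m y hy)
      rw [hsegT] at h1
      rw [← h2, add_comm] at h1
      exact add_left_cancel h1
    let Am : (κ → ℤ) →+ A :=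
      { toFun := fun m => c (seg H u0 (u0 + T m))
        map_zero' := by
          have : T 0 = 0 := by ext k <;> simp [T]
          rw [this, add_zero]
          have := tri hu0 hu0 hu0
          simpa using this
        map_add' := fun m m' => by
          have h1 := tri hu0 (hTK m u0 hu0) (hTK m' _ (hTK m u0 hu0))
          rw [hTadd, ← add_assoc, ← h1, hind m' (u0 + T m) (hTK m u0 hu0) u0 hu0] }
    have hAm : ∀ m, Am m = ∑ k, m k • Am (Pi.single k 1) := by
      intro m
      have h := LinearMap.pi_apply_eq_sum_univ Am.toIntLinearMap m
      rw [AddMonoidHom.coe_toIntLinearMap] at h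
      rw [h]
      refine Finset.sum_congr rfl fun k _ => ?_
      congr 2
      ext k'
      simp [Pi.single_apply, eq_comm]
    refine ⟨Function.extend ι (fun k => Am (Pi.single k 1)) 0, fun y => c (seg H u0 (s y)), fun γ hγ hγN => ?_⟩
    have hlog : ∀ k, ∃ l : unitInterval → ℂ, Continuous l ∧ ∀ t, Complex.exp (l t) = f (ι k) (γ t) := fun k =>
      exists_log_path ((hfc k).comp_continuous hγ hγN) fun t => hfY _ _ (hγN t).2
    choose l hlc hl using hlog
    let m : κ → ℤ := fun k => wind (fun t => f (ι k) (γ t))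
    let g : unitInterval → (κ → ℂ) × W := fun t => (fun k => l k t - l k 0 + Complex.log (f (ι k) (γ 0)), ω (γ t))
    have hgc : Continuous g := by
      have h1 := hωc.comp_continuous hγ hγN
      refine Continuous.prodMk (continuous_pi fun k => ?_) h1
      exact ((hlc k).sub continuous_const).add continuous_const
    have hgex : ∀ t k, Complex.exp ((g t).1 k) = f (ι k) (γ t) := by
      intro t k
      change Complex.exp (l k t - l k 0 + Complex.log (f (ι k) (γ 0))) = _
      rw [Complex.exp_add, Complex.exp_sub, hl, hl, Complex.exp_log (hfY _ _ (hγN 0).2)]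
      field_simp [hfY (ι k) _ (hγN 0).2]
    have hgK : ∀ t, g t ∈ K := by
      intro t
      refine ⟨fun k => ?_, hNω _ (hγN t)⟩
      rw [Real.lt_log_iff_exp_lt hδ, ← Complex.norm_exp, hgex]
      exact hNf _ (hγN t) k
    have hHg : ∀ t, H (g t) = γ t := by
      intro t
      have : ex (g t) = (fun k => f (ι k) (γ t), ω (γ t)) := by
        ext k
        · exact hgex t k
        · rfl
      change Φ (ex (g t)) = _
      rw [this, hinv _ (hγN t)]
    have hg0 : g 0 = s (γ 0) := by
      ext k
      · change l k 0 - l k 0 + _ = _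
        rw [sub_self, zero_add]
      · rfl
    have hg1 : g 1 = s (γ 1) + T m := by
      ext k
      · have h := wind_spec (g := fun t => f (ι k) (γ t)) (l := l k) (hlc k) (hl k)
        change l k 1 - l k 0 + Complex.log (f (ι k) (γ 0)) = Complex.log (f (ι k) (γ 1)) + wind (fun t => f (ι k) (γ t)) * (2 * Real.pi * Complex.I)
        rw [h]; ring
      · simp [g, s, T]
    have h1 := hc.straight hK hH hHY hgc hgK
    simp only [hHg] at h1
    have e : (fun t => γ t) = γ := rfl
    rw [e, hg0, hg1] at h1
    have k0 := hsK _ (hγN 0)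
    have k1 := hsK _ (hγN 1)
    have h2 := tri hu0 k0 (hTK m _ k1)
    have h3 := tri hu0 k1 (hTK m _ k1)
    have h4 : c (seg H (s (γ 1)) (s (γ 1) + T m)) = Am m := hind m _ k1 _ hu0
    have h5 : ∑ i, wind (fun t => f i (γ t)) • Function.extend ι (fun k => Am (Pi.single k 1)) 0 i = Am m := by
      rw [hAm]
      symm
      refine Fintype.sum_of_injective ι hι _ _ ?_ ?_
      · intro i hi
        rw [Function.extend_apply' _ _ _ (by simpa using hi)]
        simp
      · intro k
        rw [hι.extend_apply]
    rw [h5, h1, ← h4]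
    have h6 : c (seg H (s (γ 0)) (s (γ 1) + T m)) = c (seg H u0 (s (γ 1))) + c (seg H (s (γ 1)) (s (γ 1) + T m)) - c (seg H u0 (s (γ 0))) := by
      rw [h3, ← h2]; abel
    rw [h6]; abel

end INNC
end

section
namespace INNC
open Topology

theorem surj_of_linInd {V κ : Type} [NormedAddCommGroup V] [NormedSpace ℂ V] [Fintype κ] [DecidableEq κ]
    (l : κ → V →L[ℂ] ℂ) (hl : LinearIndependent ℂ l) (y : κ → ℂ) : ∃ x, ∀ k, l k x = y k := by
  let T : V →ₗ[ℂ] (κ → ℂ) := LinearMap.pi fun k => (l k : V →ₗ[ℂ] ℂ)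
  have hT : LinearMap.range T = ⊤ := by
    by_contra hne
    obtain ⟨φ, hφ0, hφ⟩ := Submodule.exists_le_ker_of_lt_top _ (lt_top_iff_ne_top.2 hne)
    have h1 : ∀ k, φ (Pi.single k 1) = 0 := by
      rw [Fintype.linearIndependent_iff] at hl
      apply hl
      ext x
      have h2 : φ (T x) = 0 := hφ ⟨x, rfl⟩
      rw [LinearMap.pi_apply_eq_sum_univ φ (T x)] at h2
      simp only [sum_apply, smul_apply, zero_apply, smul_eq_mul] at h2 ⊢
      rw [← h2]
      refine Finset.sum_congr rfl fun k _ => ?_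
      rw [mul_comm]
      congr 2
      ext j
      simp [Pi.single_apply, eq_comm]
    apply hφ0
    ext k
    simpa using h1 k
  have : y ∈ LinearMap.range T := hT ▸ Submodule.mem_top
  obtain ⟨x, hx⟩ := this
  exact ⟨x, fun k => congrFun hx k⟩

theorem exists_good {V : Type} [NormedAddCommGroup V] [InnerProductSpace ℂ V] [FiniteDimensional ℂ V] {r : ℕ}
    (f : Fin r → V → ℂ) (p : V) (hf : ∀ i, AnalyticAt ℂ (f i) p)
    (hl : LinearIndependent ℂ (fun i : {i : Fin r // f i p = 0} => fderiv ℂ (f i.1) p))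
    (v : V) (hv : ∀ i, f i p = 0 → fderiv ℂ (f i) p v = 0) (hpv : inner ℂ p v ≠ 0)
    (O : Set V) (hO : O ∈ 𝓝 p) :
    ∃ N, IsOpen N ∧ p ∈ N ∧ N ⊆ O ∧ Good f {x | ‖x‖ = ‖p‖ ∧ ∀ i, f i x ≠ 0} N {i | f i p = 0} := by
  classical
  let _inst : InnerProductSpace ℝ V := InnerProductSpace.complexToReal
  let κ := {i : Fin r // f i p = 0}
  let ι : κ → Fin r := Subtype.val
  have hcV : CompleteSpace V := FiniteDimensional.complete ℂ V
  let Ψ : V → (κ → ℂ) × ℝ := fun x => (fun k => f (ι k) x, ‖x‖ ^ 2)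
  let D1 : V →L[ℝ] (κ → ℂ) := ContinuousLinearMap.pi fun k => (fderiv ℂ (f (ι k)) p).restrictScalars ℝ
  let Ψ' : V →L[ℝ] (κ → ℂ) × ℝ := D1.prod (2 • innerSL ℝ p)
  have hΨ : HasStrictFDerivAt Ψ Ψ' p := by
    refine HasStrictFDerivAt.prodMk ?_ (hasStrictFDerivAt_norm_sq p)
    refine hasStrictFDerivAt_pi.2 fun k => ?_
    exact (hf (ι k)).hasStrictFDerivAt.restrictScalars ℝ
  have hsurj : Ψ'.range = ⊤ := by
    rw [Submodule.eq_top_iff']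
    rintro ⟨y, s⟩
    obtain ⟨x, hx⟩ := surj_of_linInd _ hl y
    let t : ℝ := (s - 2 * inner ℝ p x) / 2
    refine ⟨x + ((t : ℂ) / inner ℂ p v) • v, ?_⟩
    refine Prod.ext ?_ ?_
    · funext k
      change fderiv ℂ (f (ι k)) p (x + ((t : ℂ) / inner ℂ p v) • v) = y k
      rw [map_add, map_smul, hv _ k.2, smul_zero, add_zero]
      exact hx k
    · change (2 : ℕ) • (inner ℝ p (x + ((t : ℂ) / inner ℂ p v) • v)) = s
      have h1 : inner ℝ p (((t : ℂ) / inner ℂ p v) • v) = t := by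
        change (inner ℂ p (((t : ℂ) / inner ℂ p v) • v)).re = t
        rw [inner_smul_right, div_mul_cancel₀ _ hpv, Complex.ofReal_re]
      rw [inner_add_right, h1, nsmul_eq_mul]
      simp only [t]; push_cast; ring
  let θ := hΨ.implicitToOpenPartialHomeomorph Ψ Ψ' hsurj
  have hps : p ∈ θ.source := hΨ.mem_implicitToOpenPartialHomeomorph_source hsurj
  have hθp : θ p = (Ψ p, 0) := hΨ.implicitToOpenPartialHomeomorph_self hsurj
  have hθ1 : ∀ x, (θ x).1 = Ψ x := fun x => hΨ.implicitToOpenPartialHomeomorph_fst hsurj x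
  have hΨp : Ψ p = (0, ‖p‖ ^ 2) := by
    refine Prod.ext ?_ rfl
    funext k
    exact k.2
  have hev : ∀ᶠ x in 𝓝 p, x ∈ θ.source ∧ x ∈ O ∧ (∀ i, AnalyticAt ℂ (f i) x) ∧
      ∀ j, f j p ≠ 0 → ‖f j x / f j p - 1‖ < 1 := by
    refine Filter.Eventually.and (θ.open_source.mem_nhds hps) (Filter.Eventually.and hO ?_)
    refine (Filter.eventually_all.2 fun i => (hf i).eventually_analyticAt).and (Filter.eventually_all.2 fun j => ?_)
    by_cases hj : f j p = 0
    · simp [hj]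
    have : ContinuousAt (fun x => ‖f j x / f j p - 1‖) p := (((hf j).continuousAt.div_const _).sub continuousAt_const).norm
    have h2 := this.eventually_lt (g := fun _ => (1 : ℝ)) continuousAt_const (by simp [hj])
    filter_upwards [h2] with x hx _ using hx
  obtain ⟨O', hO', hO'o, hpO'⟩ := eventually_nhds_iff.1 hev
  have hθpt : θ p ∈ θ.target := θ.map_source hps
  have hnb : θ.target ∩ θ.symm ⁻¹' O' ∈ 𝓝 (θ p) := by
    refine Filter.inter_mem (θ.open_target.mem_nhds hθpt) ?_
    have h := θ.continuousAt_symm hθpt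
    refine h.preimage_mem_nhds ?_
    rw [θ.left_inv hps]
    exact hO'o.mem_nhds hpO'
  obtain ⟨δ, hδ, hball⟩ := Metric.mem_nhds_iff.1 hnb
  let N := θ.source ∩ θ ⁻¹' Metric.ball (θ p) δ
  have hNo : IsOpen N := θ.isOpen_inter_preimage Metric.isOpen_ball
  have hNO : N ⊆ O' := by
    intro x hx
    have := (hball hx.2).2
    rwa [Set.mem_preimage, θ.left_inv hx.1] at this
  have hmem : ∀ (u : κ → ℂ) (w : Ψ'.ker), (((u, ‖p‖^2), w) : ((κ → ℂ) × ℝ) × Ψ'.ker) ∈ Metric.ball (θ p) δ ↔ (∀ k, ‖u k‖ < δ) ∧ ‖w‖ < δ := by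
    intro u w
    rw [Metric.mem_ball, hθp, hΨp, Prod.dist_eq, Prod.dist_eq, max_lt_iff, max_lt_iff, dist_pi_lt_iff hδ]
    simp [hδ]
  refine ⟨N, hNo, ⟨hps, Metric.mem_ball_self hδ⟩, fun x hx => (hO' x (hNO hx)).2.1, ?_⟩
  have hrange : {i | f i p = 0} = Set.range ι := by
    exact Subtype.range_val.symm
  rw [hrange]
  have hxN : ∀ x ∈ N ∩ {x | ‖x‖ = ‖p‖ ∧ ∀ i, f i x ≠ 0}, θ x = ((fun k => f (ι k) x, ‖p‖ ^ 2), (θ x).2) := by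
    intro x hx
    refine Prod.ext ?_ rfl
    rw [hθ1]
    change (_, ‖x‖ ^ 2) = _
    rw [hx.2.1]
  have hxδ : ∀ x ∈ N ∩ {x | ‖x‖ = ‖p‖ ∧ ∀ i, f i x ≠ 0}, (∀ k, ‖f (ι k) x‖ < δ) ∧ ‖(θ x).2‖ < δ := by
    intro x hx
    rw [← hmem, ← hxN x hx]
    exact hx.1.2
  have hnz : ∀ x ∈ O', ∀ j, f j p ≠ 0 → f j x ≠ 0 := by
    intro x hx j hj h0
    have := (hO' x hx).2.2.2 j hj
    simp [h0] at this
  refine good_of_chart f _ N (fun i y hy => hy.2 i) ι Subtype.val_injective δ hδ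
    (fun u => θ.symm ((u.1, ‖p‖ ^ 2), u.2)) (fun x => (θ x).2) ?_ ?_ ?_ (fun x hx => (hxδ x hx).1) (fun x hx => (hxδ x hx).2)
    ?_ ?_ ?_ ?_
  · refine θ.continuousOn_symm.comp (by fun_prop) ?_
    intro u hu
    exact (hball ((hmem _ _).2 hu)).1
  · intro u h1 h2 k
    have h3 := (hball ((hmem _ _).2 ⟨h1, h2⟩)).1
    have h4 := hθ1 (θ.symm ((u.1, ‖p‖ ^ 2), u.2))
    rw [θ.right_inv h3] at h4
    exact (congrFun (congrArg Prod.fst h4) k).symm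
  · intro u h1 h2 h5
    have hb := (hmem _ _).2 ⟨h1, h2⟩
    have h3 := (hball hb).1
    have h4 := hθ1 (θ.symm ((u.1, ‖p‖ ^ 2), u.2))
    rw [θ.right_inv h3] at h4
    refine ⟨⟨θ.map_target h3, ?_⟩, ?_, ?_⟩
    · rw [Set.mem_preimage, θ.right_inv h3]; exact hb
    · have h6 : ‖p‖ ^ 2 = ‖θ.symm ((u.1, ‖p‖ ^ 2), u.2)‖ ^ 2 := congrArg Prod.snd h4
      exact ((sq_eq_sq₀ (norm_nonneg _) (norm_nonneg _)).1 h6).symm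
    · intro i
      by_cases hi : f i p = 0
      · have h6 := (congrFun (congrArg Prod.fst h4) ⟨i, hi⟩).symm
        change f i _ = u.1 ⟨i, hi⟩ at h6
        rw [h6]; exact h5 _
      · exact hnz _ (hball hb).2 i hi
  · intro k x hx
    exact ((hO' x (hNO hx.1)).2.2.1 (ι k)).continuousAt.continuousWithinAt
  · intro x hx
    exact (continuous_snd.continuousAt.comp (θ.continuousAt hx.1.1)).continuousWithinAt
  · intro x hx
    change θ.symm ((fun k => f (ι k) x, ‖p‖ ^ 2), (θ x).2) = x
    rw [← hxN x hx, θ.left_inv hx.1.1]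
  · intro j hj
    rw [← hrange] at hj
    have hj : f j p ≠ 0 := hj
    refine ⟨fun x => Complex.log (f j x / f j p) + Complex.log (f j p), ?_, ?_⟩
    · intro x hx
      have hx' := hO' x (hNO hx.1)
      have hsl : f j x / f j p ∈ Complex.slitPlane := by
        have := Complex.mem_slitPlane_of_norm_lt_one (hx'.2.2.2 j hj)
        simpa using this
      exact ((((hx'.2.2.1 j).continuousAt.div_const _).clog hsl).add continuousAt_const).continuousWithinAt
    · intro x hx
      have hx' := hNO hx.1
      rw [Complex.exp_add, Complex.exp_log (div_ne_zero (hnz _ hx' j hj) hj), Complex.exp_log hj, div_mul_cancel₀ _ hj]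

end INNC
end

section
namespace INNC
open Topology

theorem coc_trivial {W ι A : Type} [NormedAddCommGroup W] [NormedSpace ℝ W] [AddCommGroup A]
    (U : ι → Set W) (hU : ∀ i, IsOpen (U i)) (idx : W → ι) (hidx : ∀ x, x ∈ U (idx x))
    (g : ι → ι → W → A)
    (hg : ∀ i j, ∀ x ∈ U i ∩ U j, ∀ᶠ y in 𝓝 x, g i j y = g i j x)
    (hgc : ∀ i j k, ∀ x ∈ U i ∩ U j ∩ U k, g i j x + g j k x = g i k x) :
    ∃ s : ι → W → A, (∀ i, ∀ x ∈ U i, ∀ᶠ y in 𝓝 x, s i y = s i x) ∧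
      ∀ i j, ∀ x ∈ U i ∩ U j, s i x - s j x = g i j x := by
  let _t : TopologicalSpace A := ⊥
  have _hd : DiscreteTopology A := ⟨rfl⟩
  let Z : FiberBundleCore ι W A :=
    { baseSet := U
      isOpen_baseSet := hU
      indexAt := idx
      mem_baseSet_at := hidx
      coordChange := fun i j x a => a - g i j x
      coordChange_self := by
        intro i x hx v
        have := hgc i i i x ⟨⟨hx, hx⟩, hx⟩
        have h0 : g i i x = 0 := by simpa using this
        rw [h0, sub_zero]
      continuousOn_coordChange := by
        rintro i j ⟨x, a⟩ ⟨hx, -⟩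
        refine ContinuousAt.continuousWithinAt ?_
        have h1 : ContinuousAt (fun p : W × A => p.2 - g i j x) (x, a) :=
          ((continuous_of_discreteTopology (f := fun a : A => a - g i j x)).comp continuous_snd).continuousAt
        refine h1.congr ?_
        have h2 : ∀ᶠ p : W × A in 𝓝 (x, a), g i j p.1 = g i j x :=
          (continuous_fst.continuousAt (x := (x, a))).eventually (hg i j x hx)
        filter_upwards [h2] with p hp
        rw [hp]
      coordChange_comp := by
        intro i j k x hx v
        rw [← hgc i j k x hx, sub_sub] }
  have _hdf : ∀ x, DiscreteTopology (Z.Fiber x) := fun x => _hd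
  have hcov : IsCoveringMap (Bundle.TotalSpace.proj : Bundle.TotalSpace A Z.Fiber → W) := FiberBundle.isCoveringMap
  obtain ⟨F, ⟨-, hF⟩, -⟩ := hcov.existsUnique_continuousMap_lifts (ContinuousMap.id W) 0 ⟨0, (0 : A)⟩ rfl
  have hF1 : ∀ x, (F x).1 = x := fun x => congrFun hF x
  refine ⟨fun i x => (Z.localTriv i (F x)).2, ?_, ?_⟩
  · intro i x hx
    have hs : F x ∈ (Z.localTriv i).source := by
      rw [Z.mem_localTriv_source, hF1, ← Z.baseSet_at]; exact hx
    have hc : ContinuousAt (fun y => (Z.localTriv i (F y)).2) x :=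
      continuous_snd.continuousAt.comp (((Z.localTriv i).toOpenPartialHomeomorph.continuousAt hs).comp F.continuous.continuousAt)
    exact hc.eventually (IsOpen.mem_nhds (isOpen_discrete {(Z.localTriv i (F x)).2}) rfl)
  · intro i j x hx
    simp only [Z.localTriv_apply]
    rw [hF1]
    have h3 : ∀ a : A, a - g (idx x) i x - (a - g (idx x) j x) = g i j x := fun a => by
      rw [← hgc (idx x) i j x ⟨⟨hidx x, hx.1⟩, hx.2⟩]; abel
    exact h3 (F x).2

theorem coc_trivial_chart {V ι A : Type} [NormedAddCommGroup V] [InnerProductSpace ℝ V] [AddCommGroup A]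
    (U : ι → Set (Metric.sphere (0 : V) 1)) (hU : ∀ i, IsOpen (U i)) (idx : Metric.sphere (0 : V) 1 → ι)
    (hidx : ∀ x, x ∈ U (idx x))
    (g : ι → ι → Metric.sphere (0 : V) 1 → A)
    (hg : ∀ i j, ∀ x ∈ U i ∩ U j, ∀ᶠ y in 𝓝 x, g i j y = g i j x)
    (hgc : ∀ i j k, ∀ x ∈ U i ∩ U j ∩ U k, g i j x + g j k x = g i k x) (v : Metric.sphere (0 : V) 1) :
    ∃ s : ι → Metric.sphere (0 : V) 1 → A, (∀ i, ∀ x ∈ U i, x ≠ v → ∀ᶠ y in 𝓝 x, s i y = s i x) ∧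
      ∀ i j, ∀ x ∈ U i ∩ U j, x ≠ v → s i x - s j x = g i j x := by
  have hv : ‖(v : V)‖ = 1 := norm_eq_of_mem_sphere v
  let θ := stereographic hv
  have hc : Continuous θ.symm := (isOpenEmbedding_stereographic_symm hv).continuous
  obtain ⟨s, hs1, hs2⟩ := coc_trivial (fun i => θ.symm ⁻¹' U i) (fun i => (hU i).preimage hc) (fun w => idx (θ.symm w))
    (fun w => hidx _) (fun i j w => g i j (θ.symm w)) (fun i j w hw => hc.continuousAt.eventually (hg i j _ hw))
    (fun i j k w hw => hgc i j k _ hw)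
  have hsrc : ∀ x, x ≠ v → x ∈ θ.source := fun x hx => hx
  refine ⟨fun i x => s i (θ x), ?_, ?_⟩
  · intro i x hx hxv
    refine (θ.continuousAt (hsrc x hxv)).eventually (hs1 i (θ x) ?_)
    rw [Set.mem_preimage, θ.left_inv (hsrc x hxv)]; exact hx
  · intro i j x hx hxv
    have := hs2 i j (θ x) (by
      constructor
      · rw [Set.mem_preimage, θ.left_inv (hsrc x hxv)]; exact hx.1
      · rw [Set.mem_preimage, θ.left_inv (hsrc x hxv)]; exact hx.2)
    rwa [θ.left_inv (hsrc x hxv)] at this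

theorem coc_trivial_sphere {V ι A : Type} [NormedAddCommGroup V] [InnerProductSpace ℝ V] [AddCommGroup A]
    (m : ℕ) (hm : 2 ≤ m) (hV : Module.finrank ℝ V = m + 1)
    (U : ι → Set (Metric.sphere (0 : V) 1)) (hU : ∀ i, IsOpen (U i)) (idx : Metric.sphere (0 : V) 1 → ι)
    (hidx : ∀ x, x ∈ U (idx x))
    (g : ι → ι → Metric.sphere (0 : V) 1 → A)
    (hg : ∀ i j, ∀ x ∈ U i ∩ U j, ∀ᶠ y in 𝓝 x, g i j y = g i j x)
    (hgc : ∀ i j k, ∀ x ∈ U i ∩ U j ∩ U k, g i j x + g j k x = g i k x) :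
    ∃ s : ι → Metric.sphere (0 : V) 1 → A, (∀ i, ∀ x ∈ U i, ∀ᶠ y in 𝓝 x, s i y = s i x) ∧
      ∀ i j, ∀ x ∈ U i ∩ U j, s i x - s j x = g i j x := by
  classical
  have hfact : Fact (Module.finrank ℝ V = m + 1) := ⟨hV⟩
  have hnt : Nontrivial V := Module.nontrivial_of_finrank_pos (R := ℝ) (by omega)
  obtain ⟨v0, hv0⟩ := exists_norm_eq V (c := 1) zero_le_one
  let v : Metric.sphere (0 : V) 1 := ⟨v0, by simp [hv0]⟩
  have hv : ‖(v : V)‖ = 1 := hv0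
  have hvne : v ≠ -v := by
    intro h
    have h1 : v0 = -v0 := congrArg Subtype.val h
    have h2 : (2 : ℝ) • v0 = 0 := by
      rw [two_smul]; nth_rewrite 1 [h1]; simp
    rcases smul_eq_zero.1 h2 with h3 | h3
    · norm_num at h3
    · simp [h3] at hv0
  obtain ⟨s, hs1, hs2⟩ := coc_trivial_chart U hU idx hidx g hg hgc v
  obtain ⟨t, ht1, ht2⟩ := coc_trivial_chart U hU idx hidx g hg hgc (-v)
  -- the overlap is preconnected
  let S' : Set (Metric.sphere (0 : V) 1) := {x | x ≠ v ∧ x ≠ -v}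
  have hS' : IsPreconnected S' := by
    let θ := stereographic hv
    have hc : Continuous θ.symm := (isOpenEmbedding_stereographic_symm hv).continuous
    have hr : 1 < Module.rank ℝ (ℝ ∙ (v : V))ᗮ := by
      have h1 : Module.finrank ℝ (ℝ ∙ (v : V))ᗮ = m := Submodule.finrank_orthogonal_span_singleton (by
        intro h; rw [h] at hv; simp at hv)
      by_contra hcon
      have hle : Module.rank ℝ (ℝ ∙ (v : V))ᗮ ≤ 1 := not_lt.1 hcon
      have h2 := Cardinal.toNat_le_toNat hle Cardinal.one_lt_aleph0
      rw [map_one] at h2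
      change Module.finrank ℝ (ℝ ∙ (v : V))ᗮ ≤ 1 at h2
      omega
    have h1 := (isConnected_compl_singleton_of_one_lt_rank hr 0).isPreconnected.image θ.symm hc.continuousOn
    convert h1 using 1
    ext x
    constructor
    · rintro ⟨hx1, hx2⟩
      refine ⟨θ x, ?_, θ.left_inv hx1⟩
      intro h
      apply hx2
      have h3 : θ x = θ (-v) := by rw [h]; exact (stereographic_apply_neg v).symm
      exact θ.injOn hx1 (show -v ∈ θ.source from hvne.symm) h3
    · rintro ⟨w, hw, rfl⟩
      refine ⟨θ.map_target (by trivial), ?_⟩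
      intro h
      apply hw
      have h3 := congrArg θ h
      rw [θ.right_inv (by trivial)] at h3
      rw [Set.mem_singleton_iff, h3]
      exact stereographic_apply_neg v
  let _t : TopologicalSpace A := ⊥
  have _hd : DiscreteTopology A := ⟨rfl⟩
  let d : Metric.sphere (0 : V) 1 → A := fun x => s (idx x) x - t (idx x) x
  have hd : ∀ x ∈ S', ∀ i, x ∈ U i → s i x - t i x = d x := by
    intro x hx i hi
    have h1 := hs2 i (idx x) x ⟨hi, hidx x⟩ hx.1
    have h2 := ht2 i (idx x) x ⟨hi, hidx x⟩ hx.2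
    have h3 : s i x - t i x = (s i x - s (idx x) x) - (t i x - t (idx x) x) + d x := by simp only [d]; abel
    rw [h3, h1, h2]; abel
  have hS'o : IsOpen S' := isOpen_compl_singleton.inter isOpen_compl_singleton
  have hdc : ContinuousOn d S' := by
    intro x hx
    refine ContinuousAt.continuousWithinAt ?_
    refine (continuousAt_const (y := d x)).congr ?_
    filter_upwards [hs1 _ x (hidx x) hx.1, ht1 _ x (hidx x) hx.2, (hU (idx x)).mem_nhds (hidx x), hS'o.mem_nhds hx] with y h1 h2 h3 h4
    rw [← hd y h4 _ h3, h1, h2]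
  obtain ⟨d0, hd0⟩ : ∃ d0, ∀ x ∈ S', d x = d0 := by
    by_cases hne : S'.Nonempty
    · obtain ⟨x0, hx0⟩ := hne
      exact ⟨d x0, fun x hx => hS'.constant hdc hx hx0⟩
    · exact ⟨0, fun x hx => (hne ⟨x, hx⟩).elim⟩
  let w : ι → Metric.sphere (0 : V) 1 → A := fun i x => if x = v then t i x + d0 else s i x
  have hwt : ∀ i x, x ∈ U i → x ≠ -v → w i x = t i x + d0 := by
    intro i x hx hx2
    by_cases hxv : x = v
    · simp [w, hxv]
    · have := hd x ⟨hxv, hx2⟩ i hx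
      rw [hd0 x ⟨hxv, hx2⟩] at this
      simp [w, hxv, ← this]
  have hws : ∀ i x, x ≠ v → w i x = s i x := fun i x hx => by simp [w, hx]
  refine ⟨w, ?_, ?_⟩
  · intro i x hx
    by_cases hxv : x = v
    · have hx2 : x ≠ -v := hxv ▸ hvne
      filter_upwards [ht1 i x hx hx2, (hU i).mem_nhds hx, isOpen_ne.mem_nhds hx2] with y h1 h2 h3
      rw [hwt i y h2 h3, hwt i x hx hx2, h1]
    · filter_upwards [hs1 i x hx hxv, isOpen_ne.mem_nhds hxv] with y h1 h2
      rw [hws i y h2, hws i x hxv, h1]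
  · intro i j x hx
    by_cases hxv : x = v
    · have hx2 : x ≠ -v := hxv ▸ hvne
      rw [hwt i x hx.1 hx2, hwt j x hx.2 hx2, ← ht2 i j x hx hx2]; abel
    · rw [hws i x hxv, hws j x hxv, hs2 i j x hx hxv]

end INNC
end

section
namespace INNC
open Topology

theorem glue {V A : Type} [NormedAddCommGroup V] [InnerProductSpace ℝ V] [AddCommGroup A]
    (m : ℕ) (hm : 2 ≤ m) (hV : Module.finrank ℝ V = m + 1) (ε : ℝ) (hε : 0 < ε) (Y : Set V)
    (hY : ∀ y ∈ Y, ‖y‖ = ε) (c : (unitInterval → V) → A) (hc : IsCoc Y c)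
    (hprim : ∀ p, ‖p‖ = ε → ∃ N, IsOpen N ∧ p ∈ N ∧ ∃ b : V → A, ∀ γ : unitInterval → V, Continuous γ →
      (∀ t, γ t ∈ N ∩ Y) → c γ = b (γ 1) - b (γ 0))
    (hconn : ∀ p, ‖p‖ = ε → ∀ O ∈ 𝓝 p, ∃ N, IsOpen N ∧ p ∈ N ∧ N ⊆ O ∧ (N ∩ Y).Nonempty ∧
      ∀ x ∈ N ∩ Y, ∀ y ∈ N ∩ Y, ∃ γ : unitInterval → V, Continuous γ ∧ (∀ t, γ t ∈ N ∩ Y) ∧ γ 0 = x ∧ γ 1 = y) :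
    ∃ b : V → A, ∀ γ : unitInterval → V, Continuous γ → (∀ t, γ t ∈ Y) → c γ = b (γ 1) - b (γ 0) := by
  classical
  let B := Metric.sphere (0 : V) 1
  let σ : B → V := fun x => ε • (x : V)
  have hσc : Continuous σ := by fun_prop
  have hσ : ∀ x, ‖σ x‖ = ε := by
    intro x
    have : ‖(x : V)‖ = 1 := norm_eq_of_mem_sphere x
    simp only [σ]
    rw [norm_smul, this, mul_one, Real.norm_of_nonneg hε.le]
  choose N hNo hN b hb using fun x : B => hprim (σ x) (hσ x)
  let P : B → B → B → A → Prop := fun i j x a => ∃ M, IsOpen M ∧ σ x ∈ M ∧ ∀ y ∈ M ∩ Y, b i y - b j y = a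
  have hPex : ∀ i j x, σ x ∈ N i → σ x ∈ N j → ∃ a, P i j x a := by
    intro i j x hi hj
    obtain ⟨M, hMo, hxM, hMO, ⟨y0, hy0⟩, hMp⟩ := hconn (σ x) (hσ x) (N i ∩ N j)
      (((hNo i).inter (hNo j)).mem_nhds ⟨hi, hj⟩)
    refine ⟨b i y0 - b j y0, M, hMo, hxM, ?_⟩
    intro y hy
    obtain ⟨γ, hγ, hγM, h0, h1⟩ := hMp y0 hy0 y hy
    have e1 := hb i γ hγ fun t => ⟨(hMO (hγM t).1).1, (hγM t).2⟩
    have e2 := hb j γ hγ fun t => ⟨(hMO (hγM t).1).2, (hγM t).2⟩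
    rw [h0, h1] at e1 e2
    have e3 := e1.symm.trans e2
    rw [sub_eq_sub_iff_add_eq_add] at e3 ⊢
    rw [add_comm (b i y0)]
    rw [e3]
  have hPun : ∀ i j x a a', P i j x a → P i j x a' → a = a' := by
    rintro i j x a a' ⟨M, hMo, hM, h⟩ ⟨M', hMo', hM', h'⟩
    obtain ⟨K, -, -, hKO, ⟨y0, hy0⟩, -⟩ := hconn (σ x) (hσ x) (M ∩ M') ((hMo.inter hMo').mem_nhds ⟨hM, hM'⟩)
    rw [← h y0 ⟨(hKO hy0.1).1, hy0.2⟩, ← h' y0 ⟨(hKO hy0.1).2, hy0.2⟩]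
  let g : B → B → B → A := fun i j x => if h : ∃ a, P i j x a then h.choose else 0
  have hg : ∀ i j x, σ x ∈ N i → σ x ∈ N j → P i j x (g i j x) := by
    intro i j x hi hj
    have h := hPex i j x hi hj
    simp only [g, dif_pos h]
    exact h.choose_spec
  have hgeq : ∀ i j x a, σ x ∈ N i → σ x ∈ N j → P i j x a → g i j x = a := fun i j x a hi hj h =>
    hPun i j x _ _ (hg i j x hi hj) h
  obtain ⟨s, hs1, hs2⟩ := coc_trivial_sphere m hm hV (fun i => σ ⁻¹' N i) (fun i => (hNo i).preimage hσc) id hN g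
    (by
      rintro i j x ⟨hi, hj⟩
      obtain ⟨M, hMo, hM, h⟩ := hg i j x hi hj
      filter_upwards [(hMo.preimage hσc).mem_nhds hM, ((hNo i).preimage hσc).mem_nhds hi,
        ((hNo j).preimage hσc).mem_nhds hj] with y hy h1 h2
      exact hgeq i j y _ h1 h2 ⟨M, hMo, hy, h⟩)
    (by
      rintro i j k x ⟨⟨hi, hj⟩, hk⟩
      obtain ⟨M, hMo, hM, h⟩ := hg i j x hi hj
      obtain ⟨M', hMo', hM', h'⟩ := hg j k x hj hk
      refine (hgeq i k x _ hi hk ⟨M ∩ M', hMo.inter hMo', ⟨hM, hM'⟩, ?_⟩).symm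
      intro y hy
      rw [← h y ⟨hy.1.1, hy.2⟩, ← h' y ⟨hy.1.2, hy.2⟩]; abel)
  have hρ : ∀ y ∈ Y, ∃ x : B, σ x = y := by
    intro y hy
    refine ⟨⟨ε⁻¹ • y, ?_⟩, ?_⟩
    · rw [mem_sphere_zero_iff_norm, norm_smul, hY y hy, Real.norm_of_nonneg (inv_nonneg.2 hε.le), inv_mul_cancel₀ hε.ne']
    · simp only [σ]
      rw [smul_inv_smul₀ hε.ne']
  have hσi : Function.Injective σ := by
    intro x y h
    exact Subtype.ext (smul_right_injective V hε.ne' h)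
  have hσe : IsInducing σ := by
    have h1 : IsInducing (fun v : V => ε • v) := (Homeomorph.smulOfNeZero ε hε.ne').isInducing
    exact h1.comp IsInducing.subtypeVal
  let β : V → A := fun y => if h : ∃ x, σ x = y then b h.choose y - s h.choose h.choose else 0
  have hβ : ∀ x i, σ x ∈ Y → σ x ∈ N i → β (σ x) = b i (σ x) - s i x := by
    intro x i hxY hi
    have hex : ∃ x', σ x' = σ x := ⟨x, rfl⟩
    have e : hex.choose = x := hσi hex.choose_spec
    have : β (σ x) = b x (σ x) - s x x := by
      simp only [β]; rw [dif_pos hex, e]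
    rw [this]
    have h2 := hs2 x i x ⟨hN x, hi⟩
    obtain ⟨M, hMo, hM, h⟩ := hg x i x (hN x) hi
    rw [← h (σ x) ⟨hM, hxY⟩] at h2
    rw [sub_eq_sub_iff_add_eq_add] at h2 ⊢
    rw [← h2, add_comm]
  refine ⟨β, fun γ hγ hγY => hc.of_local β ?_ γ hγ hγY⟩
  intro p hp
  obtain ⟨x, rfl⟩ := hρ p hp
  obtain ⟨M, hM, hMs⟩ := (hσe.nhds_eq_comap x ▸ hs1 x x (hN x) : ∀ᶠ y in (𝓝 (σ x)).comap σ, s x y = s x x)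
  obtain ⟨M', hM'M, hM'o, hxM'⟩ := mem_nhds_iff.1 hM
  refine ⟨M' ∩ N x, hM'o.inter (hNo x), ⟨hxM', hN x⟩, ?_⟩
  intro γ hγ hγM
  have hval : ∀ t, β (γ t) = b x (γ t) - s x x := by
    intro t
    obtain ⟨y, hy⟩ := hρ (γ t) (hγM t).2
    have h3 := hγM t
    rw [← hy] at h3 ⊢
    rw [hβ y x h3.2 h3.1.2]
    have : s x y = s x x := hMs (show y ∈ σ ⁻¹' M from hM'M h3.1.1)
    rw [this]
  rw [hb x γ hγ fun t => ⟨(hγM t).1.2, (hγM t).2⟩, hval, hval]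
  abel

theorem globalize {V A : Type} [NormedAddCommGroup V] [InnerProductSpace ℝ V] [AddCommGroup A]
    (m : ℕ) (hm : 2 ≤ m) (hV : Module.finrank ℝ V = m + 1) (ε : ℝ) (hε : 0 < ε) {r : ℕ} (f : Fin r → V → ℂ)
    (Y : Set V) (hY : Y = {x | ‖x‖ = ε ∧ ∀ i, f i x ≠ 0})
    (hfc : ∀ i, ContinuousOn (f i) Y)
    (hgood : ∀ p, ‖p‖ = ε → ∀ O ∈ 𝓝 p, ∃ N, IsOpen N ∧ p ∈ N ∧ N ⊆ O ∧ Good f Y N {i | f i p = 0})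
    (hirr : ∀ i, IsPreconnected {x | ‖x‖ = ε ∧ f i x = 0})
    (c : (unitInterval → V) → A) (hc : IsCoc Y c) :
    ∃ (a : Fin r → A) (b : V → A), ∀ γ : unitInterval → V, Continuous γ → (∀ t, γ t ∈ Y) →
      c γ = b (γ 1) - b (γ 0) + ∑ i, wind (fun t => f i (γ t)) • a i := by
  classical
  have hloc : ∀ p, ∃ (N : Set V) (a : Fin r → A) (b : V → A), ‖p‖ = ε → IsOpen N ∧ p ∈ N ∧ Good f Y N {i | f i p = 0} ∧
      ∀ γ : unitInterval → V, Continuous γ → (∀ t, γ t ∈ N ∩ Y) →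
      c γ = b (γ 1) - b (γ 0) + ∑ i, wind (fun t => f i (γ t)) • a i := by
    intro p
    by_cases hp : ‖p‖ = ε
    · obtain ⟨N, hNo, hpN, -, hN⟩ := hgood p hp Set.univ Filter.univ_mem
      obtain ⟨a, b, hab⟩ := hN.coc A c hc
      exact ⟨N, a, b, fun _ => ⟨hNo, hpN, hN, hab⟩⟩
    · exact ⟨∅, 0, 0, fun h => (hp h).elim⟩
  choose N a b hN using hloc
  have hlc : ∀ i p q, ‖p‖ = ε → ‖q‖ = ε → f i q = 0 → q ∈ N p → a q i = a p i := by
    intro i p q hp hq hfq hqN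
    obtain ⟨hNo, hpN, -, hab⟩ := hN p hp
    obtain ⟨hNo', hqN', -, hab'⟩ := hN q hq
    obtain ⟨M, hMo, hqM, hMO, hM⟩ := hgood q hq (N p ∩ N q) ((hNo.inter hNo').mem_nhds ⟨hqN, hqN'⟩)
    obtain ⟨γ, hγ, hγM, h01, hw⟩ := hM.merid i hfq
    have e1 := hab γ hγ fun t => ⟨(hMO (hγM t).1).1, (hγM t).2⟩
    have e2 := hab' γ hγ fun t => ⟨(hMO (hγM t).1).2, (hγM t).2⟩
    simp only [hw, h01, sub_self, zero_add, ite_smul, one_smul, zero_smul, Finset.sum_ite_eq', Finset.mem_univ, if_true] at e1 e2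
    rw [← e1, ← e2]
  have hglob : ∀ i, ∃ a0 : A, ∀ p, ‖p‖ = ε → f i p = 0 → a p i = a0 := by
    intro i
    let _t : TopologicalSpace A := ⊥
    have _hd : DiscreteTopology A := ⟨rfl⟩
    have hcont : ContinuousOn (fun p => a p i) {x | ‖x‖ = ε ∧ f i x = 0} := by
      intro p hp
      refine (continuousWithinAt_const (b := a p i)).congr_of_eventuallyEq ?_ rfl
      obtain ⟨hNo, hpN, -, -⟩ := hN p hp.1
      filter_upwards [self_mem_nhdsWithin, mem_nhdsWithin_of_mem_nhds (hNo.mem_nhds hpN)] with q hq hqN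
      exact hlc i p q hp.1 hq.1 hq.2 hqN
    by_cases hne : ∃ p, ‖p‖ = ε ∧ f i p = 0
    · obtain ⟨p0, hp0⟩ := hne
      exact ⟨a p0 i, fun p hp hfp => (hirr i).constant hcont ⟨hp, hfp⟩ hp0⟩
    · exact ⟨0, fun p hp hfp => (hne ⟨p, hp, hfp⟩).elim⟩
  choose a0 ha0 using hglob
  have hfY : ∀ i, ∀ y ∈ Y, f i y ≠ 0 := fun i y hy => by rw [hY] at hy; exact hy.2 i
  let c' : (unitInterval → V) → A := fun γ => c γ - ∑ i, wind (fun t => f i (γ t)) • a0 i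
  have hc' : IsCoc Y c' := hc.sub (IsCoc.sum _ fun i => IsCoc.smul _ (wind_isCoc (hfc i) (hfY i)) (a0 i))
  obtain ⟨β, hβ⟩ := glue m hm hV ε hε Y (fun y hy => by rw [hY] at hy; exact hy.1) c' hc' (by
    intro p hp
    obtain ⟨hNo, hpN, hG, hab⟩ := hN p hp
    refine ⟨N p, hNo, hpN, ?_⟩
    have htr : ∀ i, ∃ bi : V → ℤ, f i p ≠ 0 → ∀ γ : unitInterval → V, Continuous γ → (∀ t, γ t ∈ N p ∩ Y) →
        wind (fun t => f i (γ t)) = bi (γ 1) - bi (γ 0) := by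
      intro i
      by_cases hi : f i p = 0
      · exact ⟨0, fun h => (h hi).elim⟩
      · obtain ⟨bi, hbi⟩ := hG.triv i hi
        exact ⟨bi, fun _ => hbi⟩
    choose bi hbi using htr
    refine ⟨fun y => b p y + ∑ i, bi i y • (a p i - a0 i), ?_⟩
    intro γ hγ hγN
    have h1 : ∀ i, wind (fun t => f i (γ t)) • (a p i - a0 i) = bi i (γ 1) • (a p i - a0 i) - bi i (γ 0) • (a p i - a0 i) := by
      intro i
      by_cases hi : f i p = 0
      · rw [ha0 i p hp hi]; simp
      · rw [hbi i hi γ hγ hγN, sub_smul]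
    have h2 : ∑ i, wind (fun t => f i (γ t)) • a p i = ∑ i, wind (fun t => f i (γ t)) • a0 i +
        (∑ i, bi i (γ 1) • (a p i - a0 i) - ∑ i, bi i (γ 0) • (a p i - a0 i)) := by
      rw [← Finset.sum_sub_distrib, ← Finset.sum_congr rfl fun i _ => h1 i, ← Finset.sum_add_distrib]
      refine Finset.sum_congr rfl fun i _ => ?_
      rw [smul_sub]; abel
    simp only [c']
    rw [hab γ hγ hγN, h2]
    abel) (by
    intro p hp O hO
    obtain ⟨M, hMo, hpM, hMO, hM⟩ := hgood p hp O hO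
    exact ⟨M, hMo, hpM, hMO, hM.nonempty, hM.conn⟩)
  refine ⟨a0, β, fun γ hγ hγY => ?_⟩
  rw [← hβ γ hγ hγY]
  simp [c']

end INNC
end

section
namespace INNC
open Topology

theorem homology_equiv (C : ChainComplex (ModuleCat.{0} ℤ) ℕ) {r : ℕ} (w : C.X 1 ⟶ ModuleCat.of ℤ (Fin r → ℤ))
    (hw : C.d 2 1 ≫ w = 0)
    (hsurj : ∀ i : Fin r, ∃ z : C.X 1, C.d 1 0 z = 0 ∧ w z = Pi.single i (1 : ℤ))
    (hinj : ∀ c : C.X 1 →+ AddCircle (1 : ℚ), (∀ t : C.X 2, c (C.d 2 1 t) = 0) →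
      ∀ z : C.X 1, C.d 1 0 z = 0 → w z = 0 → c z = 0) :
    Nonempty ((C.homology 1 : ModuleCat ℤ) ≃ₗ[ℤ] (Fin r → ℤ)) := by
  let W : C.homology 1 ⟶ ModuleCat.of ℤ (Fin r → ℤ) := C.homologyι 1 ≫ C.descOpcycles w 2 (by simp) hw
  have hWπ : C.homologyπ 1 ≫ W = C.iCycles 1 ≫ w := by
    simp only [W]
    rw [← Category.assoc, C.homology_π_ι, Category.assoc, C.p_descOpcycles]
  have hcyc : ∀ z : C.X 1, C.d 1 0 z = 0 → ∃ y : C.cycles 1, C.iCycles 1 y = z := by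
    intro z hz
    let k : ModuleCat.of ℤ ℤ ⟶ C.X 1 := ModuleCat.ofHom (LinearMap.toSpanSingleton ℤ _ z)
    have hk : k ≫ C.d 1 0 = 0 := by
      ext
      simp [k, hz]
    refine ⟨C.liftCycles k 0 (by simp) hk (1 : ℤ), ?_⟩
    have h := C.liftCycles_i k 0 (by simp) hk
    have h2 := congrArg (fun φ => φ.hom (1 : ℤ)) h
    have h3 : k.hom (1 : ℤ) = z := by
      simp only [k, ModuleCat.hom_ofHom]
      exact LinearMap.toSpanSingleton_apply_one ℤ _ z
    exact h2.trans h3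
  have hid : ∀ y : C.cycles 1, C.d 1 0 (C.iCycles 1 y) = 0 := by
    intro y
    have h := C.iCycles_d 1 0
    exact congrArg (fun φ => φ.hom y) h
  have hWπ' : ∀ y : C.cycles 1, W (C.homologyπ 1 y) = w (C.iCycles 1 y) := fun y =>
    congrArg (fun φ => φ.hom y) hWπ
  have hπs : Function.Surjective (C.homologyπ 1) := (ModuleCat.epi_iff_surjective _).1 inferInstance
  have hιi : Function.Injective (C.homologyι 1) := (ModuleCat.mono_iff_injective _).1 inferInstance
  refine ⟨LinearEquiv.ofBijective W.hom ⟨?_, ?_⟩⟩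
  · rw [← LinearMap.ker_eq_bot, LinearMap.ker_eq_bot']
    intro h hh
    by_contra hne
    obtain ⟨y, rfl⟩ := hπs h
    let o : C.opcycles 1 := C.homologyι 1 (C.homologyπ 1 y)
    have ho : o ≠ 0 := by
      intro h0
      exact hne (hιi (h0.trans (map_zero _).symm))
    obtain ⟨χ, hχ⟩ := CharacterModule.exists_character_apply_ne_zero_of_ne_zero ho
    have ho2 : o = C.pOpcycles 1 (C.iCycles 1 y) := congrArg (fun φ => φ.hom y) (C.homology_π_ι 1)
    let c : C.X 1 →+ AddCircle (1 : ℚ) := AddMonoidHom.comp (χ : C.opcycles 1 →+ AddCircle (1 : ℚ)) (C.pOpcycles 1).hom.toAddMonoidHom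
    have hc0 := hinj c (by
      intro t
      have h1 : C.pOpcycles 1 (C.d 2 1 t) = 0 := congrArg (fun φ => φ.hom t) (C.d_pOpcycles 2 1)
      change χ (C.pOpcycles 1 (C.d 2 1 t)) = 0
      rw [h1, map_zero]) (C.iCycles 1 y) (hid y) (by rw [← hWπ']; exact hh)
    apply hχ
    rw [ho2]; exact hc0
  · rw [← LinearMap.range_eq_top, eq_top_iff, ← (Pi.basisFun ℤ (Fin r)).span_eq, Submodule.span_le]
    rintro _ ⟨i, rfl⟩
    obtain ⟨z, hz, hwz⟩ := hsurj i
    obtain ⟨y, rfl⟩ := hcyc z hz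
    refine ⟨C.homologyπ 1 y, ?_⟩
    rw [Pi.basisFun_apply]
    exact (hWπ' y).trans hwz

end INNC
end

section
namespace INNC
open Topology

/-- singular simplices -/
abbrev Sx (X : TopCat.{0}) (n : ℕ) : Type := (TopCat.toSSet.obj X).obj (Opposite.op (SimplexCategory.mk n))

/-- evaluation -/
noncomputable abbrev ev (X : TopCat.{0}) (n : ℕ) : Sx X n ≃ C(stdSimplex ℝ (Fin (n + 1)), X) :=
  TopCat.toSSetObjEquiv X (Opposite.op (SimplexCategory.mk n))

theorem ev_face (X : TopCat.{0}) (n : ℕ) (i : Fin (n + 2)) (σ : Sx X (n + 1)) (x : stdSimplex ℝ (Fin (n + 1))) :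
    ev X n ((TopCat.toSSet.obj X).δ i σ) x = ev X (n + 1) σ (stdSimplex.map (Fin.succAbove i) x) := rfl

/-- basis elements -/
noncomputable def bas (X : TopCat.{0}) (n : ℕ) (σ : Sx X n) : ((singularChainComplexFunctor ℤ).obj X).X n :=
  ModuleCat.freeMk (R := ℤ) σ

theorem mod_sum_apply {ι : Type} (s : Finset ι) {M N : ModuleCat.{0} ℤ} (k : ι → ℤ) (φ : ι → (M ⟶ N)) (x : M) :
    (∑ i ∈ s, k i • φ i) x = ∑ i ∈ s, k i • φ i x := by
  change (ModuleCat.Hom.hom (∑ i ∈ s, k i • φ i : M ⟶ N)) x = _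
  rw [ModuleCat.hom_sum, LinearMap.sum_apply]
  rfl

theorem d_bas (X : TopCat.{0}) (n : ℕ) (σ : Sx X (n + 1)) :
    ((singularChainComplexFunctor ℤ).obj X).d (n + 1) n (bas X (n + 1) σ) =
      ∑ i : Fin (n + 2), (-1 : ℤ) ^ (i : ℕ) • bas X n ((TopCat.toSSet.obj X).δ i σ) := by
  have h : ((singularChainComplexFunctor ℤ).obj X).d (n + 1) n =
    ∑ i : Fin (n + 2), (-1 : ℤ) ^ (i : ℕ) • SimplicialObject.δ ((((SimplicialObject.whiskering _ _).obj (ModuleCat.free ℤ))).obj (TopCat.toSSet.obj X)) i :=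
    AlgebraicTopology.alternatingFaceMapComplex_obj_d _ _
  rw [h]
  refine (mod_sum_apply _ _ _ _).trans ?_
  refine Finset.sum_congr rfl fun i _ => ?_
  congr 1
  exact ModuleCat.free_map_apply (R := ℤ) _ _

theorem chain_ext (X : TopCat.{0}) (n : ℕ) {A : Type} [AddCommGroup A]
    (φ ψ : ((singularChainComplexFunctor ℤ).obj X).X n →+ A)
    (h : ∀ σ, φ (bas X n σ) = ψ (bas X n σ)) : φ = ψ := by
  have h2 : (φ.toIntLinearMap : (Sx X n →₀ ℤ) →ₗ[ℤ] A) = (ψ.toIntLinearMap : (Sx X n →₀ ℤ) →ₗ[ℤ] A) :=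
    Finsupp.lhom_ext' fun σ => LinearMap.ext_ring (h σ)
  ext x
  exact congrArg (fun (T : (Sx X n →₀ ℤ) →ₗ[ℤ] A) => T x) h2

theorem chain_lift (X : TopCat.{0}) (n : ℕ) {A : Type} [AddCommGroup A] (g : Sx X n → A) :
    ∃ φ : ((singularChainComplexFunctor ℤ).obj X).X n →ₗ[ℤ] A, ∀ σ, φ (bas X n σ) = g σ := by
  refine ⟨(Finsupp.lift A ℤ (Sx X n) g : (Sx X n →₀ ℤ) →ₗ[ℤ] A), fun σ => ?_⟩
  change Finsupp.lift A ℤ (Sx X n) g (Finsupp.single σ 1) = g σ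
  simp

end INNC
end

section
namespace INNC
open Topology

theorem map_succAbove (n : ℕ) (i : Fin (n + 2)) (x : stdSimplex ℝ (Fin (n + 1))) (k : Fin (n + 1)) :
    (stdSimplex.map (Fin.succAbove i) x) (Fin.succAbove i k) = x k := by
  rw [stdSimplex.map_coe, FunOnFinite.linearMap_apply_apply]
  have : (Finset.univ.filter fun y : Fin (n + 1) => i.succAbove y = i.succAbove k) = {k} := by
    ext y; simp
  rw [this, Finset.sum_singleton]

theorem map_succAbove_self (n : ℕ) (i : Fin (n + 2)) (x : stdSimplex ℝ (Fin (n + 1))) :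
    (stdSimplex.map (Fin.succAbove i) x) i = 0 := by
  rw [stdSimplex.map_coe, FunOnFinite.linearMap_apply_apply]
  have : (Finset.univ.filter fun y : Fin (n + 1) => i.succAbove y = i) = ∅ := by
    ext y; simp
  rw [this, Finset.sum_empty]

/-- point of the 1-simplex -/
noncomputable def pt (t : unitInterval) : stdSimplex ℝ (Fin 2) :=
  ⟨![1 - (t : ℝ), t], by
    refine ⟨fun i => ?_, ?_⟩
    · fin_cases i
      · simpa using t.2.2
      · simpa using t.2.1
    · simp [Fin.sum_univ_two]⟩

/-- coordinate of the 1-simplex -/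
noncomputable def co (x : stdSimplex ℝ (Fin 2)) : unitInterval :=
  ⟨x 1, stdSimplex.zero_le x 1, stdSimplex.le_one x 1⟩

theorem pt_cont : Continuous pt := by
  refine Continuous.subtype_mk ?_ _
  refine continuous_pi fun i => ?_
  fin_cases i
  · change Continuous fun t : unitInterval => 1 - (t : ℝ)
    fun_prop
  · simpa using continuous_subtype_val

theorem co_cont : Continuous co := by
  refine Continuous.subtype_mk ?_ _
  exact (continuous_apply 1).comp continuous_subtype_val

theorem sum2 (x : stdSimplex ℝ (Fin 2)) : x 0 + x 1 = 1 := by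
  have := stdSimplex.sum_eq_one x
  rwa [Fin.sum_univ_two] at this

theorem pt_co (x) : pt (co x) = x := by
  apply stdSimplex.ext
  funext i
  have := sum2 x
  fin_cases i
  · change 1 - x 1 = x 0
    linarith
  · rfl

theorem pt0 (t) : pt t 0 = 1 - (t : ℝ) := rfl
theorem pt1 (t) : pt t 1 = (t : ℝ) := rfl
theorem co_pt (t) : co (pt t) = t := rfl

/-- retraction to the 2-simplex -/
noncomputable def retr (u : ℝ × ℝ) : stdSimplex ℝ (Fin 3) :=
  ⟨![1 - max 0 (min 1 u.1) - max 0 (min (1 - max 0 (min 1 u.1)) u.2), max 0 (min 1 u.1),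
      max 0 (min (1 - max 0 (min 1 u.1)) u.2)], by
    have h1 : max 0 (min 1 u.1) ≤ 1 := max_le (by norm_num) (min_le_left _ _)
    have h2 : max 0 (min (1 - max 0 (min 1 u.1)) u.2) ≤ 1 - max 0 (min 1 u.1) :=
      max_le (by linarith) (min_le_left _ _)
    refine ⟨fun i => ?_, ?_⟩
    · fin_cases i
      · change 0 ≤ 1 - max 0 (min 1 u.1) - max 0 (min (1 - max 0 (min 1 u.1)) u.2)
        linarith
      · exact le_max_left _ _
      · exact le_max_left _ _
    · simp [Fin.sum_univ_three]
      ring⟩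

theorem retr_cont : Continuous retr := by
  refine Continuous.subtype_mk ?_ _
  refine continuous_pi fun i => ?_
  fin_cases i
  · change Continuous fun u : ℝ × ℝ => 1 - max 0 (min 1 u.1) - max 0 (min (1 - max 0 (min 1 u.1)) u.2)
    fun_prop
  · change Continuous fun u : ℝ × ℝ => max 0 (min 1 u.1)
    fun_prop
  · change Continuous fun u : ℝ × ℝ => max 0 (min (1 - max 0 (min 1 u.1)) u.2)
    fun_prop

theorem retr_self (x : stdSimplex ℝ (Fin 3)) : retr (x 1, x 2) = x := by
  have hs : x 0 + x 1 + x 2 = 1 := by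
    have := stdSimplex.sum_eq_one x
    rwa [Fin.sum_univ_three] at this
  have h0 := stdSimplex.zero_le x 0
  have h1 := stdSimplex.zero_le x 1
  have h2 := stdSimplex.zero_le x 2
  have e1 : max 0 (min 1 (x 1)) = x 1 := by
    rw [min_eq_right (by linarith), max_eq_right h1]
  have e2 : max 0 (min (1 - x 1) (x 2)) = x 2 := by
    rw [min_eq_right (by linarith), max_eq_right h2]
  apply stdSimplex.ext
  funext i
  fin_cases i
  · change 1 - max 0 (min 1 (x 1)) - max 0 (min (1 - max 0 (min 1 (x 1))) (x 2)) = x 0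
    rw [e1, e2]; linarith
  · exact e1
  · change max 0 (min (1 - max 0 (min 1 (x 1))) (x 2)) = x 2
    rw [e1, e2]

section
variable {V : Type} [NormedAddCommGroup V] {Y : Set V}

/-- path of a singular 1-simplex -/
noncomputable def pth (σ : Sx (TopCat.of Y) 1) (t : unitInterval) : V := (ev (TopCat.of Y) 1 σ (pt t) : Y).1

theorem pth_cont (σ : Sx (TopCat.of Y) 1) : Continuous (pth σ) :=
  continuous_subtype_val.comp ((ev (TopCat.of Y) 1 σ).continuous.comp pt_cont)

theorem pth_mem (σ : Sx (TopCat.of Y) 1) (t) : pth σ t ∈ Y := (ev (TopCat.of Y) 1 σ (pt t) : Y).2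

/-- singular simplex of a path -/
noncomputable def spx (γ : unitInterval → V) (h : Continuous γ ∧ ∀ t, γ t ∈ Y) : Sx (TopCat.of Y) 1 :=
  (ev (TopCat.of Y) 1).symm ⟨fun x => (⟨γ (co x), h.2 _⟩ : Y), (h.1.comp co_cont).subtype_mk _⟩

theorem ev_spx (γ : unitInterval → V) (h : Continuous γ ∧ ∀ t, γ t ∈ Y) (x) :
    (ev (TopCat.of Y) 1 (spx γ h) x : Y).1 = γ (co x) := by
  rw [spx, Equiv.apply_symm_apply]; rfl

theorem pth_spx (γ : unitInterval → V) (h : Continuous γ ∧ ∀ t, γ t ∈ Y) : pth (spx γ h) = γ := by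
  funext t
  rw [pth, ev_spx, co_pt]

theorem sx_ext {n : ℕ} (σ τ : Sx (TopCat.of Y) n) (h : ∀ x, (ev (TopCat.of Y) n σ x : Y).1 = (ev (TopCat.of Y) n τ x : Y).1) : σ = τ := by
  apply (ev (TopCat.of Y) n).injective
  apply ContinuousMap.ext
  intro x
  exact Subtype.ext (h x)

theorem spx_pth (σ : Sx (TopCat.of Y) 1) (h) : spx (pth σ) h = σ := by
  apply sx_ext
  intro x
  rw [ev_spx, pth, pt_co]

theorem pth_face (τ : Sx (TopCat.of Y) 2) (i : Fin 3) (t : unitInterval) (u : ℝ × ℝ)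
    (hu : stdSimplex.map (Fin.succAbove i) (pt t) = retr u) :
    pth ((TopCat.toSSet.obj (TopCat.of Y)).δ i τ) t = (ev (TopCat.of Y) 2 τ (retr u) : Y).1 := by
  rw [pth, ev_face, hu]

theorem face0 (x : stdSimplex ℝ (Fin 2)) : (stdSimplex.map (Fin.succAbove (0 : Fin 3)) x) 1 = x 0 ∧
    (stdSimplex.map (Fin.succAbove (0 : Fin 3)) x) 2 = x 1 :=
  ⟨map_succAbove 1 0 x 0, map_succAbove 1 0 x 1⟩
theorem face1 (x : stdSimplex ℝ (Fin 2)) : (stdSimplex.map (Fin.succAbove (1 : Fin 3)) x) 1 = 0 ∧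
    (stdSimplex.map (Fin.succAbove (1 : Fin 3)) x) 2 = x 1 :=
  ⟨map_succAbove_self 1 1 x, map_succAbove 1 1 x 1⟩
theorem face2 (x : stdSimplex ℝ (Fin 2)) : (stdSimplex.map (Fin.succAbove (2 : Fin 3)) x) 1 = x 1 ∧
    (stdSimplex.map (Fin.succAbove (2 : Fin 3)) x) 2 = 0 :=
  ⟨map_succAbove 1 2 x 1, map_succAbove_self 1 2 x⟩

theorem coc_simplex {A : Type} [AddCommGroup A] {c : (unitInterval → V) → A} (hc : IsCoc Y c)
    (τ : Sx (TopCat.of Y) 2) :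
    c (pth ((TopCat.toSSet.obj (TopCat.of Y)).δ 2 τ)) + c (pth ((TopCat.toSSet.obj (TopCat.of Y)).δ 0 τ))
      = c (pth ((TopCat.toSSet.obj (TopCat.of Y)).δ 1 τ)) := by
  have := hc (fun u => (ev (TopCat.of Y) 2 τ (retr u) : Y).1)
    (continuous_subtype_val.comp ((ev (TopCat.of Y) 2 τ).continuous.comp retr_cont)) (fun u => Subtype.prop _)
  convert this using 3
  · funext t
    refine pth_face τ 2 t _ ?_
    rw [← retr_self (stdSimplex.map (Fin.succAbove (2 : Fin 3)) (pt t)), (face2 _).1, (face2 _).2]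
    congr 1
    ext <;> simp [pt0, pt1]
  · funext t
    refine pth_face τ 0 t _ ?_
    rw [← retr_self (stdSimplex.map (Fin.succAbove (0 : Fin 3)) (pt t)), (face0 _).1, (face0 _).2]
    congr 1
    ext <;> simp [pt0, pt1, sub_eq_add_neg]
  · funext t
    refine pth_face τ 1 t _ ?_
    rw [← retr_self (stdSimplex.map (Fin.succAbove (1 : Fin 3)) (pt t)), (face1 _).1, (face1 _).2]
    congr 1
    ext <;> simp [pt0, pt1]

/-- singular simplex of a map of the plane -/
noncomputable def tri (G : ℝ × ℝ → V) (h : Continuous G ∧ ∀ t, G t ∈ Y) : Sx (TopCat.of Y) 2 :=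
  (ev (TopCat.of Y) 2).symm ⟨fun x => (⟨G (x 1, x 2), h.2 _⟩ : Y), by
    refine (h.1.comp ?_).subtype_mk _
    exact ((continuous_apply 1).comp continuous_subtype_val).prodMk
      ((continuous_apply 2).comp continuous_subtype_val)⟩

theorem ev_tri (G : ℝ × ℝ → V) (h : Continuous G ∧ ∀ t, G t ∈ Y) (x) :
    (ev (TopCat.of Y) 2 (tri G h) x : Y).1 = G (x 1, x 2) := by
  rw [tri, Equiv.apply_symm_apply]; rfl

theorem face_tri (G : ℝ × ℝ → V) (h : Continuous G ∧ ∀ t, G t ∈ Y) (i : Fin 3) (γ) (hγ)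
    (he : ∀ x : stdSimplex ℝ (Fin 2), G ((stdSimplex.map (Fin.succAbove i) x) 1, (stdSimplex.map (Fin.succAbove i) x) 2) = γ (co x)) :
    (TopCat.toSSet.obj (TopCat.of Y)).δ i (tri G h) = spx γ hγ := by
  apply sx_ext
  intro x
  rw [ev_face, ev_tri, ev_spx, he]

theorem d_bas2 (τ : Sx (TopCat.of Y) 2) :
    ((singularChainComplexFunctor ℤ).obj (TopCat.of Y)).d 2 1 (bas (TopCat.of Y) 2 τ) =
      bas (TopCat.of Y) 1 ((TopCat.toSSet.obj (TopCat.of Y)).δ 0 τ)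
      - bas (TopCat.of Y) 1 ((TopCat.toSSet.obj (TopCat.of Y)).δ 1 τ)
      + bas (TopCat.of Y) 1 ((TopCat.toSSet.obj (TopCat.of Y)).δ 2 τ) := by
  rw [d_bas, Fin.sum_univ_three]
  simp [sub_eq_add_neg]

theorem d_bas1 (τ : Sx (TopCat.of Y) 1) :
    ((singularChainComplexFunctor ℤ).obj (TopCat.of Y)).d 1 0 (bas (TopCat.of Y) 1 τ) =
      bas (TopCat.of Y) 0 ((TopCat.toSSet.obj (TopCat.of Y)).δ 0 τ)
      - bas (TopCat.of Y) 0 ((TopCat.toSSet.obj (TopCat.of Y)).δ 1 τ) := by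
  rw [d_bas, Fin.sum_univ_two]
  simp [sub_eq_add_neg]

open Classical in
theorem raw_isCoc {A : Type} [AddCommGroup A]
    (c : ((singularChainComplexFunctor ℤ).obj (TopCat.of Y)).X 1 →+ A)
    (hc : ∀ t, c (((singularChainComplexFunctor ℤ).obj (TopCat.of Y)).d 2 1 t) = 0) :
    IsCoc Y (fun γ => if h : Continuous γ ∧ ∀ t, γ t ∈ Y then c (bas (TopCat.of Y) 1 (spx γ h)) else 0) := by
  intro G hG hGY
  have hs : ∀ x y : ℝ × ℝ, Continuous (seg G x y) ∧ ∀ t, seg G x y t ∈ Y := by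
    intro x y
    refine ⟨?_, fun t => hGY _⟩
    unfold seg
    fun_prop
  simp only [hs, dif_pos, implies_true, and_self]
  have h0 := hc (bas (TopCat.of Y) 2 (tri G ⟨hG, hGY⟩))
  rw [d_bas2, map_add, map_sub,
    face_tri G ⟨hG, hGY⟩ 0 (seg G (1, 0) (0, 1)) (hs _ _) ?_,
    face_tri G ⟨hG, hGY⟩ 1 (seg G (0, 0) (0, 1)) (hs _ _) ?_,
    face_tri G ⟨hG, hGY⟩ 2 (seg G (0, 0) (1, 0)) (hs _ _) ?_] at h0
  · rw [← sub_eq_zero, ← h0]; abel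
  · intro x
    rw [(face2 x).1, (face2 x).2]
    unfold seg; congr 1; ext <;> simp [co]
  · intro x
    rw [(face1 x).1, (face1 x).2]
    unfold seg; congr 1; ext <;> simp [co]
  · intro x
    rw [(face0 x).1, (face0 x).2]
    have := sum2 x
    unfold seg; congr 1; ext <;> simp [co]
    linarith

/-- the point of a 0-simplex -/
noncomputable def pnt (σ : Sx (TopCat.of Y) 0) : V := (ev (TopCat.of Y) 0 σ ⟨fun _ => 1, by simp [stdSimplex]⟩ : Y).1

theorem sx0_ext (σ τ : Sx (TopCat.of Y) 0) (h : pnt σ = pnt τ) : σ = τ := by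
  apply sx_ext
  intro x
  have : x = ⟨fun _ => 1, by simp [stdSimplex]⟩ := by
    apply stdSimplex.ext
    funext i
    have := stdSimplex.sum_eq_one x
    fin_cases i
    simp
  rw [this]; exact h

theorem pnt_face (σ : Sx (TopCat.of Y) 1) :
    pnt ((TopCat.toSSet.obj (TopCat.of Y)).δ 0 σ) = pth σ 1 ∧
    pnt ((TopCat.toSSet.obj (TopCat.of Y)).δ 1 σ) = pth σ 0 := by
  constructor
  · rw [pnt, ev_face, pth]
    congr 2
    rw [← pt_co (stdSimplex.map _ _)]
    congr 1
    apply Subtype.ext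
    exact map_succAbove 0 0 _ 0
  · rw [pnt, ev_face, pth]
    congr 2
    rw [← pt_co (stdSimplex.map _ _)]
    congr 1
    apply Subtype.ext
    exact map_succAbove_self 0 1 _
end

theorem final {V : Type} [NormedAddCommGroup V] {Y : Set V} {r : ℕ} (f : Fin r → V → ℂ)
    (hfc : ∀ i, ContinuousOn (f i) Y) (hf0 : ∀ i, ∀ y ∈ Y, f i y ≠ 0)
    (hm : ∀ i, ∃ γ : unitInterval → V, Continuous γ ∧ (∀ t, γ t ∈ Y) ∧ γ 0 = γ 1 ∧
      ∀ j, wind (fun t => f j (γ t)) = if j = i then 1 else 0)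
    (hg : ∀ c : (unitInterval → V) → AddCircle (1 : ℚ), IsCoc Y c →
      ∃ (a : Fin r → AddCircle (1 : ℚ)) (b : V → AddCircle (1 : ℚ)), ∀ γ : unitInterval → V, Continuous γ →
        (∀ t, γ t ∈ Y) → c γ = b (γ 1) - b (γ 0) + ∑ i, wind (fun t => f i (γ t)) • a i) :
    Nonempty (((singularHomologyFunctor ℤ 1).obj (TopCat.of Y)) ≃ₗ[ℤ] (Fin r → ℤ)) := by
  classical
  obtain ⟨w, hw⟩ := chain_lift (TopCat.of Y) 1 (A := Fin r → ℤ) (fun σ => fun i => wind (fun t => f i (pth σ t)))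
  refine homology_equiv ((singularChainComplexFunctor ℤ).obj (TopCat.of Y)) (r := r) (ModuleCat.ofHom w) ?_ ?_ ?_
  · ext1
    have := chain_ext (TopCat.of Y) 2
      ((w.comp (((singularChainComplexFunctor ℤ).obj (TopCat.of Y)).d 2 1).hom).toAddMonoidHom) 0 (by
        intro τ
        change w (((singularChainComplexFunctor ℤ).obj (TopCat.of Y)).d 2 1 (bas (TopCat.of Y) 2 τ)) = 0
        rw [d_bas2, map_add, map_sub, hw, hw, hw]
        funext i
        have := coc_simplex (wind_isCoc (hfc i) (hf0 i)) τ
        simp only [Pi.add_apply, Pi.sub_apply, Pi.zero_apply]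
        rw [← this]; ring)
    apply LinearMap.ext
    intro x
    exact DFunLike.congr_fun this x
  · intro i
    obtain ⟨γ, h1, h2, h3, h4⟩ := hm i
    refine ⟨bas (TopCat.of Y) 1 (spx γ ⟨h1, h2⟩), ?_, ?_⟩
    · rw [d_bas1, sub_eq_zero]
      congr 1
      apply sx0_ext
      rw [(pnt_face _).1, (pnt_face _).2, pth_spx, h3]
    · refine (hw _).trans ?_
      funext j
      rw [pth_spx, h4, Pi.single_apply]
  · intro c hc z hz hwz
    obtain ⟨a, b, hab⟩ := hg _ (raw_isCoc c hc)
    obtain ⟨B, hB⟩ := chain_lift (TopCat.of Y) 0 (fun σ => b (pnt σ))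
    have := chain_ext (TopCat.of Y) 1 c
      ((B.comp (((singularChainComplexFunctor ℤ).obj (TopCat.of Y)).d 1 0).hom).toAddMonoidHom
       + ∑ i, (((LinearMap.toSpanSingleton ℤ _ (a i)).comp ((LinearMap.proj i).comp w)).toAddMonoidHom)) (by
        intro σ
        have h := hab (pth σ) (pth_cont σ) (pth_mem σ)
        rw [dif_pos ⟨pth_cont σ, pth_mem σ⟩, spx_pth] at h
        rw [h, AddMonoidHom.add_apply, AddMonoidHom.finsetSum_apply]
        change _ = B (((singularChainComplexFunctor ℤ).obj (TopCat.of Y)).d 1 0 (bas (TopCat.of Y) 1 σ)) +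
          ∑ i, (w (bas (TopCat.of Y) 1 σ) i) • a i
        rw [d_bas1, map_sub, hB, hB, hw, (pnt_face _).1, (pnt_face _).2])
    rw [this, AddMonoidHom.add_apply, AddMonoidHom.finsetSum_apply]
    change B (((singularChainComplexFunctor ℤ).obj (TopCat.of Y)).d 1 0 z) + ∑ i, (w z i) • a i = 0
    have hwz' : w z = 0 := hwz
    rw [hz, hwz']
    simp

end INNC
end

theorem stmt0 (n r : ℕ) (hn : 2 ≤ n) (hr : 1 ≤ r)
    -- the germs `f i` are holomorphic on an open neighborhood `Ω` of `0` and vanish at `0`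
    (f : Fin r → EuclideanSpace ℂ (Fin (n + 1)) → ℂ)
    (Ω : Set (EuclideanSpace ℂ (Fin (n + 1))))
    (hΩ : IsOpen Ω) (h0Ω : (0 : EuclideanSpace ℂ (Fin (n + 1))) ∈ Ω)
    (hf : ∀ i, ∀ x ∈ Ω, AnalyticAt ℂ (f i) x)
    (hf0 : ∀ i, f i 0 = 0)
    -- the hypersurfaces `D i` and their union `X`
    (D : Fin r → Set (EuclideanSpace ℂ (Fin (n + 1))))
    (hD : ∀ i, D i = {x ∈ Ω | f i x = 0})
    (X : Set (EuclideanSpace ℂ (Fin (n + 1))))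
    (hX : X = ⋃ i, D i)
    -- irreducibility of the germs: each `D i ∩ S_ε` is connected for small `ε`
    (hirr : ∃ ε₁ > (0 : ℝ), ∀ ε, 0 < ε → ε < ε₁ →
      ∀ i, IsConnected (D i ∩ Metric.sphere (0 : EuclideanSpace ℂ (Fin (n + 1))) ε))
    -- isolated non-normal crossing: normal crossings away from the origin
    (hINNC : ∀ p ∈ X, p ≠ 0 →
      LinearIndependent ℂ (fun i : {i : Fin r // f i p = 0} => fderiv ℂ (f i.1) p)) :
    -- conclusion: `H₁(S_ε \ X; ℤ) ≅ ℤ^r` for all sufficiently small `ε`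
    ∃ ε₀ > (0 : ℝ), Metric.closedBall (0 : EuclideanSpace ℂ (Fin (n + 1))) ε₀ ⊆ Ω ∧
      ∀ ε, 0 < ε → ε < ε₀ →
        Nonempty
          (((singularHomologyFunctor ℤ 1).obj
              (TopCat.of
                ↥(Metric.sphere (0 : EuclideanSpace ℂ (Fin (n + 1))) ε \ X))) ≃ₗ[ℤ]
            (Fin r → ℤ)) := by
  obtain ⟨ε₁, hε₁, hirr⟩ := hirr
  obtain ⟨ρ, hρ, hρΩ⟩ := Metric.isOpen_iff.1 hΩ 0 h0Ω
  choose δ hδ hδ' using fun I : Finset (Fin r) => INNC.transverse f (fun i => hf i 0 h0Ω) I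
  have hex : ∃ δ₀ > (0 : ℝ), ∀ I, δ₀ ≤ δ I :=
    ⟨Finset.univ.inf' Finset.univ_nonempty δ, (Finset.lt_inf'_iff _).2 fun I _ => hδ I,
      fun I => Finset.inf'_le _ (Finset.mem_univ I)⟩
  obtain ⟨δ₀, hδ₀, hδI⟩ := hex
  refine ⟨min (ρ / 2) (min ε₁ δ₀), lt_min (half_pos hρ) (lt_min hε₁ hδ₀), ?_, ?_⟩
  · refine (Metric.closedBall_subset_ball ?_).trans hρΩ
    exact (min_le_left _ _).trans_lt (half_lt_self hρ)
  intro ε hε hlt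
  have hl1 : ε < ρ := by linarith [hlt.trans_le (min_le_left _ _)]
  have hl2 : ε < ε₁ := hlt.trans_le ((min_le_right _ _).trans (min_le_left _ _))
  have hl3 : ε < δ₀ := hlt.trans_le ((min_le_right _ _).trans (min_le_right _ _))
  have hSΩ : ∀ x : EuclideanSpace ℂ (Fin (n + 1)), ‖x‖ = ε → x ∈ Ω := fun x hx => hρΩ (by
    rw [Metric.mem_ball, dist_zero_right, hx]; exact hl1)
  have hY : Metric.sphere (0 : EuclideanSpace ℂ (Fin (n + 1))) ε \ X = {x | ‖x‖ = ε ∧ ∀ i, f i x ≠ 0} := by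
    ext x
    simp only [hX, hD, Set.mem_diff, mem_sphere_zero_iff_norm, Set.mem_iUnion, Set.mem_setOf_eq, not_exists, not_and]
    constructor
    · rintro ⟨h1, h2⟩
      exact ⟨h1, fun i => h2 i (hSΩ x h1)⟩
    · rintro ⟨h1, h2⟩
      exact ⟨h1, fun i _ => h2 i⟩
  have hDS : ∀ i, D i ∩ Metric.sphere (0 : EuclideanSpace ℂ (Fin (n + 1))) ε = {x | ‖x‖ = ε ∧ f i x = 0} := by
    intro i
    ext x
    simp only [hD, Set.mem_inter_iff, mem_sphere_zero_iff_norm, Set.mem_setOf_eq]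
    constructor
    · rintro ⟨⟨_, h1⟩, h2⟩
      exact ⟨h2, h1⟩
    · rintro ⟨h1, h2⟩
      exact ⟨⟨hSΩ x h1, h2⟩, h1⟩
  have hgood : ∀ p : EuclideanSpace ℂ (Fin (n + 1)), ‖p‖ = ε → ∀ O ∈ nhds p, ∃ N, IsOpen N ∧ p ∈ N ∧ N ⊆ O ∧
      INNC.Good f (Metric.sphere (0 : EuclideanSpace ℂ (Fin (n + 1))) ε \ X) N {i | f i p = 0} := by
    intro p hp O hO
    classical
    have hp0 : p ≠ 0 := by
      rintro rfl
      rw [norm_zero] at hp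
      exact hε.ne hp
    have hli : LinearIndependent ℂ (fun i : {i : Fin r // f i p = 0} => fderiv ℂ (f i.1) p) := by
      by_cases h : ∃ i, f i p = 0
      · obtain ⟨i, hi⟩ := h
        refine hINNC p ?_ hp0
        rw [hX]
        refine Set.mem_iUnion.2 ⟨i, ?_⟩
        rw [hD]
        exact ⟨hSΩ p hp, hi⟩
      · have : IsEmpty {i : Fin r // f i p = 0} := ⟨fun i => h ⟨i.1, i.2⟩⟩
        exact linearIndependent_empty_type
    obtain ⟨v, hv, hpv⟩ := hδ' (Finset.univ.filter fun i => f i p = 0) p hp0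
      (by rw [hp]; exact hl3.trans_le (hδI _)) (fun i hi => (Finset.mem_filter.1 hi).2)
    obtain ⟨N, h1, h2, h3, h4⟩ := INNC.exists_good f p (fun i => hf i p (hSΩ p hp)) hli v
      (fun i hi => hv i (Finset.mem_filter.2 ⟨Finset.mem_univ i, hi⟩)) hpv O hO
    refine ⟨N, h1, h2, h3, ?_⟩
    rw [hY, ← hp]
    exact h4
  have hfc : ∀ i, ContinuousOn (f i) (Metric.sphere (0 : EuclideanSpace ℂ (Fin (n + 1))) ε \ X) := by
    intro i x hx
    exact (hf i x (hSΩ x (mem_sphere_zero_iff_norm.1 hx.1))).continuousAt.continuousWithinAt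
  refine INNC.final f hfc ?_ ?_ ?_
  · intro i y hy
    rw [hY] at hy
    exact hy.2 i
  · intro i
    obtain ⟨p, hp⟩ := (hirr ε hε hl2 i).nonempty
    rw [hDS] at hp
    obtain ⟨N, _, _, _, hN⟩ := hgood p hp.1 Set.univ Filter.univ_mem
    obtain ⟨γ, h1, h2, h3, h4⟩ := hN.merid i hp.2
    exact ⟨γ, h1, fun t => (h2 t).2, h3, h4⟩
  · intro c hc
    let _inst : InnerProductSpace ℝ (EuclideanSpace ℂ (Fin (n + 1))) := InnerProductSpace.complexToReal
    refine INNC.globalize (2 * n + 1) (by omega) ?_ ε hε f _ hY hfc hgood ?_ c hc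
    · rw [finrank_real_of_complex, finrank_euclideanSpace_fin]
      ring
    · intro i
      rw [← hDS]
      exact (hirr ε hε hl2 i).isPreconnected
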